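/- arXiv:2103.11767 — 3 statements merged into one kernel-verified Lean document; each statement's English description precedes it below -/
import Mathlib

section
/- Let F be a family of meromorphic functions on a domain D. Suppose there exists ε > 0 such that for each f in F there are three functions a_{1f}, a_{2f}, a_{3f}, each meromorphic on D or identically ∞, with spherical distance σ(a_{jf}(z), a_{kf}(z)) ≥ ε for all j ≠ k and all z in D, and suppose that for every pair f, g in F and each j = 1,2,3 the functions f − a_{jf} and g − a_{jg} share the value 0 in D (i.e., have the same zero sets). Then F is normal in D. -/
open Filter Topology OnePoint Metric
open scoped Classical

noncomputable def chord : OnePoint ℂ → OnePoint ℂ → ℝ := fun x y =>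
  Option.elim (α := ℂ) x
    (Option.elim (α := ℂ) y 0 (fun b => 2 / Real.sqrt (1 + ‖b‖ ^ 2)))
    (fun a =>
      Option.elim (α := ℂ) y (2 / Real.sqrt (1 + ‖a‖ ^ 2))
        (fun b => 2 * ‖a - b‖ / Real.sqrt ((1 + ‖a‖ ^ 2) * (1 + ‖b‖ ^ 2))))

/-- spherical (arclength) metric on the Riemann sphere, diameter π -/
noncomputable def sph (x y : OnePoint ℂ) : ℝ := 2 * Real.arcsin (chord x y / 2)

/-- value of a meromorphic function as a point of the Riemann sphere -/
noncomputable def sphVal (f : ℂ → ℂ) (z : ℂ) : OnePoint ℂ :=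
  if Tendsto (fun w => ‖f w‖) (𝓝[≠] z) atTop then ∞
  else (((limUnder (𝓝[≠] z) f : ℂ) : OnePoint ℂ))

def IsMeroSphere (D : Set ℂ) (A : ℂ → OnePoint ℂ) : Prop :=
  ∃ a : ℂ → ℂ, MeromorphicOn a D ∧ ∀ z ∈ D, A z = sphVal a z

def IsMeroSphereOrInf (D : Set ℂ) (A : ℂ → OnePoint ℂ) : Prop :=
  IsMeroSphere D A ∨ ∀ z ∈ D, A z = ∞

/-- Normality: every sequence has a subsequence converging locally uniformly (spherically)
to a meromorphic function or to ∞. -/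
def NormalOn (D : Set ℂ) (F : Set (ℂ → ℂ)) : Prop :=
  ∀ f : ℕ → ℂ → ℂ, (∀ n, f n ∈ F) →
    ∃ φ : ℕ → ℕ, StrictMono φ ∧ ∃ G : ℂ → OnePoint ℂ,
      IsMeroSphereOrInf D G ∧
      ∀ K : Set ℂ, K ⊆ D → IsCompact K → ∀ ε : ℝ, 0 < ε →
        ∀ᶠ n in atTop, ∀ z ∈ K, sph (sphVal (f (φ n)) z) (G z) < ε

/-- rational map of degree at most m -/
def IsRatDegLE (m : ℕ) (R : ℂ → ℂ) : Prop :=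
  ∃ p q : Polynomial ℂ, q ≠ 0 ∧ p.degree ≤ (m : ℕ) ∧ q.degree ≤ (m : ℕ) ∧
    ∀ z : ℂ, R z = p.eval z / q.eval z



lemma csv_exists_log {f : ℂ → ℂ} {c : ℂ} {R : ℝ} (hR : 0 < R)
    (hf : DifferentiableOn ℂ f (ball c R)) (h0 : ∀ z ∈ ball c R, f z ≠ 0) :
    ∃ L : ℂ → ℂ, DifferentiableOn ℂ L (ball c R) ∧ (∀ z ∈ ball c R, Complex.exp (L z) = f z) ∧
      L c = Complex.log (f c) := by
  have hd : DifferentiableOn ℂ (fun z => deriv f z / f z) (ball c R) :=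
    (hf.deriv isOpen_ball).div hf h0
  obtain ⟨G, hG⟩ := hd.isExactOn_ball
  have hc : c ∈ ball c R := mem_ball_self hR
  refine ⟨fun z => G z - G c + Complex.log (f c), ?_, ?_, by simp⟩
  · intro z hz
    exact (((hG z hz).differentiableAt.sub_const _).add_const _).differentiableWithinAt
  · intro z hz
    have key : ∀ w ∈ ball c R, HasDerivAt (fun w => f w * Complex.exp (-G w)) 0 w := by
      intro w hw
      have h1 : HasDerivAt f (deriv f w) w :=
        (hf.differentiableAt (isOpen_ball.mem_nhds hw)).hasDerivAt
      have h2 := h1.mul ((hG w hw).neg.cexp)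
      convert! h2 using 1
      have := h0 w hw
      field_simp
      ring
    have hcst := isOpen_ball.is_const_of_deriv_eq_zero (convex_ball c R).isPreconnected
      (fun w hw => (key w hw).differentiableAt.differentiableWithinAt)
      (fun w hw => (key w hw).deriv) hz hc
    rw [Complex.exp_add, Complex.exp_log (h0 c hc), Complex.exp_sub]
    rw [Complex.exp_neg, Complex.exp_neg] at hcst
    have e1 := Complex.exp_ne_zero (G z)
    have e2 := Complex.exp_ne_zero (G c)
    field_simp at hcst ⊢
    linear_combination -hcst

lemma csv_surj {h : ℂ → ℂ} {p : ℂ} {t : ℝ} (ht : 0 < t) (hd : DifferentiableOn ℂ h (ball p t))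
    (hp : deriv h p ≠ 0) (hb : ∀ z ∈ ball p t, ‖deriv h z‖ ≤ 2 * ‖deriv h p‖) :
    closedBall (h p) (‖deriv h p‖ * t / 24) ⊆ h '' ball p t := by
  set A := ‖deriv h p‖ with hA
  have hA0 : 0 < A := norm_pos_iff.mpr hp
  have hder : ∀ z ∈ ball p (t/6), ‖deriv h z - deriv h p‖ ≤ A / 2 := by
    intro z hz
    have := Complex.dist_le_div_mul_dist_of_mapsTo_ball (f := deriv h) (c := p) (R₁ := t)
      (R₂ := 3 * A) (z := z) (hd.deriv isOpen_ball) (by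
        intro w hw
        rw [mem_closedBall, dist_eq_norm]
        calc _ ≤ ‖deriv h w‖ + ‖deriv h p‖ := norm_sub_le _ _
          _ ≤ 3 * A := by have := hb w hw; linarith) (ball_subset_ball (by linarith) hz)
    rw [dist_eq_norm] at this
    refine this.trans ?_
    rw [mem_ball] at hz
    calc 3 * A / t * dist z p ≤ 3 * A / t * (t / 6) := by gcongr
      _ = A / 2 := by field_simp; norm_num
  have hlip : ∀ x ∈ ball p (t/6), ∀ y ∈ ball p (t/6),
      ‖(h x - deriv h p * x) - (h y - deriv h p * y)‖ ≤ A / 2 * ‖x - y‖ := by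
    intro x hx y hy
    refine (convex_ball p (t/6)).norm_image_sub_le_of_norm_hasDerivWithin_le
      (f := fun z => h z - deriv h p * z) (f' := fun z => deriv h z - deriv h p) ?_ hder hy hx
    intro z hz
    have h1 : HasDerivAt h (deriv h z) z := (hd.differentiableAt
      (isOpen_ball.mem_nhds (ball_subset_ball (by linarith) hz))).hasDerivAt
    have := h1.sub ((hasDerivAt_id z).const_mul (deriv h p))
    rw [mul_one] at this
    exact this.hasDerivWithinAt
  let f' : ℂ →L[ℂ] ℂ := (deriv h p) • ContinuousLinearMap.id ℂ ℂ
  have happ : ApproximatesLinearOn h f' (ball p (t/6)) (⟨A/2, by positivity⟩ : NNReal) := by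
    intro x hx y hy
    have := hlip x hx y hy
    change _ ≤ A / 2 * ‖x - y‖
    have e : h x - h y - f' (x - y) = (h x - deriv h p * x) - (h y - deriv h p * y) := by
      change h x - h y - deriv h p * (x - y) = _
      ring
    rw [e]; exact this
  let inv : f'.NonlinearRightInverse :=
    { toFun := fun y => (deriv h p)⁻¹ * y
      nnnorm := ⟨A⁻¹, by positivity⟩
      bound' := by intro y; change ‖(deriv h p)⁻¹ * y‖ ≤ A⁻¹ * ‖y‖; simp [hA]
      right_inv' := by intro y; simp [f', hp] }
  have := happ.surjOn_closedBall_of_nonlinearRightInverse inv (ε := t/12) (b := p) (by positivity)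
    (closedBall_subset_ball (by linarith))
  intro y hy
  have hy' : y ∈ closedBall (h p) ((((inv.nnnorm : NNReal) : ℝ)⁻¹ - ((⟨A/2, by positivity⟩ : NNReal) : ℝ)) * (t/12)) := by
    refine closedBall_subset_closedBall ?_ hy
    change _ ≤ ((A⁻¹)⁻¹ - A / 2) * (t / 12)
    rw [inv_inv]
    apply le_of_eq; ring
  obtain ⟨x, hx, rfl⟩ := this hy'
  exact ⟨x, closedBall_subset_ball (by linarith) hx, rfl⟩

/-- Bloch -/
lemma csv_bloch {h : ℂ → ℂ} {z₀ : ℂ} {R : ℝ} (hR : 0 < R) (hd : DifferentiableOn ℂ h (ball z₀ R))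
    {B : ℝ} (hB : ∀ w : ℂ, ∃ v : ℂ, dist v w ≤ B ∧ ∀ z ∈ ball z₀ R, h z ≠ v) :
    ‖deriv h z₀‖ * R ≤ 96 * B := by
  have hB0 : 0 ≤ B := by
    obtain ⟨v, hv, -⟩ := hB 0
    exact dist_nonneg.trans hv
  by_cases h0 : deriv h z₀ = 0
  · simp [h0]; exact hB0
  set r := R / 2 with hr
  have hr0 : 0 < r := by positivity
  have hsub : closedBall z₀ r ⊆ ball z₀ R := closedBall_subset_ball (by rw [hr]; linarith)
  have hcont : ContinuousOn (fun z => ‖deriv h z‖ * (r - dist z z₀)) (closedBall z₀ r) := by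
    refine ContinuousOn.mul ?_ (by fun_prop)
    exact ((hd.deriv isOpen_ball).continuousOn.mono hsub).norm
  obtain ⟨p, hp, hmax⟩ := (isCompact_closedBall z₀ r).exists_isMaxOn
    ⟨z₀, mem_closedBall_self hr0.le⟩ hcont
  have hM := hmax (mem_closedBall_self hr0.le)
  simp only [dist_self, sub_zero, Set.mem_ofPred_eq] at hM
  set t := (r - dist p z₀) / 2 with ht
  have hdp : 0 < ‖deriv h z₀‖ := norm_pos_iff.mpr h0
  have hpos : 0 < ‖deriv h p‖ * (r - dist p z₀) := lt_of_lt_of_le (by positivity) hM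
  have ht0 : 0 < t := by
    have := pos_of_mul_pos_right hpos (norm_nonneg _)
    rw [ht]; linarith
  have hp0 : deriv h p ≠ 0 := by
    intro h; simp [h] at hpos
  have hsub2 : ball p t ⊆ closedBall z₀ r := by
    intro z hz
    rw [mem_ball] at hz; rw [mem_closedBall]
    have := dist_triangle z p z₀
    linarith
  have hbd : ∀ z ∈ ball p t, ‖deriv h z‖ ≤ 2 * ‖deriv h p‖ := by
    intro z hz
    have h1 := hmax (hsub2 hz)
    simp only [Set.mem_ofPred_eq] at h1
    rw [mem_ball] at hz
    have h2 := dist_triangle z p z₀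
    have h3 : t ≤ r - dist z z₀ := by linarith
    have h4 : ‖deriv h z‖ * t ≤ (2 * ‖deriv h p‖) * t := by
      calc ‖deriv h z‖ * t ≤ ‖deriv h z‖ * (r - dist z z₀) := by gcongr
        _ ≤ ‖deriv h p‖ * (r - dist p z₀) := h1
        _ = _ := by rw [ht]; ring
    exact le_of_mul_le_mul_right h4 ht0
  have hs := csv_surj ht0 (hd.mono (hsub2.trans hsub)) hp0 hbd
  obtain ⟨v, hv, hv2⟩ := hB (h p)
  by_contra hcon
  push Not at hcon
  have : v ∈ closedBall (h p) (‖deriv h p‖ * t / 24) := by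
    rw [mem_closedBall]
    refine hv.trans ?_
    have : ‖deriv h p‖ * (r - dist p z₀) = 2 * (‖deriv h p‖ * t) := by rw [ht]; ring
    have h5 : ‖deriv h z₀‖ * R = 2 * (‖deriv h z₀‖ * r) := by rw [hr]; ring
    linarith
  obtain ⟨z, hz, hzv⟩ := hs this
  exact hv2 z (hsub (hsub2 hz)) hzv

/-- density of the exceptional values -/
lemma csv_lattice (w : ℂ) : ∃ v : ℂ, dist v w ≤ 5 ∧ ∃ n : ℕ, Complex.cosh v ^ 2 = n := by
  -- real part
  have hre : ∀ x : ℝ, 0 ≤ x → ∃ y : ℝ, |y - x| ≤ 1 ∧ ∃ n : ℕ, Real.cosh y ^ 2 = n := by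
    intro x hx
    have hinc : Real.cosh x ^ 2 + 1 ≤ Real.cosh (x + 1) ^ 2 := by
      have h1 : 1 ≤ Real.sinh 1 := by
        have := Real.self_le_sinh_iff.mpr (zero_le_one)
        exact this
      have h2 : Real.cosh 1 ^ 2 = Real.sinh 1 ^ 2 + 1 := Real.cosh_sq 1
      have h3 : 0 ≤ Real.sinh x := Real.sinh_nonneg_iff.mpr hx
      have h4 := Real.cosh_pos x
      have h5 := Real.cosh_pos 1
      have h6 := Real.one_le_cosh x
      rw [Real.cosh_add]
      have h7 : 0 ≤ Real.cosh x * Real.cosh 1 * (Real.sinh x * Real.sinh 1) := by positivity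
      have h8 : 1 ≤ Real.sinh 1 ^ 2 := by nlinarith
      nlinarith [mul_pos h4 h4, sq_nonneg (Real.sinh x * Real.sinh 1),
        mul_le_mul_of_nonneg_left h8 (sq_nonneg (Real.cosh x))]
    have hcont : ContinuousOn (fun y : ℝ => Real.cosh y ^ 2) (Set.Icc x (x+1)) := by
      fun_prop
    have hn : (⌈Real.cosh x ^ 2⌉₊ : ℝ) ∈ Set.Icc (Real.cosh x ^ 2) (Real.cosh (x+1) ^ 2) := by
      refine ⟨Nat.le_ceil _, ?_⟩
      exact (Nat.ceil_lt_add_one (by positivity)).le.trans hinc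
    obtain ⟨y, hy, hy2⟩ := intermediate_value_Icc (by linarith) hcont hn
    refine ⟨y, ?_, _, hy2⟩
    rw [abs_le]; constructor <;> linarith [hy.1, hy.2]
  have hre' : ∃ y : ℝ, |y - w.re| ≤ 1 ∧ ∃ n : ℕ, Real.cosh y ^ 2 = n := by
    rcases le_total 0 w.re with h | h
    · exact hre _ h
    · obtain ⟨y, hy, n, hn⟩ := hre (-w.re) (by linarith)
      refine ⟨-y, ?_, n, by simpa using hn⟩
      rw [← abs_neg]; convert hy using 2; ring
  obtain ⟨y, hy, n, hn⟩ := hre'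
  set m : ℤ := ⌊w.im / Real.pi⌋ with hm
  refine ⟨y + (m * Real.pi : ℝ) * Complex.I, ?_, n, ?_⟩
  · rw [dist_eq_norm]
    refine (Complex.norm_le_abs_re_add_abs_im _).trans ?_
    have h1 : |((y : ℂ) + (m * Real.pi : ℝ) * Complex.I - w).re| ≤ 1 := by simpa using hy
    have h2 : |((y : ℂ) + (m * Real.pi : ℝ) * Complex.I - w).im| ≤ 4 := by
      have e : ((y : ℂ) + (m * Real.pi : ℝ) * Complex.I - w).im = m * Real.pi - w.im := by simp
      rw [e, abs_le]
      have h3 := Int.floor_le (w.im / Real.pi)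
      have h4 := Int.lt_floor_add_one (w.im / Real.pi)
      have hpi := Real.pi_pos
      have hpi4 := Real.pi_le_four
      rw [← hm] at h3 h4
      rw [le_div_iff₀ hpi] at h3
      rw [div_lt_iff₀ hpi] at h4
      constructor <;> nlinarith
    linarith
  · have h1 : Complex.cosh ((y : ℂ) + (m * Real.pi : ℝ) * Complex.I) ^ 2
        = Complex.cosh y ^ 2 := by
      rw [Complex.cosh_add, Complex.cosh_mul_I, Complex.sinh_mul_I, ← Complex.ofReal_cos,
        ← Complex.ofReal_sin, Real.sin_int_mul_pi]
      have := Real.cos_sq' (m * Real.pi)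
      rw [Real.sin_int_mul_pi] at this
      have h2 : ((Real.cos (m * Real.pi) : ℝ) : ℂ) ^ 2 = 1 := by
        rw [← Complex.ofReal_pow, this]; simp
      simp only [Complex.ofReal_zero, zero_mul, mul_zero, add_zero, mul_pow, h2, mul_one]
    rw [h1, ← Complex.ofReal_cosh]
    exact_mod_cast hn


/-- holomorphic inverse of `cosh ^ 2` -/
lemma csv_exists_arcosh {g : ℂ → ℂ} {c : ℂ} {R : ℝ} (hR : 0 < R)
    (hg : DifferentiableOn ℂ g (ball c R)) (h0 : ∀ z ∈ ball c R, g z ≠ 0)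
    (h1 : ∀ z ∈ ball c R, g z ≠ 1) :
    ∃ h : ℂ → ℂ, DifferentiableOn ℂ h (ball c R) ∧
      ∀ z ∈ ball c R, Complex.cosh (h z) ^ 2 = g z := by
  obtain ⟨L₁, hL₁, hL₁', -⟩ := csv_exists_log hR hg h0
  obtain ⟨L₂, hL₂, hL₂', -⟩ := csv_exists_log hR (hg.sub_const 1)
    (fun z hz => sub_ne_zero.mpr (h1 z hz))
  have hsq : ∀ w : ℂ, Complex.exp (w / 2) ^ 2 = Complex.exp w := by
    intro w
    rw [← Complex.exp_nat_mul]; congr 1; push_cast; ring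
  set s : ℂ → ℂ := fun z => Complex.exp (L₁ z / 2) with hs
  set r : ℂ → ℂ := fun z => Complex.exp (L₂ z / 2) with hr
  have hs2 : ∀ z ∈ ball c R, s z ^ 2 = g z := fun z hz => by
    simp only [hs]; rw [hsq, hL₁' z hz]
  have hr2 : ∀ z ∈ ball c R, r z ^ 2 = g z - 1 := fun z hz => by
    simp only [hr]; rw [hsq, hL₂' z hz]
  have hprod : ∀ z ∈ ball c R, (s z - r z) * (s z + r z) = 1 := fun z hz => by
    linear_combination hs2 z hz - hr2 z hz
  have hd : DifferentiableOn ℂ (fun z => s z - r z) (ball c R) :=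
    (hL₁.div_const 2).cexp.sub (hL₂.div_const 2).cexp
  obtain ⟨h, hh, hh', -⟩ := csv_exists_log hR hd (fun z hz h => by
    have := hprod z hz
    rw [h] at this; simp at this)
  refine ⟨h, hh, fun z hz => ?_⟩
  have e1 : Complex.exp (-h z) = s z + r z := by
    rw [Complex.exp_neg, hh' z hz]
    exact inv_eq_of_mul_eq_one_right (hprod z hz)
  have : Complex.cosh (h z) = s z := by
    rw [Complex.cosh, e1, hh' z hz]; ring
  rw [this, hs2 z hz]

lemma csv_landau {f : ℂ → ℂ} {z₀ : ℂ} {R : ℝ} (hR : 0 < R)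
    (hd : DifferentiableOn ℂ f (ball z₀ R)) (h0 : ∀ z ∈ ball z₀ R, f z ≠ 0)
    (h1 : ∀ z ∈ ball z₀ R, f z ≠ 1) :
    ‖deriv f z₀‖ * R ≤ 7680 * (‖f z₀‖ * (2 + |Real.log ‖f z₀‖|)) := by
  have hz₀ : z₀ ∈ ball z₀ R := mem_ball_self hR
  obtain ⟨L, hL, hL', hLc⟩ := csv_exists_log hR hd h0
  have hpi : (2 * Real.pi * Complex.I : ℂ) ≠ 0 := Complex.two_pi_I_ne_zero
  set g : ℂ → ℂ := fun z => L z / (2 * Real.pi * Complex.I) with hg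
  have hfg : ∀ z ∈ ball z₀ R, f z = Complex.exp (2 * Real.pi * Complex.I * g z) := fun z hz => by
    rw [← hL' z hz]; congr 1; simp only [hg]; field_simp
  have hgint : ∀ n : ℕ, ∀ z ∈ ball z₀ R, g z ≠ n := by
    intro n z hz he
    apply h1 z hz
    rw [hfg z hz, he, mul_comm]
    exact Complex.exp_nat_mul_two_pi_mul_I n
  obtain ⟨h, hh, hh'⟩ := csv_exists_arcosh (g := g) hR (hL.div_const _)
    (fun z hz => by simpa using hgint 0 z hz) (fun z hz => by simpa using hgint 1 z hz)
  have hbl := csv_bloch hR hh (B := 5) (fun w => by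
    obtain ⟨v, hv, n, hn⟩ := csv_lattice w
    refine ⟨v, hv, fun z hz he => hgint n z hz ?_⟩
    rw [← hn, ← he, hh' z hz])
  have hder : HasDerivAt f (f z₀ * (2 * Real.pi * Complex.I *
      (2 * Complex.cosh (h z₀) * (Complex.sinh (h z₀) * deriv h z₀)))) z₀ := by
    have hd1 : HasDerivAt h (deriv h z₀) z₀ :=
      (hh.differentiableAt (isOpen_ball.mem_nhds hz₀)).hasDerivAt
    have hd2 := (((hd1.ccosh).pow 2).const_mul (2 * Real.pi * Complex.I : ℂ)).cexp
    have heq : f =ᶠ[𝓝 z₀] fun z => Complex.exp (2 * Real.pi * Complex.I * Complex.cosh (h z) ^ 2) := by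
      filter_upwards [isOpen_ball.mem_nhds hz₀] with z hz
      rw [hh' z hz, ← hfg z hz]
    refine HasDerivAt.congr_of_eventuallyEq ?_ heq
    convert! hd2 using 1
    simp only [Pi.pow_apply]
    rw [hh' z₀ hz₀, ← hfg z₀ hz₀]
    simp
  rw [hder.deriv]
  have hcs : ‖Complex.cosh (h z₀) * Complex.sinh (h z₀)‖ ≤ 1 + ‖g z₀‖ := by
    have e : (Complex.cosh (h z₀) * Complex.sinh (h z₀)) ^ 2 = g z₀ * (g z₀ - 1) := by
      rw [mul_pow, Complex.sinh_sq, hh' z₀ hz₀]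
    have e2 : ‖Complex.cosh (h z₀) * Complex.sinh (h z₀)‖ ^ 2 = ‖g z₀‖ * ‖g z₀ - 1‖ := by
      rw [← norm_pow, e, norm_mul]
    have e3 : ‖g z₀ - 1‖ ≤ ‖g z₀‖ + 1 := by
      have := norm_sub_le (g z₀) 1; simpa using this
    refine abs_le_of_sq_le_sq' ?_ (by positivity) |>.2
    rw [e2]
    nlinarith [norm_nonneg (g z₀)]
  have hgn : ‖g z₀‖ ≤ 1 + |Real.log ‖f z₀‖| := by
    have hn : ‖(2 * Real.pi * Complex.I : ℂ)‖ = 2 * Real.pi := by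
      simp [abs_of_pos Real.pi_pos]
    have e : ‖g z₀‖ * (2 * Real.pi) = ‖Complex.log (f z₀)‖ := by
      simp only [hg]
      rw [norm_div, hn, hLc, div_mul_cancel₀]
      positivity
    have e2 : ‖Complex.log (f z₀)‖ ≤ |Real.log ‖f z₀‖| + Real.pi := by
      refine (Complex.norm_le_abs_re_add_abs_im _).trans ?_
      rw [Complex.log_re, Complex.log_im]
      have := Complex.abs_arg_le_pi (f z₀)
      linarith
    have hp3 := Real.pi_gt_three
    nlinarith [abs_nonneg (Real.log ‖f z₀‖), norm_nonneg (g z₀)]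
  have hn : ‖f z₀ * (2 * Real.pi * Complex.I *
      (2 * Complex.cosh (h z₀) * (Complex.sinh (h z₀) * deriv h z₀)))‖
      = ‖f z₀‖ * (4 * Real.pi) * ‖Complex.cosh (h z₀) * Complex.sinh (h z₀)‖ * ‖deriv h z₀‖ := by
    simp only [norm_mul, Complex.norm_real, Complex.norm_I, Complex.norm_ofNat, Real.norm_eq_abs,
      abs_of_pos Real.pi_pos]
    ring
  rw [hn]
  have hpi4 := Real.pi_le_four
  calc ‖f z₀‖ * (4 * Real.pi) * ‖Complex.cosh (h z₀) * Complex.sinh (h z₀)‖ * ‖deriv h z₀‖ * R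
      = ‖f z₀‖ * (4 * Real.pi) * ‖Complex.cosh (h z₀) * Complex.sinh (h z₀)‖ *
        (‖deriv h z₀‖ * R) := by ring
    _ ≤ ‖f z₀‖ * (4 * 4) * (2 + |Real.log ‖f z₀‖|) * (96 * 5) := by
        gcongr
        linarith
    _ = _ := by ring

lemma csv_growth_aux {x : ℝ} (hx : 0 < x) :
    x ^ 2 * (2 + |Real.log x|) ≤ 2 * ((1 + x ^ 2) * (2 + Real.log (1 + x ^ 2))) := by
  have hl : 0 ≤ Real.log (1 + x ^ 2) := Real.log_nonneg (by nlinarith)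
  rcases le_total 1 x with h | h
  · rw [abs_of_nonneg (Real.log_nonneg h)]
    have : Real.log x ≤ Real.log (1 + x ^ 2) := Real.log_le_log hx (by nlinarith)
    have h2 : 0 ≤ Real.log x := Real.log_nonneg h
    nlinarith [mul_le_mul_of_nonneg_left this (sq_nonneg x), mul_nonneg (sq_nonneg x) hl]
  · have := Real.abs_log_mul_self_lt x hx h
    rw [abs_mul, abs_of_pos hx] at this
    have h3 : x ^ 2 * |Real.log x| ≤ 1 := by nlinarith [abs_nonneg (Real.log x)]
    nlinarith [mul_nonneg (sq_nonneg x) hl]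

/-- uniform bound on a smaller ball -/
lemma csv_schottky : ∃ M : ℝ, 0 < M ∧ ∀ (h : ℂ → ℂ) (z₀ : ℂ) (ρ : ℝ), 0 < ρ →
    DifferentiableOn ℂ h (ball z₀ (2 * ρ)) → (∀ z ∈ ball z₀ (2 * ρ), h z ≠ 1) →
    (∀ z ∈ ball z₀ (2 * ρ), z ≠ z₀ → h z ≠ 0) → ‖h z₀‖ ≤ 2 →
    ∀ z ∈ ball z₀ ρ, ‖h z‖ ≤ M := by
  set K : ℝ := 4 * 7680 with hK
  set T : ℝ := Real.log (2 + Real.log (1 + 5 ^ 2)) + K * (2 * Real.pi) with hT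
  set M : ℝ := Real.exp (Real.exp T) + 1 with hM
  refine ⟨M, by positivity, ?_⟩
  intro h z₀ ρ hρ hd h1 h0 hz₀ z hz
  have hsub : closedBall z₀ ρ ⊆ ball z₀ (2 * ρ) := closedBall_subset_ball (by linarith)
  have hcl : closure (ball z₀ ρ) = closedBall z₀ ρ := closure_ball _ hρ.ne'
  have hfr : frontier (ball z₀ ρ) = sphere z₀ ρ := frontier_ball _ hρ.ne'
  -- a point on the circle where `h` is small
  have hζ : ∃ ζ ∈ sphere z₀ ρ, ‖h ζ‖ ≤ 5 := by
    by_contra hcon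
    push Not at hcon
    have hdi : DifferentiableOn ℂ (fun z => (h z - 1)⁻¹) (ball z₀ (2 * ρ)) :=
      (hd.sub_const 1).inv (fun z hz => sub_ne_zero.mpr (h1 z hz))
    have := Complex.norm_le_of_forall_mem_frontier_norm_le (f := fun z => (h z - 1)⁻¹)
      (U := ball z₀ ρ) (C := 1/4) isBounded_ball
      (hdi.mono (hcl.trans_subset hsub)).diffContOnCl (by
        intro w hw
        rw [hfr] at hw
        have h2 := hcon w hw
        have h3 : ‖h w‖ ≤ ‖h w - 1‖ + 1 := by
          have := norm_add_le (h w - 1) 1; simpa using this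
        rw [norm_inv, one_div]
        exact inv_anti₀ (by norm_num) (by linarith)) (subset_closure (mem_ball_self hρ))
    have h3 : ‖h z₀ - 1‖ ≤ 3 := by
      have := norm_sub_le (h z₀) 1
      rw [norm_one] at this
      linarith
    rw [norm_inv, one_div] at this
    have h4 : 0 < ‖h z₀ - 1‖ :=
      norm_pos_iff.mpr (sub_ne_zero.mpr (h1 z₀ (mem_ball_self (by linarith))))
    rw [inv_le_inv₀ h4 (by norm_num)] at this
    linarith
  obtain ⟨ζ, hζ, hζ5⟩ := hζ
  -- growth along the circle
  set γ : ℝ → ℂ := circleMap z₀ ρ with hγ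
  have hγs : ∀ θ, γ θ ∈ sphere z₀ ρ := fun θ => circleMap_mem_sphere _ hρ.le _
  set k : ℝ → ℝ := fun θ => Real.log (2 + Real.log (1 + ‖h (γ θ)‖ ^ 2)) with hk
  set k' : ℝ → ℝ := fun θ => (2 * inner ℝ (h (γ θ)) (deriv h (γ θ) * (circleMap 0 ρ θ * Complex.I)) /
    (1 + ‖h (γ θ)‖ ^ 2)) / (2 + Real.log (1 + ‖h (γ θ)‖ ^ 2)) with hk'
  have hlogpos : ∀ x : ℝ, 0 ≤ Real.log (1 + x ^ 2) := fun x => Real.log_nonneg (by nlinarith)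
  have hkd : ∀ θ, HasDerivAt k (k' θ) θ := by
    intro θ
    have hd1 : HasDerivAt h (deriv h (γ θ)) (γ θ) := (hd.differentiableAt
      (isOpen_ball.mem_nhds (hsub (sphere_subset_closedBall (hγs θ))))).hasDerivAt
    have hd2 : HasDerivAt (fun θ => h (γ θ)) (deriv h (γ θ) * (circleMap 0 ρ θ * Complex.I)) θ := by
      have := hd1.comp θ (hasDerivAt_circleMap z₀ ρ θ)
      exact this
    have hp : 0 < 1 + ‖h (γ θ)‖ ^ 2 := by positivity
    have hp2 := hlogpos ‖h (γ θ)‖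
    exact (((hd2.norm_sq.const_add 1).log hp.ne').const_add 2).log (by positivity)
  have hkb : ∀ θ, ‖k' θ‖ ≤ K := by
    intro θ
    have hmem := hγs θ
    set w := γ θ with hw
    have hww : dist w z₀ = ρ := hmem
    have hbsub : ball w ρ ⊆ ball z₀ (2 * ρ) := ball_subset_ball' (by linarith)
    have hne : ∀ v ∈ ball w ρ, v ≠ z₀ := by
      rintro v hv rfl
      rw [mem_ball, dist_comm] at hv
      linarith
    have hl := csv_landau hρ (hd.mono hbsub) (fun v hv => h0 v (hbsub hv) (hne v hv))
      (fun v hv => h1 v (hbsub hv))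
    have hw0 : 0 < ‖h w‖ := norm_pos_iff.mpr (h0 w (hbsub (mem_ball_self hρ))
      (hne w (mem_ball_self hρ)))
    have hp := hlogpos ‖h w‖
    have hin : |inner ℝ (h w) (deriv h w * (circleMap 0 ρ θ * Complex.I))| ≤
        ‖h w‖ * (‖deriv h w‖ * ρ) := by
      refine (abs_real_inner_le_norm _ _).trans ?_
      simp [abs_of_pos hρ]
    simp only [hk']
    rw [← hw, Real.norm_eq_abs, div_div, abs_div, abs_mul,
      abs_of_pos (show 0 < (1 + ‖h w‖ ^ 2) * (2 + Real.log (1 + ‖h w‖ ^ 2)) by positivity),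
      div_le_iff₀ (by positivity), abs_two]
    have hg := csv_growth_aux hw0
    calc _ ≤ 2 * (‖h w‖ * (‖deriv h w‖ * ρ)) := by gcongr
      _ ≤ 2 * (‖h w‖ * (7680 * (‖h w‖ * (2 + |Real.log ‖h w‖|)))) := by gcongr
      _ = 2 * 7680 * (‖h w‖ ^ 2 * (2 + |Real.log ‖h w‖|)) := by ring
      _ ≤ 2 * 7680 * (2 * ((1 + ‖h w‖ ^ 2) * (2 + Real.log (1 + ‖h w‖ ^ 2)))) := by gcongr
      _ = _ := by rw [hK]; ring
  have hkl : ∀ a b, |k b - k a| ≤ K * |b - a| := fun a b =>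
    convex_univ.norm_image_sub_le_of_norm_hasDerivWithin_le
      (fun x _ => (hkd x).hasDerivWithinAt) (fun x _ => hkb x) (Set.mem_univ a) (Set.mem_univ b)
  have hparam : ∀ w ∈ sphere z₀ ρ, γ (Complex.arg (w - z₀)) = w := by
    intro w hw
    rw [mem_sphere, dist_eq_norm] at hw
    simp only [hγ, circleMap]
    rw [← hw, Complex.norm_mul_exp_arg_mul_I]; ring
  have hbound : ∀ w ∈ sphere z₀ ρ, ‖h w‖ ≤ M := by
    intro w hw
    have h2 := hkl (Complex.arg (ζ - z₀)) (Complex.arg (w - z₀))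
    have h3 : |Complex.arg (w - z₀) - Complex.arg (ζ - z₀)| ≤ 2 * Real.pi := by
      have := Complex.abs_arg_le_pi (w - z₀)
      have := Complex.abs_arg_le_pi (ζ - z₀)
      have := abs_sub (Complex.arg (w - z₀)) (Complex.arg (ζ - z₀))
      linarith
    simp only [hk] at h2
    rw [hparam w hw, hparam ζ hζ] at h2
    have hK0 : 0 ≤ K := by rw [hK]; norm_num
    have h4 : Real.log (2 + Real.log (1 + ‖h ζ‖ ^ 2)) ≤ Real.log (2 + Real.log (1 + 5 ^ 2)) := by
      have := hlogpos ‖h ζ‖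
      gcongr
    have h5 : Real.log (2 + Real.log (1 + ‖h w‖ ^ 2)) ≤ T := by
      have := (le_abs_self _).trans h2
      have h6 : K * |Complex.arg (w - z₀) - Complex.arg (ζ - z₀)| ≤ K * (2 * Real.pi) := by gcongr
      linarith
    have hp := hlogpos ‖h w‖
    rw [Real.log_le_iff_le_exp (by positivity)] at h5
    have h6 : Real.log (1 + ‖h w‖ ^ 2) ≤ Real.exp T := by linarith
    rw [Real.log_le_iff_le_exp (by positivity)] at h6
    rw [hM]
    nlinarith [norm_nonneg (h w)]
  exact Complex.norm_le_of_forall_mem_frontier_norm_le isBounded_ball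
    (hd.mono (hcl.trans_subset hsub)).diffContOnCl (fun w hw => hbound w (by rwa [hfr] at hw))
    (subset_closure hz)

/-- point of the sphere with given homogeneous coordinates -/
noncomputable def csvP (p q : ℂ) : OnePoint ℂ := if q = 0 then ∞ else ((p / q : ℂ) : OnePoint ℂ)

/-- canonical homogeneous coordinates -/
noncomputable def csvX (x : OnePoint ℂ) : ℂ := Option.elim (α := ℂ) x 1 (fun a => a)

/-- canonical homogeneous coordinates -/
noncomputable def csvY (x : OnePoint ℂ) : ℂ := Option.elim (α := ℂ) x 0 (fun _ => 1)

/-- length of a vector -/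
noncomputable def csvN (p q : ℂ) : ℝ := Real.sqrt (‖p‖ ^ 2 + ‖q‖ ^ 2)

@[simp] lemma csvX_inf : csvX ∞ = 1 := rfl
@[simp] lemma csvY_inf : csvY ∞ = 0 := rfl
@[simp] lemma csvX_coe (a : ℂ) : csvX (a : OnePoint ℂ) = a := rfl
@[simp] lemma csvY_coe (a : ℂ) : csvY (a : OnePoint ℂ) = 1 := rfl

lemma chord_inf_inf : chord ∞ ∞ = 0 := rfl
lemma chord_inf_coe (b : ℂ) : chord ∞ (b : OnePoint ℂ) = 2 / Real.sqrt (1 + ‖b‖ ^ 2) := rfl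
lemma chord_coe_inf (b : ℂ) : chord (b : OnePoint ℂ) ∞ = 2 / Real.sqrt (1 + ‖b‖ ^ 2) := rfl
lemma chord_coe_coe (a b : ℂ) : chord (a : OnePoint ℂ) (b : OnePoint ℂ) =
  2 * ‖a - b‖ / Real.sqrt ((1 + ‖a‖ ^ 2) * (1 + ‖b‖ ^ 2)) := rfl

lemma csvP_XY (x : OnePoint ℂ) : csvP (csvX x) (csvY x) = x := by
  induction x using OnePoint.rec <;> simp [csvP]

lemma csvXY_ne (x : OnePoint ℂ) : csvX x ≠ 0 ∨ csvY x ≠ 0 := by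
  induction x using OnePoint.rec <;> simp

lemma csvN_nonneg (p q : ℂ) : 0 ≤ csvN p q := Real.sqrt_nonneg _

lemma csvN_left (p q : ℂ) : ‖p‖ ≤ csvN p q := Real.le_sqrt_of_sq_le (by nlinarith [sq_nonneg ‖q‖])

lemma csvN_right (p q : ℂ) : ‖q‖ ≤ csvN p q := Real.le_sqrt_of_sq_le (by nlinarith [sq_nonneg ‖p‖])

lemma csvN_pos {p q : ℂ} (h : p ≠ 0 ∨ q ≠ 0) : 0 < csvN p q := by
  rcases h with h | h
  · exact (norm_pos_iff.mpr h).trans_le (csvN_left p q)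
  · exact (norm_pos_iff.mpr h).trans_le (csvN_right p q)

lemma csvN_le (p q : ℂ) : csvN p q ≤ ‖p‖ + ‖q‖ := by
  refine Real.sqrt_le_left (by positivity) |>.mpr ?_ 
  nlinarith [norm_nonneg p, norm_nonneg q]

lemma csvN_smul (l p q : ℂ) : csvN (l * p) (l * q) = ‖l‖ * csvN p q := by
  rw [csvN, csvN, norm_mul, norm_mul, mul_pow, mul_pow, ← mul_add, Real.sqrt_mul (by positivity),
    Real.sqrt_sq (norm_nonneg _)]

lemma csv_scale {p q : ℂ} (h : p ≠ 0 ∨ q ≠ 0) :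
    ∃ l : ℂ, l ≠ 0 ∧ p = l * csvX (csvP p q) ∧ q = l * csvY (csvP p q) := by
  by_cases hq : q = 0
  · have hp : p ≠ 0 := by tauto
    exact ⟨p, hp, by simp [csvP, hq], by simp [csvP, hq]⟩
  · refine ⟨q, hq, ?_, ?_⟩ <;> simp [csvP, hq]
    field_simp

lemma csvP_smul {l p q : ℂ} (hl : l ≠ 0) : csvP (l * p) (l * q) = csvP p q := by
  by_cases hq : q = 0
  · simp [csvP, hq]
  · simp [csvP, hq, hl]
    field_simp

lemma csv_chord_XY (x y : OnePoint ℂ) : chord x y =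
    2 * ‖csvX x * csvY y - csvX y * csvY x‖ / (csvN (csvX x) (csvY x) * csvN (csvX y) (csvY y)) := by
  induction x using OnePoint.rec with
  | infty =>
    induction y using OnePoint.rec with
    | infty => simp [chord_inf_inf]
    | coe b => simp [chord_inf_coe, csvN, add_comm]
  | coe a =>
    induction y using OnePoint.rec with
    | infty => simp [chord_coe_inf, csvN, add_comm]
    | coe b =>
      simp only [chord_coe_coe, csvN, csvX_coe, csvY_coe, mul_one, norm_one, one_pow]
      rw [Real.sqrt_mul (by positivity), add_comm 1, add_comm 1]

lemma csv_chord_P {p q p' q' : ℂ} (h : p ≠ 0 ∨ q ≠ 0) (h' : p' ≠ 0 ∨ q' ≠ 0) :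
    chord (csvP p q) (csvP p' q') = 2 * ‖p * q' - p' * q‖ / (csvN p q * csvN p' q') := by
  obtain ⟨l, hl, e1, e2⟩ := csv_scale h
  obtain ⟨l', hl', e1', e2'⟩ := csv_scale h'
  rw [csv_chord_XY]
  generalize csvX (csvP p q) = X at *
  generalize csvY (csvP p q) = Y at *
  generalize csvX (csvP p' q') = X' at *
  generalize csvY (csvP p' q') = Y' at *
  subst e1 e2 e1' e2'
  rw [csvN_smul, csvN_smul]
  have : l * X * (l' * Y') - l' * X' * (l * Y) = l * l' * (X * Y' - X' * Y) := by ring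
  rw [this, norm_mul, norm_mul]
  have h1 : ‖l‖ ≠ 0 := norm_ne_zero_iff.mpr hl
  have h2 : ‖l'‖ ≠ 0 := norm_ne_zero_iff.mpr hl'
  have h3 := (csvN_pos (show X ≠ 0 ∨ Y ≠ 0 by simpa [hl] using h)).ne'
  have h4 := (csvN_pos (show X' ≠ 0 ∨ Y' ≠ 0 by simpa [hl'] using h')).ne'
  field_simp

lemma csv_chord_nonneg (x y : OnePoint ℂ) : 0 ≤ chord x y := by
  rw [csv_chord_XY]
  have := csvN_nonneg (csvX x) (csvY x)
  have := csvN_nonneg (csvX y) (csvY y)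
  positivity

lemma csv_chord_le_two (x y : OnePoint ℂ) : chord x y ≤ 2 := by
  rw [csv_chord_XY]
  have h1 := csvN_pos (csvXY_ne x)
  have h2 := csvN_pos (csvXY_ne y)
  rw [div_le_iff₀ (by positivity)]
  generalize csvX x = a at *
  generalize csvY x = b at *
  generalize csvX y = c at *
  generalize csvY y = d at *
  have h3 : ‖a * d - c * b‖ ≤ ‖a‖ * ‖d‖ + ‖c‖ * ‖b‖ := by
    refine (norm_sub_le _ _).trans ?_
    rw [norm_mul, norm_mul]
  have h4 : ‖a‖ * ‖d‖ + ‖c‖ * ‖b‖ ≤ csvN a b * csvN c d := by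
    rw [csvN, csvN, ← Real.sqrt_mul (by positivity)]
    apply Real.le_sqrt_of_sq_le
    nlinarith [sq_nonneg (‖a‖ * ‖c‖ - ‖b‖ * ‖d‖)]
  linarith

lemma csv_eq_iff {p q p' q' : ℂ} (h : p ≠ 0 ∨ q ≠ 0) (h' : p' ≠ 0 ∨ q' ≠ 0) :
    csvP p q = csvP p' q' ↔ p * q' - p' * q = 0 := by
  unfold csvP
  by_cases hq : q = 0 <;> by_cases hq' : q' = 0
  · simp [hq, hq']
  · have : p ≠ 0 := by tauto
    simp [hq, hq', this]
  · have : p' ≠ 0 := by tauto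
    simp [hq, hq', this]
  · simp only [hq, hq', if_false, OnePoint.coe_eq_coe]
    rw [div_eq_div_iff hq hq', sub_eq_zero]

lemma csv_eq_iff' {p q : ℂ} (x : OnePoint ℂ) (h : p ≠ 0 ∨ q ≠ 0) :
    x = csvP p q ↔ csvX x * q - p * csvY x = 0 := by
  conv_lhs => rw [← csvP_XY x]
  exact csv_eq_iff (csvXY_ne x) h

/-- holomorphic map to the sphere -/
def csvHol (Φ : ℂ → OnePoint ℂ) (z : ℂ) : Prop :=
  ∃ P Q : ℂ → ℂ, AnalyticAt ℂ P z ∧ AnalyticAt ℂ Q z ∧ (P z ≠ 0 ∨ Q z ≠ 0) ∧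
    Φ =ᶠ[𝓝 z] fun w => csvP (P w) (Q w)

lemma csv_ev_ne {P Q : ℂ → ℂ} {z : ℂ} (hP : ContinuousAt P z) (hQ : ContinuousAt Q z)
    (h : P z ≠ 0 ∨ Q z ≠ 0) : ∀ᶠ w in 𝓝 z, P w ≠ 0 ∨ Q w ≠ 0 := by
  rcases h with h | h
  · exact (hP.eventually_ne h).mono fun w hw => Or.inl hw
  · exact (hQ.eventually_ne h).mono fun w hw => Or.inr hw

/-- coordinates -/
noncomputable def csvC (b : Bool) (x : OnePoint ℂ) : ℂ := if b then csvX x else csvY x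

lemma csv_norm_C (b : Bool) (x : OnePoint ℂ) : ‖csvC b x‖ ≤ csvN (csvX x) (csvY x) := by
  cases b
  · simpa [csvC] using csvN_right _ _
  · simpa [csvC] using csvN_left _ _

lemma csv_diff_coord {α β : ℂ → OnePoint ℂ} {z : ℂ} (hα : csvHol α z) (hβ : csvHol β z)
    (hne : csvX (α z) * csvY (β z) - csvX (β z) * csvY (α z) ≠ 0) (i j : Bool) :
    DifferentiableAt ℂ (fun w => csvC i (α w) * csvC j (β w) /
      (csvX (α w) * csvY (β w) - csvX (β w) * csvY (α w))) z := by
  obtain ⟨P, Q, hP, hQ, h0, he⟩ := hα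
  obtain ⟨P', Q', hP', hQ', h0', he'⟩ := hβ
  have hev := csv_ev_ne hP.continuousAt hQ.continuousAt h0
  have hev' := csv_ev_ne hP'.continuousAt hQ'.continuousAt h0'
  have hz : P z * Q' z - P' z * Q z ≠ 0 := by
    obtain ⟨l, hl, e1, e2⟩ := csv_scale h0
    obtain ⟨l', hl', e1', e2'⟩ := csv_scale h0'
    rw [← show α z = csvP (P z) (Q z) from he.self_of_nhds] at e1 e2
    rw [← show β z = csvP (P' z) (Q' z) from he'.self_of_nhds] at e1' e2'
    rw [e1, e2, e1', e2']
    have : l * csvX (α z) * (l' * csvY (β z)) - l' * csvX (β z) * (l * csvY (α z)) =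
      l * l' * (csvX (α z) * csvY (β z) - csvX (β z) * csvY (α z)) := by ring
    rw [this]
    exact mul_ne_zero (mul_ne_zero hl hl') hne
  have hd : DifferentiableAt ℂ (fun w => (if i then P w else Q w) * (if j then P' w else Q' w) /
      (P w * Q' w - P' w * Q w)) z := by
    have d1 := hP.differentiableAt
    have d2 := hQ.differentiableAt
    have d3 := hP'.differentiableAt
    have d4 := hQ'.differentiableAt
    refine DifferentiableAt.div (DifferentiableAt.mul ?_ ?_) (by fun_prop) hz
    · cases i <;> simpa
    · cases j <;> simpa
  refine hd.congr_of_eventuallyEq ?_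
  filter_upwards [he, he', hev, hev'] with w h1 h2 h3 h4
  obtain ⟨l, hl, e1, e2⟩ := csv_scale h3
  obtain ⟨l', hl', e1', e2'⟩ := csv_scale h4
  rw [← h1] at e1 e2
  rw [← h2] at e1' e2'
  have a1 : (if i then P w else Q w) = l * csvC i (α w) := by cases i <;> simp [csvC, e1, e2]
  have a2 : (if j then P' w else Q' w) = l' * csvC j (β w) := by cases j <;> simp [csvC, e1', e2']
  rw [a1, a2]
  have : P w * Q' w - P' w * Q w =
      l * l' * (csvX (α w) * csvY (β w) - csvX (β w) * csvY (α w)) := by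
    rw [e1, e2, e1', e2']; ring
  rw [this, show l * csvC i (α w) * (l' * csvC j (β w)) = l * l' * (csvC i (α w) * csvC j (β w)) by ring,
    mul_div_mul_left _ _ (mul_ne_zero hl hl')]

lemma csv_schwarz {f : ℂ → ℂ} {z₀ z : ℂ} {R M : ℝ} (hf : DifferentiableOn ℂ f (ball z₀ R))
    (hM : ∀ w ∈ ball z₀ R, ‖f w‖ ≤ M) (hz : z ∈ ball z₀ R) :
    ‖f z - f z₀‖ ≤ 2 * M / R * ‖z - z₀‖ := by
  have hR : 0 < R := dist_nonneg.trans_lt (mem_ball.mp hz)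
  rw [← dist_eq_norm, ← dist_eq_norm]
  refine Complex.dist_le_div_mul_dist_of_mapsTo_ball hf ?_ hz
  intro w hw
  rw [mem_closedBall, dist_eq_norm]
  have h1 := hM w hw
  have h2 := hM z₀ (mem_ball_self hR)
  have := norm_sub_le (f w) (f z₀)
  linarith

/-- bounded representations -/
lemma csv_repr {α β : ℂ → OnePoint ℂ} {z₀ : ℂ} {R c : ℝ} (hR : 0 < R) (hc : 0 < c) (hc1 : c ≤ 1)
    (hα : ∀ z ∈ ball z₀ R, csvHol α z) (hβ : ∀ z ∈ ball z₀ R, csvHol β z)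
    (hsep : ∀ z ∈ ball z₀ R, c ≤ chord (α z) (β z)) :
    ∃ P Q : ℂ → ℂ, DifferentiableOn ℂ P (ball z₀ (R * c / 16)) ∧
      DifferentiableOn ℂ Q (ball z₀ (R * c / 16)) ∧
      ∀ z ∈ ball z₀ (R * c / 16), ‖P z‖ ≤ 2 / c ∧ ‖Q z‖ ≤ 2 / c ∧ 1 / 4 ≤ csvN (P z) (Q z) ∧
        α z = csvP (P z) (Q z) := by
  set d : ℂ → ℂ := fun w => csvX (α w) * csvY (β w) - csvX (β w) * csvY (α w) with hd
  have hδR : R * c / 16 ≤ R := by nlinarith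
  have hz₀ : z₀ ∈ ball z₀ R := mem_ball_self hR
  have hN : ∀ w ∈ ball z₀ R, csvN (csvX (α w)) (csvY (α w)) * csvN (csvX (β w)) (csvY (β w)) ≤
      2 / c * ‖d w‖ := by
    intro w hw
    have h1 := hsep w hw
    rw [csv_chord_XY] at h1
    have h2 := csvN_pos (csvXY_ne (α w))
    have h3 := csvN_pos (csvXY_ne (β w))
    rw [le_div_iff₀ (by positivity)] at h1
    rw [div_mul_eq_mul_div, le_div_iff₀ hc]
    linarith
  have hdne : ∀ w ∈ ball z₀ R, d w ≠ 0 := by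
    intro w hw h
    have h1 := hN w hw
    have h2 := csvN_pos (csvXY_ne (α w))
    have h3 := csvN_pos (csvXY_ne (β w))
    rw [h] at h1
    simp at h1
    nlinarith
  set f : Bool → Bool → ℂ → ℂ := fun i j w => csvC i (α w) * csvC j (β w) / d w with hf
  have hfd : ∀ i j, DifferentiableOn ℂ (f i j) (ball z₀ R) := fun i j w hw =>
    (csv_diff_coord (hα w hw) (hβ w hw) (hdne w hw) i j).differentiableWithinAt
  have hfb : ∀ i j, ∀ w ∈ ball z₀ R, ‖f i j w‖ ≤ 2 / c := by
    intro i j w hw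
    simp only [hf]
    rw [norm_div, norm_mul, div_le_iff₀ (norm_pos_iff.mpr (hdne w hw))]
    refine le_trans ?_ (hN w hw)
    have := csvN_nonneg (csvX (α w)) (csvY (α w))
    gcongr
    · exact csv_norm_C _ _
    · exact csv_norm_C _ _
  have hlow : ∀ i j, 1 / 2 ≤ ‖f i j z₀‖ → ∀ z ∈ ball z₀ (R * c / 16), 1 / 4 ≤ ‖f i j z‖ := by
    intro i j h z hz
    have h1 := csv_schwarz (hfd i j) (hfb i j) (ball_subset_ball hδR hz)
    rw [mem_ball, dist_eq_norm] at hz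
    have h2 : 2 * (2 / c) / R * ‖z - z₀‖ ≤ 2 * (2 / c) / R * (R * c / 16) := by gcongr
    have h3 : 2 * (2 / c) / R * (R * c / 16) = 1 / 4 := by field_simp; norm_num
    have h4 := norm_sub_norm_le (f i j z₀) (f i j z)
    rw [norm_sub_rev] at h4
    linarith
  have hone : f true false z₀ - f false true z₀ = 1 := by
    simp only [hf, csvC]
    rw [← sub_div, div_eq_one_iff_eq (hdne z₀ hz₀)]
    simp [hd]; ring
  have hcase : 1 / 2 ≤ ‖f true false z₀‖ ∨ 1 / 2 ≤ ‖f false true z₀‖ := by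
    by_contra hcon
    push Not at hcon
    have := norm_sub_le (f true false z₀) (f false true z₀)
    rw [hone, norm_one] at this
    linarith [hcon.1, hcon.2]
  rcases hcase with h | h
  · refine ⟨f true false, f false false, (hfd _ _).mono (ball_subset_ball hδR),
      (hfd _ _).mono (ball_subset_ball hδR), fun z hz => ?_⟩
    have hz' := ball_subset_ball hδR hz
    have hl := hlow _ _ h z hz
    refine ⟨hfb _ _ z hz', hfb _ _ z hz', hl.trans (csvN_left _ _), ?_⟩
    have e1 : f true false z = (csvY (β z) / d z) * csvX (α z) := by simp [hf, csvC]; ring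
    have e2 : f false false z = (csvY (β z) / d z) * csvY (α z) := by simp [hf, csvC]; ring
    have hne : csvY (β z) / d z ≠ 0 := by
      intro h; rw [e1, h] at hl; simp at hl; linarith
    rw [e1, e2, csvP_smul hne, csvP_XY]
  · refine ⟨f true true, f false true, (hfd _ _).mono (ball_subset_ball hδR),
      (hfd _ _).mono (ball_subset_ball hδR), fun z hz => ?_⟩
    have hz' := ball_subset_ball hδR hz
    have hl := hlow _ _ h z hz
    refine ⟨hfb _ _ z hz', hfb _ _ z hz', hl.trans (csvN_right _ _), ?_⟩
    have e1 : f true true z = (csvX (β z) / d z) * csvX (α z) := by simp [hf, csvC]; ring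
    have e2 : f false true z = (csvX (β z) / d z) * csvY (α z) := by simp [hf, csvC]; ring
    have hne : csvX (β z) / d z ≠ 0 := by
      intro h; rw [e2, h] at hl; simp at hl; linarith
    rw [e1, e2, csvP_smul hne, csvP_XY]


lemma csv_ne_of_N {p q : ℂ} {m : ℝ} (hm : 0 < m) (h : m ≤ csvN p q) : p ≠ 0 ∨ q ≠ 0 := by
  by_contra hcon
  push Not at hcon
  rw [hcon.1, hcon.2] at h
  simp [csvN] at h
  linarith

lemma csv_equi_of_repr {Φ : ℂ → OnePoint ℂ} {P Q : ℂ → ℂ} {z₀ z : ℂ} {δ M m : ℝ} (hm : 0 < m)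
    (hP : DifferentiableOn ℂ P (ball z₀ δ)) (hQ : DifferentiableOn ℂ Q (ball z₀ δ))
    (hb : ∀ z ∈ ball z₀ δ, ‖P z‖ ≤ M ∧ ‖Q z‖ ≤ M ∧ m ≤ csvN (P z) (Q z) ∧ Φ z = csvP (P z) (Q z))
    (hz : z ∈ ball z₀ δ) :
    chord (Φ z) (Φ z₀) ≤ (8 * M ^ 2 / (δ * m ^ 2)) * ‖z - z₀‖ := by
  have hδ : 0 < δ := dist_nonneg.trans_lt (mem_ball.mp hz)
  have hz₀ : z₀ ∈ ball z₀ δ := mem_ball_self hδ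
  obtain ⟨a1, a2, a3, a4⟩ := hb z hz
  obtain ⟨b1, b2, b3, b4⟩ := hb z₀ hz₀
  rw [a4, b4, csv_chord_P (csv_ne_of_N hm a3) (csv_ne_of_N hm b3)]
  have h1 := csv_schwarz hP (fun w hw => (hb w hw).1) hz
  have h2 := csv_schwarz hQ (fun w hw => (hb w hw).2.1) hz
  have hM : 0 ≤ M := (norm_nonneg _).trans a1
  have h3 : ‖P z * Q z₀ - P z₀ * Q z‖ ≤ 2 * (M * (2 * M / δ * ‖z - z₀‖)) := by
    have e : P z * Q z₀ - P z₀ * Q z = (P z - P z₀) * Q z₀ - P z₀ * (Q z - Q z₀) := by ring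
    rw [e]
    refine (norm_sub_le _ _).trans ?_
    rw [norm_mul, norm_mul]
    have i1 : ‖P z - P z₀‖ * ‖Q z₀‖ ≤ (2 * M / δ * ‖z - z₀‖) * M := by gcongr
    have i2 : ‖P z₀‖ * ‖Q z - Q z₀‖ ≤ M * (2 * M / δ * ‖z - z₀‖) := by gcongr
    linarith
  have h4 : m ^ 2 ≤ csvN (P z) (Q z) * csvN (P z₀) (Q z₀) := by
    have := csvN_nonneg (P z) (Q z)
    rw [pow_two]; gcongr
  calc _ ≤ 2 * (2 * (M * (2 * M / δ * ‖z - z₀‖))) / m ^ 2 := by gcongr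
    _ = _ := by field_simp; ring

lemma csv_diff_cross {Φ : ℂ → OnePoint ℂ} {z : ℂ} (hΦ : csvHol Φ z) {p₁ q₁ p₃ q₃ : ℂ → ℂ}
    (hp₁ : DifferentiableAt ℂ p₁ z) (hq₁ : DifferentiableAt ℂ q₁ z)
    (hp₃ : DifferentiableAt ℂ p₃ z) (hq₃ : DifferentiableAt ℂ q₃ z)
    (hne : csvX (Φ z) * q₃ z - p₃ z * csvY (Φ z) ≠ 0) :
    DifferentiableAt ℂ (fun w => (csvX (Φ w) * q₁ w - p₁ w * csvY (Φ w)) /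
      (csvX (Φ w) * q₃ w - p₃ w * csvY (Φ w))) z := by
  obtain ⟨P, Q, hP, hQ, h0, he⟩ := hΦ
  have hev := csv_ev_ne hP.continuousAt hQ.continuousAt h0
  have d1 := hP.differentiableAt
  have d2 := hQ.differentiableAt
  have hz : P z * q₃ z - p₃ z * Q z ≠ 0 := by
    obtain ⟨l, hl, e1, e2⟩ := csv_scale h0
    rw [← show Φ z = csvP (P z) (Q z) from he.self_of_nhds] at e1 e2
    rw [e1, e2, show l * csvX (Φ z) * q₃ z - p₃ z * (l * csvY (Φ z)) =
      l * (csvX (Φ z) * q₃ z - p₃ z * csvY (Φ z)) by ring]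
    exact mul_ne_zero hl hne
  have hd : DifferentiableAt ℂ (fun w => (P w * q₁ w - p₁ w * Q w) /
      (P w * q₃ w - p₃ w * Q w)) z :=
    DifferentiableAt.div (by fun_prop) (by fun_prop) hz
  refine hd.congr_of_eventuallyEq ?_
  filter_upwards [he, hev] with w h1 h3
  obtain ⟨l, hl, e1, e2⟩ := csv_scale h3
  rw [← h1] at e1 e2
  rw [e1, e2, show l * csvX (Φ w) * q₁ w - p₁ w * (l * csvY (Φ w)) =
      l * (csvX (Φ w) * q₁ w - p₁ w * csvY (Φ w)) by ring,
      show l * csvX (Φ w) * q₃ w - p₃ w * (l * csvY (Φ w)) =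
      l * (csvX (Φ w) * q₃ w - p₃ w * csvY (Φ w)) by ring,
      mul_div_mul_left _ _ hl]

/-- core estimate, small value of the cross ratio at the centre -/
lemma csv_core (M m ρ : ℝ) (hM : 0 < M) (hm : 0 < m) (hρ : 0 < ρ) : ∃ C : ℝ,
    ∀ (z₀ : ℂ) (Φ : ℂ → OnePoint ℂ) (p₁ q₁ p₂ q₂ p₃ q₃ : ℂ → ℂ),
    (∀ z ∈ ball z₀ (2 * ρ), csvHol Φ z) →
    DifferentiableOn ℂ p₁ (ball z₀ (2 * ρ)) → DifferentiableOn ℂ q₁ (ball z₀ (2 * ρ)) →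
    DifferentiableOn ℂ p₂ (ball z₀ (2 * ρ)) → DifferentiableOn ℂ q₂ (ball z₀ (2 * ρ)) →
    DifferentiableOn ℂ p₃ (ball z₀ (2 * ρ)) → DifferentiableOn ℂ q₃ (ball z₀ (2 * ρ)) →
    (∀ z ∈ ball z₀ (2 * ρ), ‖p₁ z‖ ≤ M ∧ ‖q₁ z‖ ≤ M ∧ ‖p₂ z‖ ≤ M ∧ ‖q₂ z‖ ≤ M ∧
      ‖p₃ z‖ ≤ M ∧ ‖q₃ z‖ ≤ M) →
    (∀ z ∈ ball z₀ (2 * ρ), m ≤ ‖p₁ z * q₃ z - p₃ z * q₁ z‖ ∧ m ≤ ‖p₂ z * q₁ z - p₁ z * q₂ z‖ ∧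
      m ≤ ‖p₂ z * q₃ z - p₃ z * q₂ z‖) →
    (∀ z ∈ ball z₀ (2 * ρ), csvX (Φ z) * q₃ z - p₃ z * csvY (Φ z) ≠ 0) →
    (∀ z ∈ ball z₀ (2 * ρ), csvX (Φ z) * q₂ z - p₂ z * csvY (Φ z) ≠ 0) →
    (∀ z ∈ ball z₀ (2 * ρ), z ≠ z₀ → csvX (Φ z) * q₁ z - p₁ z * csvY (Φ z) ≠ 0) →
    ‖(csvX (Φ z₀) * q₁ z₀ - p₁ z₀ * csvY (Φ z₀)) * (p₂ z₀ * q₃ z₀ - p₃ z₀ * q₂ z₀)‖ ≤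
      2 * ‖(csvX (Φ z₀) * q₃ z₀ - p₃ z₀ * csvY (Φ z₀)) * (p₂ z₀ * q₁ z₀ - p₁ z₀ * q₂ z₀)‖ →
    ∀ z ∈ ball z₀ ρ, chord (Φ z) (Φ z₀) ≤ C * ‖z - z₀‖ := by
  obtain ⟨S, hS, hsch⟩ := csv_schottky
  set B : ℝ := 2 * M ^ 3 * (1 + S) with hB
  set b : ℝ := m ^ 2 / (2 * M) with hb
  refine ⟨8 * B ^ 2 / (ρ * b ^ 2), ?_⟩
  intro z₀ Φ p₁ q₁ p₂ q₂ p₃ q₃ hΦ hp₁ hq₁ hp₂ hq₂ hp₃ hq₃ hbd hdet h3 h2 h1 hc z hz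
  have hb0 : 0 < b := by positivity
  have hsub : ball z₀ ρ ⊆ ball z₀ (2 * ρ) := ball_subset_ball (by linarith)
  have hz₀ : z₀ ∈ ball z₀ (2 * ρ) := mem_ball_self (by linarith)
  set d23 : ℂ → ℂ := fun w => p₂ w * q₃ w - p₃ w * q₂ w with hd23
  set d21 : ℂ → ℂ := fun w => p₂ w * q₁ w - p₁ w * q₂ w with hd21
  set f1 : ℂ → ℂ := fun w => csvX (Φ w) * q₁ w - p₁ w * csvY (Φ w) with hf1
  set f3 : ℂ → ℂ := fun w => csvX (Φ w) * q₃ w - p₃ w * csvY (Φ w) with hf3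
  have hd23d : DifferentiableOn ℂ d23 (ball z₀ (2 * ρ)) := (hp₂.mul hq₃).sub (hp₃.mul hq₂)
  have hd21d : DifferentiableOn ℂ d21 (ball z₀ (2 * ρ)) := (hp₂.mul hq₁).sub (hp₁.mul hq₂)
  have hne : ∀ {a : ℂ}, m ≤ ‖a‖ → a ≠ 0 := by
    rintro a h rfl
    simp at h; linarith
  have n13 : ∀ w ∈ ball z₀ (2 * ρ), p₁ w * q₃ w - p₃ w * q₁ w ≠ 0 := fun w hw => hne (hdet w hw).1
  have n21 : ∀ w ∈ ball z₀ (2 * ρ), d21 w ≠ 0 := fun w hw => hne (hdet w hw).2.1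
  have n23 : ∀ w ∈ ball z₀ (2 * ρ), d23 w ≠ 0 := fun w hw => hne (hdet w hw).2.2
  set h : ℂ → ℂ := fun w => (f1 w / f3 w) * (d23 w / d21 w) with hh
  have hhd : DifferentiableOn ℂ h (ball z₀ (2 * ρ)) := by
    refine DifferentiableOn.mul ?_ (hd23d.div hd21d n21)
    intro w hw
    have hn := isOpen_ball.mem_nhds hw
    exact (csv_diff_cross (hΦ w hw) (hp₁.differentiableAt hn) (hq₁.differentiableAt hn)
      (hp₃.differentiableAt hn) (hq₃.differentiableAt hn) (h3 w hw)).differentiableWithinAt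
  have hh1 : ∀ w ∈ ball z₀ (2 * ρ), h w ≠ 1 := by
    intro w hw he
    have a3 : f3 w ≠ 0 := h3 w hw
    have a21 := n21 w hw
    simp only [hh] at he
    rw [div_mul_div_comm, div_eq_one_iff_eq (mul_ne_zero a3 a21)] at he
    apply mul_ne_zero (h2 w hw) (n13 w hw)
    simp only [hf1, hf3, hd23, hd21] at he
    linear_combination he
  have hh0 : ∀ w ∈ ball z₀ (2 * ρ), w ≠ z₀ → h w ≠ 0 := by
    intro w hw hwz
    exact mul_ne_zero (div_ne_zero (h1 w hw hwz) (h3 w hw)) (div_ne_zero (n23 w hw) (n21 w hw))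
  have hh2 : ‖h z₀‖ ≤ 2 := by
    simp only [hh]
    rw [div_mul_div_comm, norm_div, div_le_iff₀
      (norm_pos_iff.mpr (mul_ne_zero (h3 z₀ hz₀) (n21 z₀ hz₀)))]
    exact hc
  have hbound := hsch h z₀ ρ hρ hhd hh1 hh0 hh2
  have hdb : ∀ a b c d : ℂ, ‖a‖ ≤ M → ‖b‖ ≤ M → ‖c‖ ≤ M → ‖d‖ ≤ M →
      ‖a * b - c * d‖ ≤ 2 * M ^ 2 := by
    intro a b c d ha hb hc hd
    refine (norm_sub_le _ _).trans ?_
    rw [norm_mul, norm_mul]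
    have i1 : ‖a‖ * ‖b‖ ≤ M * M := by gcongr
    have i2 : ‖c‖ * ‖d‖ ≤ M * M := by gcongr
    nlinarith
  have hcomb : ∀ a b d d' k : ℂ, ‖a‖ ≤ M → ‖b‖ ≤ M → ‖d‖ ≤ 2 * M ^ 2 → ‖d'‖ ≤ 2 * M ^ 2 → ‖k‖ ≤ S →
      ‖a * d - k * d' * b‖ ≤ B := by
    intro a b d d' k ha hb hd hd' hk
    refine (norm_sub_le _ _).trans ?_
    rw [norm_mul, norm_mul, norm_mul]
    have i1 : ‖a‖ * ‖d‖ ≤ M * (2 * M ^ 2) := by gcongr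
    have i2 : ‖k‖ * ‖d'‖ * ‖b‖ ≤ S * (2 * M ^ 2) * M := by gcongr
    rw [hB]; nlinarith
  refine csv_equi_of_repr (P := fun w => p₁ w * d23 w - h w * d21 w * p₃ w)
    (Q := fun w => q₁ w * d23 w - h w * d21 w * q₃ w) hb0 ?_ ?_ ?_ hz
  · exact ((hp₁.mul hd23d).sub ((hhd.mul hd21d).mul hp₃)).mono hsub
  · exact ((hq₁.mul hd23d).sub ((hhd.mul hd21d).mul hq₃)).mono hsub
  · intro w hw
    have hw' := hsub hw
    obtain ⟨bp1, bq1, bp2, bq2, bp3, bq3⟩ := hbd w hw'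
    have b23 : ‖d23 w‖ ≤ 2 * M ^ 2 := hdb _ _ _ _ bp2 bq3 bp3 bq2
    have b21 : ‖d21 w‖ ≤ 2 * M ^ 2 := hdb _ _ _ _ bp2 bq1 bp1 bq2
    have a3 : f3 w ≠ 0 := h3 w hw'
    have a21 := n21 w hw'
    have a23 := n23 w hw'
    have a13 := n13 w hw'
    refine ⟨hcomb _ _ _ _ _ bp1 bp3 b23 b21 (hbound w hw),
      hcomb _ _ _ _ _ bq1 bq3 b23 b21 (hbound w hw), ?_, ?_⟩
    · set P := p₁ w * d23 w - h w * d21 w * p₃ w with hP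
      set Q := q₁ w * d23 w - h w * d21 w * q₃ w with hQ
      have e : P * q₃ w - p₃ w * Q = d23 w * (p₁ w * q₃ w - p₃ w * q₁ w) := by
        rw [hP, hQ]; ring
      have e1 : m ^ 2 ≤ ‖P * q₃ w - p₃ w * Q‖ := by
        rw [e, norm_mul, pow_two]
        have := (hdet w hw').1
        have := (hdet w hw').2.2
        gcongr
      have e2 : ‖P * q₃ w - p₃ w * Q‖ ≤ csvN P Q * M + M * csvN P Q := by
        refine (norm_sub_le _ _).trans ?_
        rw [norm_mul, norm_mul]
        have := csvN_left P Q
        have := csvN_right P Q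
        have := csvN_nonneg P Q
        gcongr
      rw [hb, div_le_iff₀ (by positivity)]
      linarith
    · have e1 : p₁ w * d23 w - h w * d21 w * p₃ w =
          (d23 w * (p₁ w * q₃ w - p₃ w * q₁ w) / f3 w) * csvX (Φ w) := by
        simp only [hh]
        field_simp
        simp only [hf1, hf3]; ring
      have e2 : q₁ w * d23 w - h w * d21 w * q₃ w =
          (d23 w * (p₁ w * q₃ w - p₃ w * q₁ w) / f3 w) * csvY (Φ w) := by
        simp only [hh]
        field_simp
        simp only [hf1, hf3]; ring
      simp only [e1, e2]
      rw [csvP_smul (div_ne_zero (mul_ne_zero a23 a13) a3), csvP_XY]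

/-- equicontinuity at a point -/
lemma csv_equi (c R : ℝ) (hc : 0 < c) (hc1 : c ≤ 1) (hR : 0 < R) : ∃ C δ : ℝ, 0 < δ ∧
    ∀ (z₀ : ℂ) (Φ α₁ α₂ α₃ : ℂ → OnePoint ℂ),
    (∀ z ∈ ball z₀ R, csvHol Φ z) → (∀ z ∈ ball z₀ R, csvHol α₁ z) →
    (∀ z ∈ ball z₀ R, csvHol α₂ z) → (∀ z ∈ ball z₀ R, csvHol α₃ z) →
    (∀ z ∈ ball z₀ R, c ≤ chord (α₁ z) (α₂ z)) → (∀ z ∈ ball z₀ R, c ≤ chord (α₁ z) (α₃ z)) →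
    (∀ z ∈ ball z₀ R, c ≤ chord (α₂ z) (α₁ z)) → (∀ z ∈ ball z₀ R, c ≤ chord (α₂ z) (α₃ z)) →
    (∀ z ∈ ball z₀ R, c ≤ chord (α₃ z) (α₁ z)) →
    (∀ z ∈ ball z₀ R, Φ z ≠ α₃ z) → (∀ z ∈ ball z₀ R, Φ z ≠ α₂ z) →
    (∀ z ∈ ball z₀ R, z ≠ z₀ → Φ z ≠ α₁ z) →
    ∀ z ∈ ball z₀ δ, chord (Φ z) (Φ z₀) ≤ C * ‖z - z₀‖ := by
  set ρ := R * c / 32 with hρdef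
  have hρ : 0 < ρ := by positivity
  obtain ⟨C, hC⟩ := csv_core (2 / c) (c / 32) ρ (by positivity) (by positivity) hρ
  refine ⟨C, ρ, hρ, ?_⟩
  intro z₀ Φ α₁ α₂ α₃ hΦ hα₁ hα₂ hα₃ s12 s13 s21 s23 s31 n3 n2 n1 z hz
  have hρ2 : R * c / 16 = 2 * ρ := by rw [hρdef]; ring
  have hsub : ball z₀ (2 * ρ) ⊆ ball z₀ R := ball_subset_ball (by rw [hρdef]; nlinarith)
  obtain ⟨p₁, q₁, hp₁, hq₁, r₁⟩ := csv_repr hR hc hc1 hα₁ hα₂ s12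
  obtain ⟨p₂, q₂, hp₂, hq₂, r₂⟩ := csv_repr hR hc hc1 hα₂ hα₁ s21
  obtain ⟨p₃, q₃, hp₃, hq₃, r₃⟩ := csv_repr hR hc hc1 hα₃ hα₁ s31
  rw [hρ2] at hp₁ hq₁ r₁ hp₂ hq₂ r₂ hp₃ hq₃ r₃
  have hz₀ : z₀ ∈ ball z₀ (2 * ρ) := mem_ball_self (by linarith)
  have q4 : (0 : ℝ) < 1 / 4 := by norm_num
  have v1 : ∀ z ∈ ball z₀ (2 * ρ), p₁ z ≠ 0 ∨ q₁ z ≠ 0 := fun z hz =>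
    csv_ne_of_N q4 (r₁ z hz).2.2.1
  have v2 : ∀ z ∈ ball z₀ (2 * ρ), p₂ z ≠ 0 ∨ q₂ z ≠ 0 := fun z hz =>
    csv_ne_of_N q4 (r₂ z hz).2.2.1
  have v3 : ∀ z ∈ ball z₀ (2 * ρ), p₃ z ≠ 0 ∨ q₃ z ≠ 0 := fun z hz =>
    csv_ne_of_N q4 (r₃ z hz).2.2.1
  have hdet : ∀ {p q p' q' : ℂ}, (1:ℝ) / 4 ≤ csvN p q → (1:ℝ) / 4 ≤ csvN p' q' →
      c ≤ chord (csvP p q) (csvP p' q') → c / 32 ≤ ‖p * q' - p' * q‖ := by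
    intro p q p' q' h h' hch
    rw [csv_chord_P (csv_ne_of_N q4 h) (csv_ne_of_N q4 h'), le_div_iff₀ (by nlinarith)] at hch
    have : (1 : ℝ) / 4 * (1 / 4) ≤ csvN p q * csvN p' q' := by gcongr
    nlinarith
  have d13 : ∀ z ∈ ball z₀ (2 * ρ), c / 32 ≤ ‖p₁ z * q₃ z - p₃ z * q₁ z‖ := fun z hz =>
    hdet (r₁ z hz).2.2.1 (r₃ z hz).2.2.1
      (by rw [← (r₁ z hz).2.2.2, ← (r₃ z hz).2.2.2]; exact s13 z (hsub hz))
  have d31 : ∀ z ∈ ball z₀ (2 * ρ), c / 32 ≤ ‖p₃ z * q₁ z - p₁ z * q₃ z‖ := fun z hz => by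
    rw [norm_sub_rev]; exact d13 z hz
  have d21 : ∀ z ∈ ball z₀ (2 * ρ), c / 32 ≤ ‖p₂ z * q₁ z - p₁ z * q₂ z‖ := fun z hz =>
    hdet (r₂ z hz).2.2.1 (r₁ z hz).2.2.1
      (by rw [← (r₁ z hz).2.2.2, ← (r₂ z hz).2.2.2]; exact s21 z (hsub hz))
  have d23 : ∀ z ∈ ball z₀ (2 * ρ), c / 32 ≤ ‖p₂ z * q₃ z - p₃ z * q₂ z‖ := fun z hz =>
    hdet (r₂ z hz).2.2.1 (r₃ z hz).2.2.1
      (by rw [← (r₃ z hz).2.2.2, ← (r₂ z hz).2.2.2]; exact s23 z (hsub hz))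
  have m3 : ∀ z ∈ ball z₀ (2 * ρ), csvX (Φ z) * q₃ z - p₃ z * csvY (Φ z) ≠ 0 := fun z hz h =>
    n3 z (hsub hz) (by rw [(r₃ z hz).2.2.2]; exact (csv_eq_iff' _ (v3 z hz)).mpr h)
  have m2 : ∀ z ∈ ball z₀ (2 * ρ), csvX (Φ z) * q₂ z - p₂ z * csvY (Φ z) ≠ 0 := fun z hz h =>
    n2 z (hsub hz) (by rw [(r₂ z hz).2.2.2]; exact (csv_eq_iff' _ (v2 z hz)).mpr h)
  have m1 : ∀ z ∈ ball z₀ (2 * ρ), z ≠ z₀ → csvX (Φ z) * q₁ z - p₁ z * csvY (Φ z) ≠ 0 :=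
    fun z hz hne h =>
    n1 z (hsub hz) hne (by rw [(r₁ z hz).2.2.2]; exact (csv_eq_iff' _ (v1 z hz)).mpr h)
  have hΦ' : ∀ z ∈ ball z₀ (2 * ρ), csvHol Φ z := fun z hz => hΦ z (hsub hz)
  by_cases hcase : ‖(csvX (Φ z₀) * q₁ z₀ - p₁ z₀ * csvY (Φ z₀)) * (p₂ z₀ * q₃ z₀ - p₃ z₀ * q₂ z₀)‖ ≤
      2 * ‖(csvX (Φ z₀) * q₃ z₀ - p₃ z₀ * csvY (Φ z₀)) * (p₂ z₀ * q₁ z₀ - p₁ z₀ * q₂ z₀)‖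
  · exact hC z₀ Φ p₁ q₁ p₂ q₂ p₃ q₃ hΦ' hp₁ hq₁ hp₂ hq₂ hp₃ hq₃
      (fun z hz => ⟨(r₁ z hz).1, (r₁ z hz).2.1, (r₂ z hz).1, (r₂ z hz).2.1,
        (r₃ z hz).1, (r₃ z hz).2.1⟩)
      (fun z hz => ⟨d13 z hz, d21 z hz, d23 z hz⟩) m3 m2 m1 hcase z hz
  · push Not at hcase
    refine hC z₀ Φ p₃ q₃ p₂ q₂ p₁ q₁ hΦ' hp₃ hq₃ hp₂ hq₂ hp₁ hq₁
      (fun z hz => ⟨(r₃ z hz).1, (r₃ z hz).2.1, (r₂ z hz).1, (r₂ z hz).2.1,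
        (r₁ z hz).1, (r₁ z hz).2.1⟩)
      (fun z hz => ⟨d31 z hz, d23 z hz, d21 z hz⟩) ?_ m2 (fun z hz _ => m3 z hz) ?_ z hz
    · intro w hw
      by_cases hwz : w = z₀
      · subst hwz
        intro h0
        rw [h0] at hcase
        simp only [zero_mul, norm_zero] at hcase
        have := norm_nonneg ((csvX (Φ w) * q₃ w - p₃ w * csvY (Φ w)) * (p₂ w * q₁ w - p₁ w * q₂ w))
        linarith
      · exact m1 w hw hwz
    · have := norm_nonneg ((csvX (Φ z₀) * q₃ z₀ - p₃ z₀ * csvY (Φ z₀)) * (p₂ z₀ * q₁ z₀ - p₁ z₀ * q₂ z₀))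
      linarith


lemma csv_sphVal_eq {f P Q : ℂ → ℂ} {z : ℂ} (hP : ContinuousAt P z) (hQ : ContinuousAt Q z)
    (h0 : P z ≠ 0 ∨ Q z ≠ 0) (hf : ∀ᶠ w in 𝓝[≠] z, f w = P w / Q w ∧ Q w ≠ 0) :
    sphVal f z = csvP (P z) (Q z) := by
  have hfe : f =ᶠ[𝓝[≠] z] fun w => P w / Q w := hf.mono fun w h => h.1
  have hP' : Tendsto P (𝓝[≠] z) (𝓝 (P z)) := hP.tendsto.mono_left nhdsWithin_le_nhds
  have hQ' : Tendsto Q (𝓝[≠] z) (𝓝 (Q z)) := hQ.tendsto.mono_left nhdsWithin_le_nhds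
  by_cases hq : Q z = 0
  · have hp : P z ≠ 0 := by tauto
    have ht : Tendsto (fun w => ‖f w‖) (𝓝[≠] z) atTop := by
      have h1 : Tendsto (fun w => ‖P w‖ * ‖(Q w)⁻¹‖) (𝓝[≠] z) atTop := by
        refine Tendsto.pos_mul_atTop (norm_pos_iff.mpr hp) hP'.norm ?_
        refine tendsto_norm_inv_nhdsNE_zero_atTop.comp ?_
        rw [tendsto_nhdsWithin_iff]
        exact ⟨by rw [hq] at hQ'; exact hQ', hf.mono fun w h => h.2⟩
      refine h1.congr' ?_
      filter_upwards [hfe] with w hw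
      rw [hw, div_eq_mul_inv, norm_mul]
    rw [sphVal, if_pos ht, csvP, if_pos hq]
  · have ht : Tendsto f (𝓝[≠] z) (𝓝 (P z / Q z)) := (hP'.div hQ' hq).congr' hfe.symm
    have hn : ¬ Tendsto (fun w => ‖f w‖) (𝓝[≠] z) atTop :=
      not_tendsto_atTop_of_tendsto_nhds ht.norm
    rw [sphVal, if_neg hn, csvP, if_neg hq, ht.limUnder_eq]

lemma csv_sphVal_ev {f P Q : ℂ → ℂ} {z : ℂ} (hP : AnalyticAt ℂ P z) (hQ : AnalyticAt ℂ Q z)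
    (h0 : P z ≠ 0 ∨ Q z ≠ 0) (hf : ∀ᶠ w in 𝓝[≠] z, f w = P w / Q w ∧ Q w ≠ 0) :
    sphVal f =ᶠ[𝓝 z] fun w => csvP (P w) (Q w) := by
  have h1 : ∀ᶠ w in 𝓝[≠] z, ∀ᶠ u in 𝓝[≠] w, f u = P u / Q u ∧ Q u ≠ 0 := by
    have := eventually_eventually_nhdsWithin.mpr hf
    filter_upwards [this, self_mem_nhdsWithin] with w hw hwz
    rw [isOpen_compl_singleton.nhdsWithin_eq hwz] at hw
    exact hw.filter_mono nhdsWithin_le_nhds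
  rw [eventually_nhdsWithin_iff] at h1
  filter_upwards [h1, hP.eventually_analyticAt, hQ.eventually_analyticAt,
    csv_ev_ne hP.continuousAt hQ.continuousAt h0] with w h2 h3 h4 h5
  by_cases hw : w = z
  · subst hw
    exact csv_sphVal_eq h3.continuousAt h4.continuousAt h5 hf
  · exact csv_sphVal_eq h3.continuousAt h4.continuousAt h5 (h2 hw)

lemma csv_hol_sphVal {f : ℂ → ℂ} {z : ℂ} (hf : MeromorphicAt f z) : csvHol (sphVal f) z := by
  by_cases ho : meromorphicOrderAt f z = ⊤
  · rw [meromorphicOrderAt_eq_top_iff] at ho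
    have a0 : AnalyticAt ℂ (fun _ : ℂ => (0 : ℂ)) z := analyticAt_const
    have a1 : AnalyticAt ℂ (fun _ : ℂ => (1 : ℂ)) z := analyticAt_const
    refine ⟨_, _, a0, a1, by simp, csv_sphVal_ev a0 a1 (by simp) ?_⟩
    filter_upwards [ho] with w hw
    simp [hw]
  · obtain ⟨g, hg, hgz, hev⟩ := (meromorphicOrderAt_ne_top_iff hf).mp ho
    set n := (meromorphicOrderAt f z).untop₀ with hn
    rcases le_or_gt 0 n with h | h
    · lift n to ℕ using h with m
      have aP : AnalyticAt ℂ (fun w => (w - z) ^ m * g w) z := by fun_prop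
      have a1 : AnalyticAt ℂ (fun _ : ℂ => (1 : ℂ)) z := analyticAt_const
      refine ⟨_, _, aP, a1, by simp, csv_sphVal_ev aP a1 (by simp) ?_⟩
      filter_upwards [hev] with w hw
      simp [hw]
    · obtain ⟨m, hm⟩ : ∃ m : ℕ, n = -(m : ℤ) := ⟨n.natAbs, by omega⟩
      have aQ : AnalyticAt ℂ (fun w => (w - z) ^ m) z := by fun_prop
      refine ⟨_, _, hg, aQ, Or.inl hgz, csv_sphVal_ev hg aQ (Or.inl hgz) ?_⟩
      filter_upwards [hev, self_mem_nhdsWithin] with w hw hwz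
      have : w - z ≠ 0 := sub_ne_zero.mpr hwz
      refine ⟨?_, pow_ne_zero _ this⟩
      rw [hw, hm, zpow_neg, zpow_natCast, smul_eq_mul]
      field_simp

lemma csv_hol_inf (z : ℂ) : csvHol (fun _ => ∞) z :=
  ⟨fun _ => 1, fun _ => 0, analyticAt_const, analyticAt_const, by simp, by
    refine Eventually.of_forall fun w => by simp [csvP]⟩

lemma csv_hol_congr {Φ Ψ : ℂ → OnePoint ℂ} {z : ℂ} (h : csvHol Φ z) (he : Ψ =ᶠ[𝓝 z] Φ) :
    csvHol Ψ z := by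
  obtain ⟨P, Q, hP, hQ, h0, h1⟩ := h
  exact ⟨P, Q, hP, hQ, h0, he.trans h1⟩

lemma csv_hol_of_mero {D : Set ℂ} (hD : IsOpen D) {Φ : ℂ → OnePoint ℂ}
    (h : IsMeroSphereOrInf D Φ) {z : ℂ} (hz : z ∈ D) : csvHol Φ z := by
  rcases h with ⟨a, ha, h⟩ | h
  · refine csv_hol_congr (csv_hol_sphVal (ha z hz)) ?_
    filter_upwards [hD.mem_nhds hz] with w hw using h w hw
  · refine csv_hol_congr (csv_hol_inf z) ?_
    filter_upwards [hD.mem_nhds hz] with w hw using h w hw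

lemma csv_ident_local {Φ α : ℂ → OnePoint ℂ} {z : ℂ} (hΦ : csvHol Φ z) (hα : csvHol α z) :
    (∀ᶠ w in 𝓝 z, Φ w = α w) ∨ (∀ᶠ w in 𝓝[≠] z, Φ w ≠ α w) := by
  obtain ⟨P, Q, hP, hQ, h0, he⟩ := hΦ
  obtain ⟨P', Q', hP', hQ', h0', he'⟩ := hα
  have hev := csv_ev_ne hP.continuousAt hQ.continuousAt h0
  have hev' := csv_ev_ne hP'.continuousAt hQ'.continuousAt h0'
  have ha : AnalyticAt ℂ (fun w => P w * Q' w - P' w * Q w) z := by fun_prop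
  have key : ∀ᶠ w in 𝓝 z, Φ w = α w ↔ P w * Q' w - P' w * Q w = 0 := by
    filter_upwards [hev, hev', he, he'] with w h1 h2 h3 h4
    rw [h3, h4, csv_eq_iff h1 h2]
  rcases ha.eventually_eq_zero_or_eventually_ne_zero with h | h
  · left
    filter_upwards [key, h] with w h1 h2 using h1.mpr h2
  · right
    filter_upwards [key.filter_mono nhdsWithin_le_nhds, h] with w h1 h2
    exact fun h3 => h2 (h1.mp h3)

lemma csv_ident {D : Set ℂ} (hDc : IsPreconnected D) {Φ α : ℂ → OnePoint ℂ}
    (hΦ : ∀ z ∈ D, csvHol Φ z) (hα : ∀ z ∈ D, csvHol α z) {z₀ : ℂ} (hz₀ : z₀ ∈ D)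
    (h : ∀ᶠ w in 𝓝 z₀, Φ w = α w) : ∀ z ∈ D, ∀ᶠ w in 𝓝 z, Φ w = α w := by
  have := hDc.subset_of_closure_inter_subset (u := {z | ∀ᶠ w in 𝓝 z, Φ w = α w})
    isOpen_setOfPred_eventually_nhds ⟨z₀, hz₀, h⟩ ?_
  · exact fun z hz => this hz
  · rintro z ⟨hz, hzD⟩
    rcases csv_ident_local (hΦ z hzD) (hα z hzD) with h1 | h1
    · exact h1
    · rw [mem_closure_iff_frequently] at hz
      rw [eventually_nhdsWithin_iff] at h1
      obtain ⟨w, hw, h2⟩ := (hz.and_eventually h1).exists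
      by_cases hwz : w = z
      · rwa [hwz] at hw
      · exact absurd (Eventually.self_of_nhds hw) (h2 hwz)

lemma csv_mero_of_hol {D : Set ℂ} (hDc : IsPreconnected D) {G : ℂ → OnePoint ℂ}
    (hG : ∀ z ∈ D, csvHol G z) : IsMeroSphereOrInf D G := by
  by_cases h : ∃ z ∈ D, ∀ᶠ w in 𝓝 z, G w = ∞
  · right
    obtain ⟨z, hz, h⟩ := h
    intro w hw
    exact (csv_ident hDc hG (fun z _ => csv_hol_inf z) hz h w hw).self_of_nhds
  · left
    push Not at h
    have key : ∀ z ∈ D, MeromorphicAt (fun w => csvX (G w)) z ∧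
        G z = sphVal (fun w => csvX (G w)) z := by
      intro z hz
      obtain ⟨P, Q, hP, hQ, h0, he⟩ := hG z hz
      have hQne : ∀ᶠ w in 𝓝[≠] z, Q w ≠ 0 := by
        rcases hQ.eventually_eq_zero_or_eventually_ne_zero with h1 | h1
        · exfalso
          refine (h z hz) ?_
          filter_upwards [h1, he] with w h2 h3
          simp [h3, csvP, if_pos h2]
        · exact h1
      have hq : ∀ᶠ w in 𝓝[≠] z, csvX (G w) = P w / Q w ∧ Q w ≠ 0 := by
        filter_upwards [hQne, he.filter_mono nhdsWithin_le_nhds] with w h1 h2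
        refine ⟨?_, h1⟩
        rw [h2, csvP, if_neg h1, csvX_coe]
      refine ⟨?_, ?_⟩
      · refine (hP.meromorphicAt.div hQ.meromorphicAt).congr ?_
        filter_upwards [hq] with w hw using hw.1.symm
      · rw [csv_sphVal_eq hP.continuousAt hQ.continuousAt h0 hq]
        exact he.self_of_nhds
    exact ⟨_, fun z hz => (key z hz).1, fun z hz => (key z hz).2⟩


lemma csv_sep_of_sph (ε : ℝ) (hε : 0 < ε) : ∃ c : ℝ, 0 < c ∧ c ≤ 1 ∧
    ∀ x y : OnePoint ℂ, ε ≤ sph x y → c ≤ chord x y := by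
  by_cases h : ε / 2 ≤ Real.pi / 2
  · refine ⟨min (2 * Real.sin (ε / 2)) 1, lt_min ?_ one_pos, min_le_right _ _, ?_⟩
    · have := Real.sin_pos_of_pos_of_lt_pi (x := ε / 2) (by linarith) (by linarith [Real.pi_pos])
      linarith
    · intro x y hxy
      refine (min_le_left _ _).trans ?_
      rw [sph] at hxy
      have h1 : ε / 2 ≤ Real.arcsin (chord x y / 2) := by linarith
      have h0 := csv_chord_nonneg x y
      have h2 := csv_chord_le_two x y
      have h3 : Real.sin (ε / 2) ≤ Real.sin (Real.arcsin (chord x y / 2)) :=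
        Real.sin_le_sin_of_le_of_le_pi_div_two (by linarith [Real.pi_pos])
          (Real.arcsin_le_pi_div_two _) h1
      rw [Real.sin_arcsin (by linarith) (by linarith)] at h3
      linarith
  · refine ⟨1, one_pos, le_rfl, ?_⟩
    intro x y hxy
    rw [sph] at hxy
    have := Real.arcsin_le_pi_div_two (chord x y / 2)
    exact absurd (by linarith) h

lemma csv_sph_of_chord (ε : ℝ) (hε : 0 < ε) : ∃ η : ℝ, 0 < η ∧
    ∀ x y : OnePoint ℂ, chord x y < η → sph x y < ε := by
  have hc : Continuous fun t : ℝ => 2 * Real.arcsin (t / 2) := by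
    have := Real.continuous_arcsin
    fun_prop
  have h0 := (Metric.continuous_iff.mp hc) 0 ε hε
  obtain ⟨η, hη, h⟩ := h0
  refine ⟨η, hη, fun x y hxy => ?_⟩
  have h1 := csv_chord_nonneg x y
  have h2 := h (chord x y) (by simpa [abs_of_nonneg h1] using hxy)
  simp only [zero_div, Real.arcsin_zero, mul_zero, Real.dist_eq, sub_zero] at h2
  exact (le_abs_self _).trans_lt h2

lemma csv_chord_self (x : OnePoint ℂ) : chord x x = 0 := by
  rw [csv_chord_XY, sub_self]; simp

lemma csv_equicont
    (D : Set ℂ) (hD : IsOpen D) (hDc : IsPreconnected D)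
    (F : Set (ℂ → ℂ)) (hF : ∀ f ∈ F, MeromorphicOn f D)
    (ε : ℝ) (hε : 0 < ε)
    (A : (ℂ → ℂ) → Fin 3 → ℂ → OnePoint ℂ)
    (hA : ∀ f ∈ F, ∀ j : Fin 3, IsMeroSphereOrInf D (A f j))
    (hsep : ∀ f ∈ F, ∀ j k : Fin 3, j ≠ k → ∀ z ∈ D, ε ≤ sph (A f j z) (A f k z))
    (hshare : ∀ f ∈ F, ∀ g ∈ F, ∀ j : Fin 3, ∀ z ∈ D,
      (sphVal f z = A f j z ↔ sphVal g z = A g j z)) {z₀ : ℂ} (hz₀ : z₀ ∈ D) :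
    ∃ C δ : ℝ, 0 < δ ∧ ∀ f ∈ F, ∀ z ∈ ball z₀ δ,
      chord (sphVal f z) (sphVal f z₀) ≤ C * ‖z - z₀‖ := by
  obtain ⟨c, hc0, hc1, hc⟩ := csv_sep_of_sph ε hε
  by_cases hFe : ∃ f₀, f₀ ∈ F
  swap
  · push Not at hFe
    exact ⟨0, 1, one_pos, fun f hf => absurd hf (hFe f)⟩
  obtain ⟨f₀, hf₀⟩ := hFe
  have hΦ : ∀ f ∈ F, ∀ z ∈ D, csvHol (sphVal f) z := fun f hf z hz => csv_hol_sphVal (hF f hf z hz)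
  have hα : ∀ f ∈ F, ∀ j, ∀ z ∈ D, csvHol (A f j) z := fun f hf j z hz =>
    csv_hol_of_mero hD (hA f hf j) hz
  have hch : ∀ f ∈ F, ∀ j k : Fin 3, j ≠ k → ∀ z ∈ D, c ≤ chord (A f j z) (A f k z) :=
    fun f hf j k hjk z hz => hc _ _ (hsep f hf j k hjk z hz)
  have n1 : ∀ j : Fin 3, j ≠ j + 1 := by decide
  have n2 : ∀ j : Fin 3, j ≠ j + 2 := by decide
  have n3 : ∀ j : Fin 3, j + 1 ≠ j + 2 := by decide
  by_cases hcase : ∃ j, ∀ z ∈ D, sphVal f₀ z = A f₀ j z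
  · obtain ⟨j, hj⟩ := hcase
    obtain ⟨R, hR, hRD⟩ := Metric.isOpen_iff.mp hD z₀ hz₀
    refine ⟨8 * (2 / c) ^ 2 / (R * c / 16 * (1 / 4) ^ 2), R * c / 16, by positivity, fun f hf z hz => ?_⟩
    have hj' : ∀ z ∈ D, sphVal f z = A f j z := fun z hz => (hshare f₀ hf₀ f hf j z hz).mp (hj z hz)
    obtain ⟨P, Q, hP, hQ, hb⟩ := csv_repr (α := sphVal f) (β := A f (j + 1)) hR hc0 hc1
      (fun z hz => hΦ f hf z (hRD hz)) (fun z hz => hα f hf _ z (hRD hz))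
      (fun z hz => by rw [hj' z (hRD hz)]; exact hch f hf _ _ (n1 j) z (hRD hz))
    exact csv_equi_of_repr (m := 1 / 4) (M := 2 / c) (by norm_num) hP hQ hb hz
  · push Not at hcase
    have hev : ∀ j, ∀ᶠ w in 𝓝 z₀, w ≠ z₀ → sphVal f₀ w ≠ A f₀ j w := by
      intro j
      rcases csv_ident_local (hΦ f₀ hf₀ z₀ hz₀) (hα f₀ hf₀ j z₀ hz₀) with h | h
      · exfalso
        obtain ⟨w, hw, hne⟩ := hcase j
        exact hne (csv_ident hDc (hΦ f₀ hf₀) (hα f₀ hf₀ j) hz₀ h w hw).self_of_nhds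
      · exact eventually_nhdsWithin_iff.mp h
    obtain ⟨R, hR, hRR⟩ := Metric.eventually_nhds_iff_ball.mp
      ((eventually_all.mpr hev).and (hD.mem_nhds hz₀))
    have hRD : ∀ z ∈ ball z₀ R, z ∈ D := fun z hz => (hRR z hz).2
    obtain ⟨j, hj⟩ : ∃ j, ∀ k, k ≠ j → sphVal f₀ z₀ ≠ A f₀ k z₀ := by
      by_cases hx : ∃ j, sphVal f₀ z₀ = A f₀ j z₀
      · obtain ⟨j, hj⟩ := hx
        refine ⟨j, fun k hk h => ?_⟩
        have := hch f₀ hf₀ k j hk z₀ hz₀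
        rw [← h, ← hj, csv_chord_self] at this
        linarith
      · push Not at hx
        exact ⟨0, fun k _ => hx k⟩
    obtain ⟨C, δ, hδ, hE⟩ := csv_equi c R hc0 hc1 hR
    refine ⟨C, δ, hδ, fun f hf => ?_⟩
    have hne : ∀ k, k ≠ j → ∀ z ∈ ball z₀ R, sphVal f z ≠ A f k z := by
      intro k hk z hz h
      rw [← hshare f₀ hf₀ f hf k z (hRD z hz)] at h
      by_cases hzz : z = z₀
      · exact hj k hk (hzz ▸ h)
      · exact (hRR z hz).1 k hzz h
    have hne1 : ∀ z ∈ ball z₀ R, z ≠ z₀ → sphVal f z ≠ A f j z := by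
      intro z hz hzz h
      rw [← hshare f₀ hf₀ f hf j z (hRD z hz)] at h
      exact (hRR z hz).1 j hzz h
    exact hE z₀ (sphVal f) (A f j) (A f (j + 1)) (A f (j + 2))
      (fun z hz => hΦ f hf z (hRD z hz)) (fun z hz => hα f hf _ z (hRD z hz))
      (fun z hz => hα f hf _ z (hRD z hz)) (fun z hz => hα f hf _ z (hRD z hz))
      (fun z hz => hch f hf _ _ (n1 j) z (hRD z hz))
      (fun z hz => hch f hf _ _ (n2 j) z (hRD z hz))
      (fun z hz => hch f hf _ _ (n1 j).symm z (hRD z hz))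
      (fun z hz => hch f hf _ _ (n3 j) z (hRD z hz))
      (fun z hz => hch f hf _ _ (n2 j).symm z (hRD z hz))
      (fun z hz => hne _ (n2 j).symm z hz) (fun z hz => hne _ (n1 j).symm z hz) hne1


/-- embedding of the sphere -/
noncomputable def csvI (x : OnePoint ℂ) : ℂ × ℝ :=
  Option.elim (α := ℂ) x (0, 0) (fun a => ((1 + ‖a‖ ^ 2)⁻¹ • a, (1 + ‖a‖ ^ 2)⁻¹))

lemma csvI_inf : csvI ∞ = (0, 0) := rfl
lemma csvI_coe (a : ℂ) : csvI (a : OnePoint ℂ) = ((1 + ‖a‖ ^ 2)⁻¹ • a, (1 + ‖a‖ ^ 2)⁻¹) := rfl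

lemma csvI_mem (x : OnePoint ℂ) : ‖(csvI x).1‖ ^ 2 + (csvI x).2 ^ 2 = (csvI x).2 := by
  induction x using OnePoint.rec with
  | infty => simp [csvI_inf]
  | coe a =>
    have : 0 < 1 + ‖a‖ ^ 2 := by positivity
    simp only [csvI_coe, norm_smul, norm_inv, Real.norm_eq_abs, abs_of_pos this]
    field_simp
    ring

lemma csvI_surj (v : ℂ × ℝ) (hv : ‖v.1‖ ^ 2 + v.2 ^ 2 = v.2) : csvI (csvP v.1 (v.2 : ℂ)) = v := by
  obtain ⟨u, t⟩ := v
  simp only at hv ⊢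
  by_cases ht : t = 0
  · subst ht
    have : u = 0 := by simpa using hv
    simp [csvP, csvI_inf, this]
  · have ht0 : 0 < t := lt_of_le_of_ne (by rw [← hv]; positivity) (Ne.symm ht)
    have h1 : (1 + ‖u / (t : ℂ)‖ ^ 2)⁻¹ = t := by
      rw [norm_div, Complex.norm_real, Real.norm_eq_abs, abs_of_pos ht0, div_pow,
        show ‖u‖ ^ 2 = t - t ^ 2 by linarith]
      field_simp
      ring
    rw [csvP, if_neg (by exact_mod_cast ht), csvI_coe, h1]
    simp only [Prod.mk.injEq, and_true, Complex.real_smul]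
    have : (t : ℂ) ≠ 0 := by exact_mod_cast ht
    field_simp

lemma csv_chord_sq (x y : OnePoint ℂ) :
    chord x y ^ 2 = 4 * (‖(csvI x).1 - (csvI y).1‖ ^ 2 + ((csvI x).2 - (csvI y).2) ^ 2) := by
  have key : ∀ a : ℂ, (2 / Real.sqrt (1 + ‖a‖ ^ 2)) ^ 2 =
      4 * (‖(1 + ‖a‖ ^ 2)⁻¹ • a‖ ^ 2 + ((1 + ‖a‖ ^ 2)⁻¹) ^ 2) := by
    intro a
    have h : 0 < 1 + ‖a‖ ^ 2 := by positivity
    rw [div_pow, Real.sq_sqrt h.le, norm_smul, norm_inv, Real.norm_eq_abs, abs_of_pos h]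
    field_simp
    ring
  induction x using OnePoint.rec with
  | infty =>
    induction y using OnePoint.rec with
    | infty => simp [chord_inf_inf]
    | coe b => simpa [chord_inf_coe, csvI_inf, csvI_coe] using key b
  | coe a =>
    induction y using OnePoint.rec with
    | infty => simpa [chord_coe_inf, csvI_inf, csvI_coe] using key a
    | coe b =>
      have hA : 0 < 1 + (a.re * a.re + a.im * a.im) := by nlinarith [sq_nonneg a.re, sq_nonneg a.im]
      have hB : 0 < 1 + (b.re * b.re + b.im * b.im) := by nlinarith [sq_nonneg b.re, sq_nonneg b.im]
      rw [chord_coe_coe, csvI_coe, csvI_coe, div_pow, Real.sq_sqrt (by positivity), mul_pow]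
      simp only [Complex.sq_norm, Complex.normSq_apply, Complex.sub_re, Complex.sub_im,
        Complex.smul_re, Complex.smul_im, smul_eq_mul]
      field_simp
      ring

lemma csv_dist_le (x y : OnePoint ℂ) : dist (csvI x) (csvI y) ≤ chord x y := by
  have h := csv_chord_sq x y
  have h0 := csv_chord_nonneg x y
  rw [Prod.dist_eq, dist_eq_norm, Real.dist_eq]
  refine max_le ?_ ?_
  · refine abs_le_of_sq_le_sq' ?_ h0 |>.2
    nlinarith [sq_nonneg ‖(csvI x).1 - (csvI y).1‖, sq_nonneg ((csvI x).2 - (csvI y).2)]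
  · refine abs_le_of_sq_le_sq ?_ h0
    nlinarith [sq_nonneg ‖(csvI x).1 - (csvI y).1‖, sq_nonneg ((csvI x).2 - (csvI y).2)]

lemma csv_le_dist (x y : OnePoint ℂ) : chord x y ≤ 4 * dist (csvI x) (csvI y) := by
  have h := csv_chord_sq x y
  have h1 : ‖(csvI x).1 - (csvI y).1‖ ≤ dist (csvI x) (csvI y) := by
    rw [Prod.dist_eq, dist_eq_norm]; exact le_max_left _ _
  have h2 : |(csvI x).2 - (csvI y).2| ≤ dist (csvI x) (csvI y) := by
    rw [Prod.dist_eq, ← Real.dist_eq]; exact le_max_right _ _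
  have h3 : ((csvI x).2 - (csvI y).2) ^ 2 ≤ dist (csvI x) (csvI y) ^ 2 := by
    rw [← sq_abs]; gcongr
  have h4 : ‖(csvI x).1 - (csvI y).1‖ ^ 2 ≤ dist (csvI x) (csvI y) ^ 2 := by gcongr
  refine abs_le_of_sq_le_sq' ?_ (by positivity) |>.2
  nlinarith [sq_nonneg (dist (csvI x) (csvI y))]

lemma csv_t_le (x y : OnePoint ℂ) : (csvI x).2 - chord x y ≤ (csvI y).2 := by
  have h2 : |(csvI x).2 - (csvI y).2| ≤ dist (csvI x) (csvI y) := by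
    rw [Prod.dist_eq, ← Real.dist_eq]; exact le_max_right _ _
  have := csv_dist_le x y
  have := le_abs_self ((csvI x).2 - (csvI y).2)
  linarith

lemma csv_finite_of_t {x : OnePoint ℂ} (h : 1 / 8 ≤ (csvI x).2) :
    ∃ a : ℂ, x = a ∧ 1 + ‖a‖ ^ 2 ≤ 8 := by
  induction x using OnePoint.rec with
  | infty => norm_num [csvI_inf] at h
  | coe a =>
    refine ⟨a, rfl, ?_⟩
    rw [csvI_coe] at h
    have h0 : 0 < 1 + ‖a‖ ^ 2 := by positivity
    simp only at h
    rw [le_inv_comm₀ (by norm_num) h0] at h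
    linarith

lemma csv_X_le {x y : OnePoint ℂ} (hx : 1 / 8 ≤ (csvI x).2) (hy : 1 / 8 ≤ (csvI y).2) :
    ‖csvX x - csvX y‖ ≤ 4 * chord x y := by
  obtain ⟨a, rfl, ha⟩ := csv_finite_of_t hx
  obtain ⟨b, rfl, hb⟩ := csv_finite_of_t hy
  rw [chord_coe_coe, csvX_coe, csvX_coe]
  have h1 : Real.sqrt ((1 + ‖a‖ ^ 2) * (1 + ‖b‖ ^ 2)) ≤ 8 := by
    rw [Real.sqrt_le_left (by norm_num)]
    have : (1 + ‖a‖ ^ 2) * (1 + ‖b‖ ^ 2) ≤ 8 * 8 := by gcongr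
    linarith
  have h0 : 0 < Real.sqrt ((1 + ‖a‖ ^ 2) * (1 + ‖b‖ ^ 2)) := Real.sqrt_pos.mpr (by positivity)
  rw [mul_div_assoc', le_div_iff₀ h0]
  nlinarith [norm_nonneg (a - b)]

lemma csv_diff_X {Φ : ℂ → OnePoint ℂ} {z : ℂ} (h : csvHol Φ z) (hn : Φ z ≠ ∞) :
    DifferentiableAt ℂ (fun w => csvX (Φ w)) z := by
  obtain ⟨P, Q, hP, hQ, h0, he⟩ := h
  have hq : Q z ≠ 0 := by
    intro hq
    refine hn ?_
    rw [show Φ z = csvP (P z) (Q z) from he.self_of_nhds, csvP, if_pos hq]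
  refine (hP.differentiableAt.div hQ.differentiableAt hq).congr_of_eventuallyEq ?_
  filter_upwards [he, hQ.continuousAt.eventually_ne hq] with w h1 h2
  rw [h1, csvP, if_neg h2, csvX_coe]; rfl

lemma csv_limit_aux {Φ : ℕ → ℂ → OnePoint ℂ} {G : ℂ → OnePoint ℂ} {z₀ : ℂ} {r : ℝ} (hr : 0 < r)
    (hΦ : ∀ n, ∀ z ∈ ball z₀ r, csvHol (Φ n) z)
    (hlim : ∀ η : ℝ, 0 < η → ∀ᶠ n in atTop, ∀ z ∈ ball z₀ r, chord (G z) (Φ n z) < η)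
    (hcont : ∀ η : ℝ, 0 < η → ∀ᶠ z in 𝓝 z₀, chord (G z₀) (G z) < η)
    (ht : 1 / 2 ≤ (csvI (G z₀)).2) : csvHol G z₀ := by
  obtain ⟨s, hs, hsG⟩ := Metric.eventually_nhds_iff_ball.mp (hcont (1 / 4) (by norm_num))
  set ρ := min r s with hρ
  have hρ0 : 0 < ρ := lt_min hr hs
  have hG : ∀ z ∈ ball z₀ ρ, 1 / 4 ≤ (csvI (G z)).2 := by
    intro z hz
    have := hsG z (ball_subset_ball (min_le_right _ _) hz)
    have := csv_t_le (G z₀) (G z)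
    linarith
  have hsub : ∀ z ∈ ball z₀ ρ, z ∈ ball z₀ r := fun z hz => ball_subset_ball (min_le_left _ _) hz
  have hGn : ∀ z ∈ ball z₀ ρ, G z ≠ ∞ := by
    intro z hz h
    have := hG z hz
    rw [h] at this
    norm_num [csvI_inf] at this
  have hΦt : ∀ᶠ n in atTop, ∀ z ∈ ball z₀ ρ, 1 / 8 ≤ (csvI (Φ n z)).2 := by
    filter_upwards [hlim (1 / 8) (by norm_num)] with n hn z hz
    have := hn z (hsub z hz)
    have := hG z hz
    have := csv_t_le (G z) (Φ n z)
    linarith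
  have hu : TendstoUniformlyOn (fun n w => csvX (Φ n w)) (fun w => csvX (G w)) atTop (ball z₀ ρ) := by
    rw [Metric.tendstoUniformlyOn_iff]
    intro η hη
    filter_upwards [hΦt, hlim (η / 4) (by linarith)] with n h1 h2 z hz
    rw [dist_eq_norm]
    have := csv_X_le (x := G z) (y := Φ n z) (by linarith [hG z hz]) (h1 z hz)
    have := h2 z (hsub z hz)
    linarith
  have hd : DifferentiableOn ℂ (fun w => csvX (G w)) (ball z₀ ρ) := by
    refine hu.tendstoLocallyUniformlyOn.differentiableOn ?_ isOpen_ball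
    filter_upwards [hΦt] with n hn z hz
    refine (csv_diff_X (hΦ n z (hsub z hz)) ?_).differentiableWithinAt
    intro h
    have := hn z hz
    rw [h] at this
    norm_num [csvI_inf] at this
  refine ⟨fun w => csvX (G w), fun _ => 1, hd.analyticAt (ball_mem_nhds _ hρ0), analyticAt_const,
    by simp, ?_⟩
  filter_upwards [ball_mem_nhds z₀ hρ0] with w hw
  have := hGn w hw
  revert this
  generalize G w = x
  induction x using OnePoint.rec with
  | infty => simp
  | coe a => simp [csvP]

/-- inversion -/
noncomputable def csvW (x : OnePoint ℂ) : OnePoint ℂ := csvP (csvY x) (csvX x)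

lemma csvW_P {p q : ℂ} (h : p ≠ 0 ∨ q ≠ 0) : csvW (csvP p q) = csvP q p := by
  obtain ⟨l, hl, e1, e2⟩ := csv_scale h
  have h1 : csvP q p = csvP (l * csvY (csvP p q)) (l * csvX (csvP p q)) := by rw [← e1, ← e2]
  rw [csvW, h1, csvP_smul hl]

lemma csvW_W (x : OnePoint ℂ) : csvW (csvW x) = x := by
  conv_lhs => rw [csvW.eq_def x]
  rw [csvW_P (csvXY_ne x).symm, csvP_XY]

lemma csvW_chord (x y : OnePoint ℂ) : chord (csvW x) (csvW y) = chord x y := by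
  rw [csvW, csvW, csv_chord_P (csvXY_ne x).symm (csvXY_ne y).symm, csv_chord_XY, csvN, csvN, csvN,
    csvN, add_comm (‖csvX x‖ ^ 2), add_comm (‖csvX y‖ ^ 2), ← norm_neg]
  congr 3
  ring_nf

lemma csvW_hol {Φ : ℂ → OnePoint ℂ} {z : ℂ} (h : csvHol Φ z) : csvHol (fun w => csvW (Φ w)) z := by
  obtain ⟨P, Q, hP, hQ, h0, he⟩ := h
  refine ⟨Q, P, hQ, hP, h0.symm, ?_⟩
  filter_upwards [he, csv_ev_ne hP.continuousAt hQ.continuousAt h0] with w h1 h2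
  rw [h1, csvW_P h2]

lemma csvW_t (x : OnePoint ℂ) : (csvI (csvW x)).2 = 1 - (csvI x).2 := by
  induction x using OnePoint.rec with
  | infty =>
    have h : csvW ∞ = ((0 : ℂ) : OnePoint ℂ) := by
      rw [csvW, csvP, csvX_inf, csvY_inf, if_neg one_ne_zero, zero_div]
    rw [h, csvI_coe, csvI_inf]; simp
  | coe a =>
    by_cases ha : a = 0
    · simp [csvW, csvP, csvI_inf, csvI_coe, ha]
    · have : 0 < ‖a‖ := norm_pos_iff.mpr ha
      simp [csvW, csvP, csvI_coe, ha]
      field_simp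
      ring

lemma csv_limit {Φ : ℕ → ℂ → OnePoint ℂ} {G : ℂ → OnePoint ℂ} {z₀ : ℂ} {r : ℝ} (hr : 0 < r)
    (hΦ : ∀ n, ∀ z ∈ ball z₀ r, csvHol (Φ n) z)
    (hlim : ∀ η : ℝ, 0 < η → ∀ᶠ n in atTop, ∀ z ∈ ball z₀ r, chord (G z) (Φ n z) < η)
    (hcont : ∀ η : ℝ, 0 < η → ∀ᶠ z in 𝓝 z₀, chord (G z₀) (G z) < η) : csvHol G z₀ := by
  rcases le_total (1 / 2) (csvI (G z₀)).2 with h | h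
  · exact csv_limit_aux hr hΦ hlim hcont h
  · have := csv_limit_aux (Φ := fun n z => csvW (Φ n z)) (G := fun z => csvW (G z)) (z₀ := z₀) hr
      (fun n z hz => csvW_hol (hΦ n z hz)) (by simpa only [csvW_chord] using hlim)
      (by simpa only [csvW_chord] using hcont) (by rw [csvW_t]; linarith)
    simpa only [csvW_W] using csvW_hol this


/-- compactness of the set of admissible maps -/
lemma csv_ascoli {D : Set ℂ} (hD : IsOpen D) (C δ : D → ℝ) (hδ : ∀ z, 0 < δ z)
    (u : ℕ → D → ℂ × ℝ) (hu : ∀ n z, ‖(u n z).1‖ ^ 2 + (u n z).2 ^ 2 = (u n z).2)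
    (hl : ∀ n z₀ z, dist z z₀ < δ z₀ → dist (u n z) (u n z₀) ≤ C z₀ * dist z z₀) :
    ∃ φ : ℕ → ℕ, StrictMono φ ∧ ∃ g : D → ℂ × ℝ, Continuous g ∧
      (∀ z, ‖(g z).1‖ ^ 2 + (g z).2 ^ 2 = (g z).2) ∧
      ∀ K : Set D, IsCompact K → TendstoUniformlyOn (fun n => u (φ n)) g atTop K := by
  set Sp : Set (ℂ × ℝ) := {v | ‖v.1‖ ^ 2 + v.2 ^ 2 = v.2} with hSp
  have hSpc : IsCompact Sp := by
    refine Metric.isCompact_of_isClosed_isBounded ?_ ?_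
    · exact isClosed_eq (by fun_prop) (by fun_prop)
    · refine (Metric.isBounded_iff_subset_closedBall (0 : ℂ × ℝ)).mpr ⟨1, ?_⟩
      rintro ⟨a, t⟩ h
      have h' : ‖a‖ ^ 2 + t ^ 2 = t := h
      rw [mem_closedBall, dist_zero_right, Prod.norm_def]
      refine max_le ?_ ?_
      · simp only
        nlinarith [norm_nonneg a, sq_nonneg (t - 1), sq_nonneg t]
      · simp only [Real.norm_eq_abs]
        rw [abs_le]
        constructor <;> nlinarith [sq_nonneg ‖a‖, sq_nonneg (t - 1), sq_nonneg t]
  set T : Set (D → ℂ × ℝ) := {h | (∀ z, h z ∈ Sp) ∧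
    ∀ z₀ z, dist z z₀ < δ z₀ → dist (h z) (h z₀) ≤ C z₀ * dist z z₀} with hT
  have hTc : IsCompact T := by
    refine (isCompact_univ_pi fun _ : D => hSpc).of_isClosed_subset ?_ ?_
    · have : T = (⋂ z, {h : D → ℂ × ℝ | h z ∈ Sp}) ∩ ⋂ z₀, ⋂ z, ⋂ (_ : dist z z₀ < δ z₀),
          {h : D → ℂ × ℝ | dist (h z) (h z₀) ≤ C z₀ * dist z z₀} := by
        ext h
        simp [hT]
      rw [this]
      refine IsClosed.inter (isClosed_iInter fun z => ?_) (isClosed_iInter fun z₀ =>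
        isClosed_iInter fun z => isClosed_iInter fun _ => ?_)
      · exact hSpc.isClosed.preimage (continuous_apply z)
      · exact isClosed_le (by fun_prop) (by fun_prop)
    · intro h hh z _
      exact hh.1 z
  have hlip : ∀ z₀, ∀ η > 0, ∀ᶠ z in 𝓝 z₀, ∀ h ∈ T, dist (h z) (h z₀) < η := by
    intro z₀ η hη
    have h1 : Tendsto (fun z => C z₀ * dist z z₀) (𝓝 z₀) (𝓝 0) := by
      have : Continuous fun z => C z₀ * dist z z₀ := by fun_prop
      simpa using this.tendsto z₀
    filter_upwards [h1.eventually_lt_const hη, Metric.ball_mem_nhds z₀ (hδ z₀)] with z h2 h3 h hh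
    exact (hh.2 z₀ z h3).trans_lt h2
  have hcont : ∀ h ∈ T, Continuous h := by
    intro h hh
    rw [continuous_iff_continuousAt]
    intro z₀
    rw [ContinuousAt, Metric.tendsto_nhds]
    intro η hη
    exact (hlip z₀ η hη).mono fun z hz => hz h hh
  set S : Set C(D, ℂ × ℝ) := {g | (g : D → ℂ × ℝ) ∈ T} with hS
  have hSc : IsCompact S := by
    refine ArzelaAscoli.isCompact_of_equicontinuous S ?_ ?_
    · have : ContinuousMap.toFun '' S = T := by
        ext h
        constructor
        · rintro ⟨g, hg, rfl⟩
          exact hg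
        · intro hh
          exact ⟨⟨h, hcont h hh⟩, hh, rfl⟩
      rw [this]
      exact hTc
    · intro z₀
      rw [Metric.equicontinuousAt_iff_right]
      intro η hη
      filter_upwards [hlip z₀ η hη] with z hz g
      rw [dist_comm]
      exact hz _ g.2
  have huT : ∀ n, u n ∈ T := fun n => ⟨hu n, hl n⟩
  have : LocallyCompactSpace D := hD.locallyCompactSpace
  obtain ⟨g, hg, φ, hφ, hlim⟩ := hSc.tendsto_subseq
    (x := fun n => (⟨u n, hcont _ (huT n)⟩ : C(D, ℂ × ℝ))) (fun n => huT n)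
  refine ⟨φ, hφ, g, g.continuous, fun z => hg.1 z, fun K hK => ?_⟩
  exact ContinuousMap.tendsto_iff_forall_isCompact_tendstoUniformlyOn.mp hlim K hK

theorem caratheodory_sharing_variant
    (D : Set ℂ) (hD : IsOpen D) (hDc : IsPreconnected D)
    (F : Set (ℂ → ℂ)) (hF : ∀ f ∈ F, MeromorphicOn f D)
    (ε : ℝ) (hε : 0 < ε)
    (A : (ℂ → ℂ) → Fin 3 → ℂ → OnePoint ℂ)
    (hA : ∀ f ∈ F, ∀ j : Fin 3, IsMeroSphereOrInf D (A f j))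
    (hsep : ∀ f ∈ F, ∀ j k : Fin 3, j ≠ k → ∀ z ∈ D, ε ≤ sph (A f j z) (A f k z))
    (hshare : ∀ f ∈ F, ∀ g ∈ F, ∀ j : Fin 3, ∀ z ∈ D,
      (sphVal f z = A f j z ↔ sphVal g z = A g j z)) :
    NormalOn D F := by
  intro f hf
  have heq := fun z₀ : D => csv_equicont D hD hDc F hF ε hε A hA hsep hshare z₀.2
  choose C δ hδ hE using heq
  obtain ⟨φ, hφ, g, hgc, hgS, hgu⟩ := csv_ascoli hD C δ hδ (fun n z => csvI (sphVal (f n) z))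
    (fun n z => csvI_mem _) (fun n z₀ z hz => (csv_dist_le _ _).trans (by
      have := hE z₀ (f n) (hf n) z hz
      rwa [← dist_eq_norm] at this))
  set G : ℂ → OnePoint ℂ := fun z => if hz : z ∈ D then csvP (g ⟨z, hz⟩).1 ((g ⟨z, hz⟩).2 : ℂ)
    else ∞ with hG
  have hGI : ∀ z : D, csvI (G z) = g z := by
    intro z
    simp only [hG, z.2, dif_pos]
    exact csvI_surj _ (hgS z)
  have hconv : ∀ K : Set ℂ, K ⊆ D → IsCompact K → ∀ η : ℝ, 0 < η →
      ∀ᶠ n in atTop, ∀ z ∈ K, dist (csvI (G z)) (csvI (sphVal (f (φ n)) z)) < η := by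
    intro K hKD hK η hη
    have hK' : IsCompact ((↑) ⁻¹' K : Set D) := by
      rw [Subtype.isCompact_iff, Subtype.image_preimage_coe, Set.inter_eq_right.mpr hKD]
      exact hK
    filter_upwards [Metric.tendstoUniformlyOn_iff.mp (hgu _ hK') η hη] with n hn z hz
    have := hn ⟨z, hKD hz⟩ hz
    rwa [← hGI] at this
  refine ⟨φ, hφ, G, csv_mero_of_hol hDc ?_, ?_⟩
  · intro z₀ hz₀
    obtain ⟨R, hR, hRD⟩ := Metric.isOpen_iff.mp hD z₀ hz₀
    have hsub : closedBall z₀ (R / 2) ⊆ D := (closedBall_subset_ball (by linarith)).trans hRD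
    refine csv_limit (Φ := fun n => sphVal (f (φ n))) (r := R / 2) (by linarith) ?_ ?_ ?_
    · intro n z hz
      exact csv_hol_sphVal (hF _ (hf _) z (hsub (ball_subset_closedBall hz)))
    · intro η hη
      filter_upwards [hconv _ hsub (isCompact_closedBall _ _) (η / 4) (by linarith)] with n hn z hz
      have := hn z (ball_subset_closedBall hz)
      have := csv_le_dist (G z) (sphVal (f (φ n)) z)
      linarith
    · intro η hη
      have h1 : ∀ᶠ z in 𝓝 (⟨z₀, hz₀⟩ : D), dist (g z) (g ⟨z₀, hz₀⟩) < η / 4 :=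
        Metric.tendsto_nhds.mp (hgc.tendsto _) (η / 4) (by linarith)
      have h2 : ∀ᶠ z : D in 𝓝 (⟨z₀, hz₀⟩ : D), chord (G z₀) (G z) < η := by
        filter_upwards [h1] with z hz
        rw [← hGI, ← hGI, dist_comm] at hz
        have := csv_le_dist (G z₀) (G z)
        simp only at hz
        linarith
      rw [nhds_subtype_eq_comap, eventually_comap] at h2
      filter_upwards [h2, hD.mem_nhds hz₀] with z h3 h4
      exact h3 ⟨z, h4⟩ rfl
  · intro K hKD hK ε' hε'
    obtain ⟨η, hη, hs⟩ := csv_sph_of_chord ε' hε'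
    filter_upwards [hconv K hKD hK (η / 4) (by linarith)] with n hn z hz
    refine hs _ _ ?_
    have h1 := hn z hz
    rw [dist_comm] at h1
    have := csv_le_dist (sphVal (f (φ n)) z) (G z)
    linarith
end

section
/- Let F be a family of meromorphic functions on a domain D and let h be meromorphic on D. Then F is normal in D if and only if every z₀ ∈ D has a neighbourhood D(z₀; r) and constants 0 < ε₁ < ε₂ < π such that each f ∈ F satisfies either σ(f(z), h(z)) > ε₁ for all z ∈ D(z₀; r) or σ(f(z), h(z)) < ε₂ for all z ∈ D(z₀; r). -/
open Filter Topology OnePoint Metric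
open scoped Classical

namespace SphAux

/-- stereographic projection -/
noncomputable def stereo (x : OnePoint ℂ) : WithLp 2 (ℂ × ℝ) :=
  Option.elim (α := ℂ) x (WithLp.toLp 2 (0, 1))
    (fun a => WithLp.toLp 2 (((2 / (1 + ‖a‖ ^ 2) : ℝ) : ℂ) * a, 1 - 2 / (1 + ‖a‖ ^ 2)))

theorem stereo_infty : stereo ∞ = WithLp.toLp 2 (0, 1) := rfl
theorem stereo_coe (a : ℂ) : stereo (a : OnePoint ℂ) =
    WithLp.toLp 2 (((2 / (1 + ‖a‖ ^ 2) : ℝ) : ℂ) * a, 1 - 2 / (1 + ‖a‖ ^ 2)) := rfl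

theorem chord_ii : chord ∞ ∞ = 0 := rfl
theorem chord_ic (b : ℂ) : chord ∞ (b : OnePoint ℂ) = 2 / Real.sqrt (1 + ‖b‖ ^ 2) := rfl
theorem chord_ci (b : ℂ) : chord (b : OnePoint ℂ) ∞ = 2 / Real.sqrt (1 + ‖b‖ ^ 2) := rfl
theorem chord_cc (a b : ℂ) : chord (a : OnePoint ℂ) (b : OnePoint ℂ) =
    2 * ‖a - b‖ / Real.sqrt ((1 + ‖a‖ ^ 2) * (1 + ‖b‖ ^ 2)) := rfl

theorem dist_stereo_ci (b : ℂ) : dist (stereo b) (stereo ∞) = 2 / Real.sqrt (1 + ‖b‖ ^ 2) := by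
  have hp : 0 < 1 + ‖b‖ ^ 2 := by positivity
  rw [stereo_infty, stereo_coe, WithLp.prod_dist_eq_of_L2]
  rw [Real.sqrt_eq_iff_eq_sq (by positivity) (by positivity)]
  simp only [dist_eq_norm, sub_zero, norm_mul, Complex.norm_real, Real.norm_eq_abs, sq_abs, mul_pow,
    WithLp.toLp_fst, WithLp.toLp_snd,
    div_pow, Real.sq_sqrt hp.le]
  field_simp
  ring

theorem dist_stereo_cc (a b : ℂ) : dist (stereo a) (stereo b) =
    2 * ‖a - b‖ / Real.sqrt ((1 + ‖a‖ ^ 2) * (1 + ‖b‖ ^ 2)) := by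
  have hp : 0 < 1 + ‖a‖ ^ 2 := by positivity
  have hq : 0 < 1 + ‖b‖ ^ 2 := by positivity
  rw [stereo_coe, stereo_coe, WithLp.prod_dist_eq_of_L2]
  rw [Real.sqrt_eq_iff_eq_sq (by positivity) (by positivity)]
  simp only [dist_eq_norm, Real.norm_eq_abs, sq_abs, mul_pow, WithLp.toLp_fst, WithLp.toLp_snd,
    div_pow, Real.sq_sqrt (mul_pos hp hq).le]
  rw [← Complex.normSq_eq_norm_sq, ← Complex.normSq_eq_norm_sq] at *
  rw [← Complex.normSq_eq_norm_sq, ← Complex.normSq_eq_norm_sq]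
  simp only [Complex.normSq_apply, Complex.sub_re, Complex.sub_im, Complex.re_ofReal_mul,
    Complex.im_ofReal_mul] at *
  field_simp
  ring

theorem chord_eq (x y : OnePoint ℂ) : chord x y = dist (stereo x) (stereo y) := by
  induction x using OnePoint.rec with
  | infty =>
    induction y using OnePoint.rec with
    | infty => rw [chord_ii, dist_self]
    | coe b => rw [chord_ic, dist_comm, dist_stereo_ci]
  | coe a =>
    induction y using OnePoint.rec with
    | infty => rw [chord_ci, dist_stereo_ci]
    | coe b => rw [chord_cc, dist_stereo_cc]

theorem stereo_inj : Function.Injective stereo := by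
  intro x y hxy
  have h0 : chord x y = 0 := by rw [chord_eq, hxy, dist_self]
  induction x using OnePoint.rec with
  | infty =>
    induction y using OnePoint.rec with
    | infty => rfl
    | coe b => rw [chord_ic] at h0; exact absurd h0 (by positivity)
  | coe a =>
    induction y using OnePoint.rec with
    | infty => rw [chord_ci] at h0; exact absurd h0 (by positivity)
    | coe b =>
      rw [chord_cc] at h0
      by_cases hab : a = b
      · rw [hab]
      · have : 0 < ‖a - b‖ := norm_pos_iff.2 (sub_ne_zero.2 hab)
        exact absurd h0 (by positivity)

theorem stereo_cont : Continuous stereo := by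
  rw [continuous_iff_continuousAt]
  intro x
  induction x using OnePoint.rec with
  | infty =>
    rw [OnePoint.continuousAt_infty', tendsto_iff_dist_tendsto_zero]
    simp only [Function.comp_def, dist_stereo_ci, coclosedCompact_eq_cocompact]
    refine Tendsto.div_atTop tendsto_const_nhds ?_
    refine Real.tendsto_sqrt_atTop.comp ?_
    refine tendsto_atTop_add_const_left _ _ ?_
    exact (tendsto_pow_atTop two_ne_zero).comp (tendsto_norm_cocompact_atTop)
  | coe a =>
    rw [OnePoint.continuousAt_coe]
    have : stereo ∘ (fun a : ℂ => (a : OnePoint ℂ)) = fun a : ℂ =>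
      WithLp.toLp 2 (((2 / (1 + ‖a‖ ^ 2) : ℝ) : ℂ) * a, 1 - 2 / (1 + ‖a‖ ^ 2)) := rfl
    rw [this]
    have hne : ∀ a : ℂ, 1 + ‖a‖ ^ 2 ≠ 0 := fun a => by positivity
    have : Continuous fun a : ℂ => 2 / (1 + ‖a‖ ^ 2) :=
      continuous_const.div (by fun_prop) hne
    refine Continuous.continuousAt ?_
    refine (WithLp.prod_continuous_toLp 2 ℂ ℝ).comp ?_
    exact ((Complex.continuous_ofReal.comp this).mul continuous_id).prodMk
      (continuous_const.sub this)

theorem stereo_emb : IsEmbedding stereo :=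
  (stereo_cont.isClosedEmbedding stereo_inj).isEmbedding

noncomputable instance sphMetric : MetricSpace (OnePoint ℂ) := stereo_emb.comapMetricSpace stereo

theorem dist_eq_chord (x y : OnePoint ℂ) : dist x y = chord x y := (chord_eq x y).symm

theorem sph_eq (x y : OnePoint ℂ) : sph x y = 2 * Real.arcsin (dist x y / 2) := by
  rw [sph, dist_eq_chord]

theorem dist_le_two (x y : OnePoint ℂ) : dist x y ≤ 2 := by
  have hi : ∀ b : ℂ, 2 / Real.sqrt (1 + ‖b‖ ^ 2) ≤ 2 := fun b => by
    apply div_le_self (by norm_num)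
    rw [Real.one_le_sqrt]; nlinarith [sq_nonneg ‖b‖]
  rw [dist_eq_chord]
  induction x using OnePoint.rec with
  | infty =>
    induction y using OnePoint.rec with
    | infty => rw [chord_ii]; norm_num
    | coe b => rw [chord_ic]; exact hi b
  | coe a =>
    induction y using OnePoint.rec with
    | infty => rw [chord_ci]; exact hi a
    | coe b =>
      rw [chord_cc, div_le_iff₀ (by positivity)]
      have : ‖a - b‖ ≤ Real.sqrt ((1 + ‖a‖ ^ 2) * (1 + ‖b‖ ^ 2)) := by
        apply Real.le_sqrt_of_sq_le
        have h1 := norm_sub_le a b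
        have h2 : ‖a - b‖ ^ 2 ≤ (‖a‖ + ‖b‖) ^ 2 := by gcongr
        nlinarith [sq_nonneg (‖a‖ * ‖b‖ - 1)]
      linarith

theorem exists_antipode (x : OnePoint ℂ) : ∃ y, dist x y = 2 := by
  simp only [dist_eq_chord]
  induction x using OnePoint.rec with
  | infty => exact ⟨((0 : ℂ) : OnePoint ℂ), by rw [chord_ic]; simp⟩
  | coe a =>
    by_cases ha : a = 0
    · exact ⟨∞, by rw [chord_ci]; simp [ha]⟩
    · refine ⟨((-(starRingEnd ℂ a)⁻¹ : ℂ) : OnePoint ℂ), ?_⟩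
      have hn : 0 < ‖a‖ := norm_pos_iff.2 ha
      have hc : (starRingEnd ℂ a) ≠ 0 := by simpa using ha
      have e1 : ‖a - -(starRingEnd ℂ a)⁻¹‖ = (1 + ‖a‖ ^ 2) / ‖a‖ := by
        have : a - -(starRingEnd ℂ a)⁻¹ = ((1 + ‖a‖ ^ 2 : ℝ) : ℂ) / (starRingEnd ℂ a) := by
          field_simp
          rw [Complex.mul_conj, Complex.normSq_eq_norm_sq]
          push_cast; ring
        rw [this, norm_div, Complex.norm_real, RCLike.norm_conj, Real.norm_of_nonneg (by positivity)]
      have e2 : Real.sqrt ((1 + ‖a‖ ^ 2) * (1 + ‖-(starRingEnd ℂ a)⁻¹‖ ^ 2)) =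
          (1 + ‖a‖ ^ 2) / ‖a‖ := by
        rw [norm_neg, norm_inv, RCLike.norm_conj, Real.sqrt_eq_iff_eq_sq (by positivity)
          (by positivity)]
        field_simp
        ring
      rw [chord_cc, e1, e2]
      field_simp

/-! comparison of `sph` and `dist` -/

theorem lt_dist_of_lt_sph {e : ℝ} (he : 0 < e) (he' : e < Real.pi) :
    0 < 2 * Real.sin (e / 2) ∧ 2 * Real.sin (e / 2) < 2 ∧ ∀ x y : OnePoint ℂ,
      (e < sph x y → 2 * Real.sin (e / 2) < dist x y) ∧
      (sph x y < e → dist x y < 2 * Real.sin (e / 2)) := by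
  have h0 : 0 < Real.sin (e / 2) := Real.sin_pos_of_pos_of_lt_pi (by linarith) (by linarith)
  have h1 : Real.sin (e / 2) < 1 := by
    rw [← Real.sin_pi_div_two]
    exact Real.sin_lt_sin_of_lt_of_le_pi_div_two (by linarith) le_rfl (by linarith)
  refine ⟨by linarith, by linarith, fun x y => ?_⟩
  have hd0 : 0 ≤ dist x y := dist_nonneg
  have hd2 := dist_le_two x y
  rw [sph_eq]
  constructor
  · intro h
    have := (Real.lt_arcsin_iff_sin_lt (x := e / 2) (y := dist x y / 2)
      ⟨by linarith, by linarith⟩ ⟨by linarith, by linarith⟩).1 (by linarith)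
    linarith
  · intro h
    have := (Real.arcsin_lt_iff_lt_sin (y := e / 2) (x := dist x y / 2)
      ⟨by linarith, by linarith⟩ ⟨by linarith, by linarith⟩).1 (by linarith)
    linarith

theorem sph_of_dist {d : ℝ} (hd : 0 < d) (hd' : d < 2) :
    0 < 2 * Real.arcsin (d / 2) ∧ 2 * Real.arcsin (d / 2) < Real.pi ∧ ∀ x y : OnePoint ℂ,
      (d < dist x y ↔ 2 * Real.arcsin (d / 2) < sph x y) ∧
      (dist x y < d ↔ sph x y < 2 * Real.arcsin (d / 2)) := by
  refine ⟨by have := Real.arcsin_pos.2 (half_pos hd); linarith, ?_, fun x y => ?_⟩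
  · have := Real.arcsin_lt_pi_div_two.2 (show d / 2 < 1 by linarith); linarith
  have hd0 : 0 ≤ dist x y := dist_nonneg
  have hd2 := dist_le_two x y
  have m1 : d / 2 ∈ Set.Icc (-1 : ℝ) 1 := ⟨by linarith, by linarith⟩
  have m2 : dist x y / 2 ∈ Set.Icc (-1 : ℝ) 1 := ⟨by linarith, by linarith⟩
  rw [sph_eq]
  have a1 := Real.strictMonoOn_arcsin.lt_iff_lt m1 m2
  have a2 := Real.strictMonoOn_arcsin.lt_iff_lt m2 m1
  constructor
  · constructor
    · intro h; have := a1.2 (by linarith); linarith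
    · intro h; have := a1.1 (by linarith); linarith
  · constructor
    · intro h; have := a2.2 (by linarith); linarith
    · intro h; have := a2.1 (by linarith); linarith

/-! spherical values of meromorphic functions -/

theorem sphVal_eq_of_tendsto {f : ℂ → ℂ} {z : ℂ} {L : OnePoint ℂ}
    (hL : Tendsto (fun w => (f w : OnePoint ℂ)) (𝓝[≠] z) (𝓝 L)) : sphVal f z = L := by
  induction L using OnePoint.rec with
  | infty =>
    have : Tendsto f (𝓝[≠] z) (comap ((↑) : ℂ → OnePoint ℂ) (𝓝 ∞)) := tendsto_comap_iff.2 hL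
    rw [OnePoint.comap_coe_nhds_infty, coclosedCompact_eq_cocompact] at this
    have h2 : Tendsto (fun w => ‖f w‖) (𝓝[≠] z) atTop := tendsto_norm_cocompact_atTop.comp this
    rw [sphVal, if_pos h2]
  | coe c =>
    have : Tendsto f (𝓝[≠] z) (𝓝 c) :=
      (OnePoint.isOpenEmbedding_coe.isInducing.tendsto_nhds_iff).2 hL
    rw [sphVal, if_neg (not_tendsto_atTop_of_tendsto_nhds this.norm), this.limUnder_eq]

theorem tendsto_sphVal {f : ℂ → ℂ} {z : ℂ} (hf : MeromorphicAt f z) :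
    Tendsto (fun w => (f w : OnePoint ℂ)) (𝓝[≠] z) (𝓝 (sphVal f z)) := by
  have : ∃ L : OnePoint ℂ, Tendsto (fun w => (f w : OnePoint ℂ)) (𝓝[≠] z) (𝓝 L) := by
    by_cases ho : 0 ≤ meromorphicOrderAt f z
    · obtain ⟨c, hc⟩ := tendsto_nhds_of_meromorphicOrderAt_nonneg hf ho
      exact ⟨c, (OnePoint.continuous_coe.tendsto c).comp hc⟩
    · refine ⟨∞, ?_⟩
      have := tendsto_cobounded_of_meromorphicOrderAt_neg (not_le.1 ho)
      rw [Metric.cobounded_eq_cocompact, ← coclosedCompact_eq_cocompact,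
        ← OnePoint.comap_coe_nhds_infty] at this
      exact tendsto_comap_iff.1 this
  obtain ⟨L, hL⟩ := this
  rwa [sphVal_eq_of_tendsto hL]

theorem sphVal_analytic {f : ℂ → ℂ} {z : ℂ} (hf : AnalyticAt ℂ f z) : sphVal f z = f z :=
  sphVal_eq_of_tendsto ((OnePoint.continuous_coe.tendsto _).comp
    (hf.continuousAt.tendsto.mono_left nhdsWithin_le_nhds))

theorem sphVal_cont {f : ℂ → ℂ} {z : ℂ} (hf : MeromorphicAt f z) : ContinuousAt (sphVal f) z := by
  rw [← continuousWithinAt_compl_self]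
  refine (tendsto_sphVal hf).congr' ?_
  filter_upwards [hf.eventually_analyticAt] with w hw
  exact (sphVal_analytic hw).symm

/-! The Moebius map `w ↦ 1/(w-a)` and its inverse -/

noncomputable def U (a : ℂ) (x : OnePoint ℂ) : ℂ := Option.elim (α := ℂ) x 0 (fun w => (w - a)⁻¹)
noncomputable def T (a : ℂ) (w : ℂ) : OnePoint ℂ := if w = 0 then ∞ else ((a + w⁻¹ : ℂ) : OnePoint ℂ)

theorem U_infty (a : ℂ) : U a ∞ = 0 := rfl
theorem U_coe (a w : ℂ) : U a (w : OnePoint ℂ) = (w - a)⁻¹ := rfl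

theorem T_U (a : ℂ) (x : OnePoint ℂ) (hx : x ≠ a) : T a (U a x) = x := by
  induction x using OnePoint.rec with
  | infty => rw [U_infty, T, if_pos rfl]
  | coe w =>
    have : w - a ≠ 0 := sub_ne_zero.2 (fun h => hx (by rw [h]))
    rw [U_coe, T, if_neg (inv_ne_zero this), inv_inv, add_sub_cancel]

theorem U_cont (a : ℂ) (x : OnePoint ℂ) (hx : x ≠ a) : ContinuousAt (U a) x := by
  induction x using OnePoint.rec with
  | infty =>
    rw [OnePoint.continuousAt_infty', coclosedCompact_eq_cocompact, U_infty]
    show Tendsto (fun w : ℂ => (w - a)⁻¹) (cocompact ℂ) (𝓝 0)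
    refine (tendsto_inv₀_cobounded (α := ℂ)).comp ?_
    rw [Metric.cobounded_eq_cocompact]
    exact (Homeomorph.subRight a).isClosedEmbedding.tendsto_cocompact
  | coe w =>
    have : w - a ≠ 0 := sub_ne_zero.2 (fun h => hx (by rw [h]))
    rw [OnePoint.continuousAt_coe]
    show ContinuousAt (fun w : ℂ => (w - a)⁻¹) w
    exact ContinuousAt.inv₀ (by fun_prop) this

theorem T_cont (a : ℂ) : Continuous (T a) := by
  rw [continuous_iff_continuousAt]
  intro w
  by_cases hw : w = 0
  · subst hw
    rw [← continuousWithinAt_compl_self, ContinuousWithinAt]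
    have h1 : T a 0 = ∞ := if_pos rfl
    rw [h1]
    have h2 : Tendsto (fun w : ℂ => a + w⁻¹) (𝓝[≠] 0) (comap ((↑) : ℂ → OnePoint ℂ) (𝓝 ∞)) := by
      rw [OnePoint.comap_coe_nhds_infty, coclosedCompact_eq_cocompact]
      refine ((Homeomorph.addLeft a).isClosedEmbedding.tendsto_cocompact).comp ?_
      rw [← Metric.cobounded_eq_cocompact]
      exact tendsto_inv₀_nhdsNE_zero
    refine (tendsto_comap_iff.1 h2).congr' ?_
    filter_upwards [self_mem_nhdsWithin] with w hw
    exact (if_neg hw).symm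
  · have : ContinuousAt (fun w : ℂ => ((a + w⁻¹ : ℂ) : OnePoint ℂ)) w :=
      OnePoint.continuous_coe.continuousAt.comp
        (continuousAt_const.add (continuousAt_inv₀ hw))
    refine this.congr ?_
    filter_upwards [isOpen_ne.mem_nhds hw] with v hv
    exact (if_neg hv).symm

theorem U_bound (a : ℂ) {c : ℝ} (hc : 0 < c) (x : OnePoint ℂ) (hx : c ≤ dist x a) :
    ‖U a x‖ ≤ 2 / c := by
  induction x using OnePoint.rec with
  | infty => rw [U_infty, norm_zero]; positivity
  | coe w =>
    rw [dist_eq_chord, chord_cc] at hx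
    have h1 : 1 ≤ Real.sqrt ((1 + ‖w‖ ^ 2) * (1 + ‖a‖ ^ 2)) := by
      rw [Real.one_le_sqrt]
      nlinarith [sq_nonneg ‖w‖, sq_nonneg ‖a‖, mul_nonneg (sq_nonneg ‖w‖) (sq_nonneg ‖a‖)]
    have h2 : c ≤ 2 * ‖w - a‖ := hx.trans (div_le_self (by positivity) h1)
    rw [U_coe, norm_inv, inv_le_comm₀ (by linarith) (by positivity), inv_div]
    linarith

theorem ne_of_le_dist {c : ℝ} (hc : 0 < c) {x y : OnePoint ℂ} (h : c ≤ dist x y) : x ≠ y := by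
  rintro rfl
  rw [dist_self] at h
  linarith

theorem U_diff {f : ℂ → ℂ} {z a : ℂ} (hf : MeromorphicAt f z)
    (hne : ∀ᶠ w in 𝓝 z, sphVal f w ≠ a) : DifferentiableAt ℂ (fun w => U a (sphVal f w)) z := by
  refine (Complex.analyticAt_of_differentiable_on_punctured_nhds_of_continuousAt ?_ ?_).differentiableAt
  · filter_upwards [hf.eventually_analyticAt, hne.filter_mono nhdsWithin_le_nhds] with w hw hw'
    have h1 : f w - a ≠ 0 := by
      rw [sphVal_analytic hw] at hw'
      exact sub_ne_zero.2 (fun h => hw' (by rw [h]))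
    have h2 : DifferentiableAt ℂ (fun w => (f w - a)⁻¹) w :=
      (hw.differentiableAt.sub_const a).inv h1
    refine h2.congr_of_eventuallyEq ?_
    filter_upwards [hw.eventually_analyticAt] with v hv
    rw [sphVal_analytic hv, U_coe]
  · exact (U_cont a _ hne.self_of_nhds).comp (sphVal_cont hf)

theorem mod_of_avoid (a : ℂ) {c r ε : ℝ} (hc : 0 < c) (hr : 0 < r) (hε : 0 < ε) :
    ∃ δ > 0, ∀ (f : ℂ → ℂ) (z0 : ℂ), MeromorphicOn f (ball z0 r) →
      (∀ z ∈ ball z0 r, c ≤ dist (sphVal f z) a) →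
      ∀ z, dist z z0 < δ → dist (sphVal f z) (sphVal f z0) < ε := by
  have hu : UniformContinuousOn (T a) (closedBall 0 (2 / c)) :=
    (isCompact_closedBall _ _).uniformContinuousOn_of_continuous (T_cont a).continuousOn
  obtain ⟨η, hη, H⟩ := Metric.uniformContinuousOn_iff.1 hu ε hε
  refine ⟨min r (η / (4 / c / r)), by positivity, fun f z0 hf ho z hz => ?_⟩
  have hzr : z ∈ ball z0 r := lt_of_lt_of_le hz (min_le_left _ _)
  have hz0 : z0 ∈ ball z0 r := mem_ball_self hr
  have hz2 : dist z z0 < η / (4 / c / r) := lt_of_lt_of_le hz (min_le_right _ _)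
  set g : ℂ → ℂ := fun w => U a (sphVal f w) with hg
  have hb : ∀ w ∈ ball z0 r, g w ∈ closedBall (0 : ℂ) (2 / c) := fun w hw => by
    rw [mem_closedBall_zero_iff]; exact U_bound a hc _ (ho w hw)
  have hd : DifferentiableOn ℂ g (ball z0 r) := fun w hw => by
    refine (U_diff (hf w hw) ?_).differentiableWithinAt
    filter_upwards [isOpen_ball.mem_nhds hw] with v hv
    exact ne_of_le_dist hc (ho v hv)
  have hm : Set.MapsTo g (ball z0 r) (closedBall (g z0) (4 / c)) := fun w hw => by
    have h1 := hb w hw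
    have h2 := hb z0 hz0
    rw [mem_closedBall] at h1 h2 ⊢
    rw [dist_comm] at h2
    have := dist_triangle (g w) 0 (g z0)
    have e : 4 / c = 2 / c + 2 / c := by ring
    rw [e]; linarith
  have hs := Complex.dist_le_div_mul_dist_of_mapsTo_ball hd hm hzr
  have hlt : dist (g z) (g z0) < η := by
    refine hs.trans_lt ?_
    rw [mul_comm]
    exact (lt_div_iff₀ (by positivity)).1 hz2
  have := H _ (hb z hzr) _ (hb z0 hz0) hlt
  rwa [T_U _ _ (ne_of_le_dist hc (ho z hzr)), T_U _ _ (ne_of_le_dist hc (ho z0 hz0))] at this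

theorem exists_coe_near (x : OnePoint ℂ) {η : ℝ} (hη : 0 < η) :
    ∃ a : ℂ, dist x (a : OnePoint ℂ) < η := by
  obtain ⟨y, hy⟩ := (OnePoint.denseRange_coe (X := ℂ)).exists_dist_lt x hη
  exact ⟨y, hy⟩

theorem avoid_of_dichotomy (D : Set ℂ) (F : Set (ℂ → ℂ)) (h : ℂ → ℂ) (hh : MeromorphicOn h D)
    (z₀ : ℂ) (hz₀ : z₀ ∈ D)
    (H : ∃ r : ℝ, 0 < r ∧ Metric.ball z₀ r ⊆ D ∧
        ∃ ε₁ ε₂ : ℝ, 0 < ε₁ ∧ ε₁ < ε₂ ∧ ε₂ < Real.pi ∧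
          ∀ f ∈ F,
            (∀ z ∈ Metric.ball z₀ r, ε₁ < sph (sphVal f z) (sphVal h z)) ∨
            (∀ z ∈ Metric.ball z₀ r, sph (sphVal f z) (sphVal h z) < ε₂)) :
    ∃ r > 0, ball z₀ r ⊆ D ∧ ∃ c > 0, ∃ a b : ℂ, ∀ f ∈ F,
      (∀ z ∈ ball z₀ r, c ≤ dist (sphVal f z) a) ∨ (∀ z ∈ ball z₀ r, c ≤ dist (sphVal f z) b) := by
  obtain ⟨r, hr, hrD, e1, e2, h1, h12, h2, Hf⟩ := H
  obtain ⟨a1, -, a2⟩ := lt_dist_of_lt_sph h1 (h12.trans h2)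
  obtain ⟨-, b1, b2⟩ := lt_dist_of_lt_sph (h1.trans h12) h2
  set c1 := 2 * Real.sin (e1 / 2)
  set c2 := 2 * Real.sin (e2 / 2)
  obtain ⟨m, hm, hm1, hm2⟩ : ∃ m > 0, m ≤ c1 ∧ m ≤ 2 - c2 :=
    ⟨min c1 (2 - c2), lt_min a1 (by linarith), min_le_left _ _, min_le_right _ _⟩
  obtain ⟨q, hq⟩ := exists_antipode (sphVal h z₀)
  obtain ⟨a, ha⟩ := exists_coe_near (sphVal h z₀) (show 0 < m / 3 by positivity)
  obtain ⟨b, hb⟩ := exists_coe_near q (show 0 < m / 3 by positivity)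
  obtain ⟨s, hs, Hs⟩ := Metric.continuousAt_iff.1 (sphVal_cont (hh z₀ hz₀)) (m / 3) (by positivity)
  refine ⟨min r s, lt_min hr hs, (ball_subset_ball (min_le_left _ _)).trans hrD, m / 3,
    by positivity, a, b, fun f hf => ?_⟩
  refine (Hf f hf).imp (fun hA z hz => ?_) (fun hB z hz => ?_)
  · have k1 := (a2 _ _).1 (hA z (ball_subset_ball (min_le_left _ _) hz))
    have k2 := Hs (lt_of_lt_of_le hz (min_le_right _ _))
    have t1 := dist_triangle4_right (sphVal f z) (sphVal h z) (a : OnePoint ℂ) (sphVal h z₀)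
    have t2 := dist_triangle (sphVal f z) a (sphVal h z)
    have t3 := dist_triangle (a : OnePoint ℂ) (sphVal h z₀) (sphVal h z)
    rw [dist_comm (a : OnePoint ℂ) (sphVal h z₀), dist_comm (sphVal h z₀) (sphVal h z)] at t3
    linarith
  · have k1 := (b2 _ _).2 (hB z (ball_subset_ball (min_le_left _ _) hz))
    have k2 := Hs (lt_of_lt_of_le hz (min_le_right _ _))
    have t1 := dist_triangle (sphVal h z₀) (sphVal h z) q
    have t2 := dist_triangle (sphVal h z) (sphVal f z) q
    have t3 := dist_triangle (sphVal f z) b q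
    rw [dist_comm (sphVal h z₀) (sphVal h z)] at t1
    rw [dist_comm (sphVal h z) (sphVal f z)] at t2
    rw [dist_comm (b : OnePoint ℂ) q] at t3
    linarith

theorem exists_subseq {D : Set ℂ} (hD : IsOpen D) (u : ℕ → ℂ → OnePoint ℂ)
    (equi : ∀ x ∈ D, ∀ ε > 0, ∃ δ > 0, ∀ n, ∀ y ∈ D, dist y x < δ → dist (u n y) (u n x) ≤ ε) :
    ∃ φ : ℕ → ℕ, StrictMono φ ∧ ∃ G : ℂ → OnePoint ℂ, ContinuousOn G D ∧
      ∀ K : Set ℂ, K ⊆ D → IsCompact K → ∀ ε : ℝ, 0 < ε →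
        ∀ᶠ n in atTop, ∀ z ∈ K, dist (u (φ n) z) (G z) < ε := by
  have : LocallyCompactSpace D := hD.locallyCompactSpace
  let E : Set (D → OnePoint ℂ) := {v | ∀ x : D, ∀ ε > 0, ∀ δ > 0,
    (∀ n, ∀ y ∈ D, dist y (x : ℂ) < δ → dist (u n y) (u n x) ≤ ε) →
    ∀ y : D, dist (y : ℂ) x < δ → dist (v y) (v x) ≤ ε}
  have hEc : ∀ v ∈ E, Continuous v := fun v hv => by
    rw [Metric.continuous_iff]
    intro x ε hε
    obtain ⟨δ, hδ, h⟩ := equi x x.2 (ε / 2) (by positivity)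
    exact ⟨δ, hδ, fun y hy => (hv x _ (by positivity) δ hδ h y hy).trans_lt (by linarith)⟩
  have hEcl : IsClosed E := by
    simp only [E, Set.ofPred_forall]
    refine isClosed_iInter fun x => isClosed_iInter fun ε => isClosed_iInter fun _ =>
      isClosed_iInter fun δ => isClosed_iInter fun _ => isClosed_iInter fun _ =>
      isClosed_iInter fun y => isClosed_iInter fun _ => ?_
    exact isClosed_le ((continuous_apply y).dist (continuous_apply x)) continuous_const
  let S : Set C(D, OnePoint ℂ) := {v | (v : D → OnePoint ℂ) ∈ E}
  have himg : ContinuousMap.toFun '' S = E := by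
    ext v
    constructor
    · rintro ⟨w, hw, rfl⟩; exact hw
    · intro hv; exact ⟨⟨v, hEc v hv⟩, hv, rfl⟩
  have hS : IsCompact S := by
    refine ArzelaAscoli.isCompact_of_equicontinuous S (himg ▸ hEcl.isCompact) ?_
    intro x
    rw [Metric.equicontinuousAt_iff]
    intro ε hε
    obtain ⟨δ, hδ, h⟩ := equi x x.2 (ε / 2) (by positivity)
    refine ⟨δ, hδ, fun y hy v => ?_⟩
    have := v.2 x _ (by positivity) δ hδ h y hy
    rw [dist_comm] at this
    exact this.trans_lt (by linarith)
  have huE : ∀ n, (fun x : D => u n x) ∈ E := fun n x ε _ δ _ h y hy => h n y y.2 hy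
  obtain ⟨g, -, φ, hφ, hlim⟩ := hS.isSeqCompact
    (x := fun n => (⟨fun x : D => u n x, hEc _ (huE n)⟩ : C(D, OnePoint ℂ))) (fun n => huE n)
  refine ⟨φ, hφ, fun z => if hz : z ∈ D then g ⟨z, hz⟩ else ∞, ?_, ?_⟩
  · rw [continuousOn_iff_continuous_domRestrict]
    convert g.continuous using 1
    ext x
    simp
  · intro K hKD hK ε hε
    rw [ContinuousMap.tendsto_iff_forall_isCompact_tendstoUniformlyOn] at hlim
    have hK' : IsCompact ((↑) ⁻¹' K : Set D) := by
      rw [IsEmbedding.subtypeVal.isCompact_iff, Set.image_preimage_eq_of_subset (by simpa using hKD)]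
      exact hK
    filter_upwards [Metric.tendstoUniformlyOn_iff.1 (hlim _ hK') ε hε] with n hn z hz
    have := hn ⟨z, hKD hz⟩ hz
    rw [dif_pos (hKD hz), dist_comm]
    exact this

theorem tendsto_joint {D : Set ℂ} (hD : IsOpen D) {u : ℕ → ℂ → OnePoint ℂ} {G : ℂ → OnePoint ℂ}
    (hG : ContinuousOn G D)
    (hlim : ∀ K : Set ℂ, K ⊆ D → IsCompact K → ∀ ε : ℝ, 0 < ε →
        ∀ᶠ n in atTop, ∀ z ∈ K, dist (u n z) (G z) < ε) {z : ℂ} (hz : z ∈ D) :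
    Tendsto (fun y : ℕ × ℂ => u y.1 y.2) (atTop ×ˢ 𝓝 z) (𝓝 (G z)) := by
  rw [Metric.tendsto_nhds]
  intro ε hε
  obtain ⟨K, hK, hKz, hKD⟩ := exists_compact_subset hD hz
  have h1 := hlim K hKD hK (ε / 2) (by positivity)
  have h2 := Metric.tendsto_nhds.1 (hG.continuousAt (hD.mem_nhds hz)).tendsto (ε / 2)
    (by positivity)
  filter_upwards [h1.prod_mk (h2.and (mem_interior_iff_mem_nhds.1 hKz))] with y hy
  have := hy.1 y.2 hy.2.2
  have := hy.2.1
  have := dist_triangle (u y.1 y.2) (G y.2) (G z)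
  linarith

theorem local_limit {D : Set ℂ} (hD : IsOpen D) {f : ℕ → ℂ → ℂ} {G : ℂ → OnePoint ℂ}
    (hf : ∀ n, MeromorphicOn (f n) D)
    (hG : ContinuousOn G D)
    (hlim : ∀ K : Set ℂ, K ⊆ D → IsCompact K → ∀ ε : ℝ, 0 < ε →
        ∀ᶠ n in atTop, ∀ z ∈ K, dist (sphVal (f n) z) (G z) < ε)
    {z₀ : ℂ} {r c : ℝ} (hrD : ball z₀ r ⊆ D) (hc : 0 < c) (a : ℂ)
    (ho : ∃ᶠ n in atTop, ∀ z ∈ ball z₀ r, c ≤ dist (sphVal (f n) z) a) :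
    ∃ g : ℂ → ℂ, DifferentiableOn ℂ g (ball z₀ r) ∧ ∀ z ∈ ball z₀ r, G z = T a (g z) := by
  set P : Set ℕ := {n | ∀ z ∈ ball z₀ r, c ≤ dist (sphVal (f n) z) a} with hP
  let p : Filter ℕ := atTop ⊓ 𝓟 P
  have hpn : p.NeBot := frequently_mem_iff_neBot.1 ho
  have hpP : ∀ᶠ n in p, n ∈ P := mem_inf_of_right (mem_principal_self P)
  have hGa : ∀ z ∈ ball z₀ r, c ≤ dist (G z) a := by
    intro z hz
    have h1 : Tendsto (fun n => sphVal (f n) z) p (𝓝 (G z)) := by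
      refine Tendsto.mono_left ?_ inf_le_left
      rw [Metric.tendsto_nhds]
      intro ε hε
      filter_upwards [hlim {z} (by simpa using hrD hz) isCompact_singleton ε hε] with n hn
      exact hn z rfl
    refine ge_of_tendsto (h1.dist tendsto_const_nhds) ?_
    filter_upwards [hpP] with n hn using hn z hz
  refine ⟨fun z => U a (G z), ?_, fun z hz => (T_U a _ (ne_of_le_dist hc (hGa z hz))).symm⟩
  have hlu : TendstoLocallyUniformlyOn (fun n z => U a (sphVal (f n) z)) (fun z => U a (G z)) p
      (ball z₀ r) := by
    rw [isOpen_ball.tendstoLocallyUniformlyOn_iff_forall_tendsto]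
    intro z hz
    have hU := U_cont a (G z) (ne_of_le_dist hc (hGa z hz))
    have h1 : Tendsto (fun y : ℕ × ℂ => U a (sphVal (f y.1) y.2)) (p ×ˢ 𝓝 z) (𝓝 (U a (G z))) :=
      hU.tendsto.comp ((tendsto_joint hD hG hlim (hrD hz)).mono_left
        (Filter.prod_mono inf_le_left le_rfl))
    have h2 : Tendsto (fun y : ℕ × ℂ => U a (G y.2)) (p ×ˢ 𝓝 z) (𝓝 (U a (G z))) :=
      (hU.tendsto.comp (hG.continuousAt (hD.mem_nhds (hrD hz))).tendsto).comp tendsto_snd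
    exact (h2.prodMk_nhds h1).mono_right (nhds_le_uniformity _)
  refine hlu.differentiableOn ?_ isOpen_ball
  filter_upwards [hpP] with n hn w hw
  refine (U_diff (hf n w (hrD hw)) ?_).differentiableWithinAt
  filter_upwards [isOpen_ball.mem_nhds hw] with v hv
  exact ne_of_le_dist hc (hn v hv)

noncomputable def toC (x : OnePoint ℂ) : ℂ := Option.elim (α := ℂ) x 0 id

theorem coe_toC {x : OnePoint ℂ} (hx : x ≠ ∞) : (toC x : OnePoint ℂ) = x := by
  induction x using OnePoint.rec with
  | infty => exact absurd rfl hx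
  | coe a => rfl

theorem glue {D : Set ℂ} (hDc : IsPreconnected D) (hD : IsOpen D) {G : ℂ → OnePoint ℂ}
    (hG : ContinuousOn G D)
    (hloc : ∀ z₀ ∈ D, ∃ r > 0, ∃ a : ℂ, ∃ g : ℂ → ℂ, DifferentiableOn ℂ g (ball z₀ r) ∧
      ∀ z ∈ ball z₀ r, G z = T a (g z)) : IsMeroSphereOrInf D G := by
  have hloc' : ∀ z ∈ D, ∃ a : ℂ, ∃ g : ℂ → ℂ, AnalyticAt ℂ g z ∧ ∀ᶠ w in 𝓝 z, G w = T a (g w) := by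
    intro z hz
    obtain ⟨r, hr, a, g, hg, hGg⟩ := hloc z hz
    refine ⟨a, g, hg.analyticAt (ball_mem_nhds z hr), ?_⟩
    filter_upwards [ball_mem_nhds z hr] with w hw using hGg w hw
  have key : ∀ z ∈ D, (∀ᶠ w in 𝓝 z, G w = ∞) ∨
      ((∀ᶠ w in 𝓝[≠] z, G w ≠ ∞) ∧ MeromorphicAt (fun w => toC (G w)) z) := by
    intro z hz
    obtain ⟨a, g, hg, hGg⟩ := hloc' z hz
    rcases hg.eventually_eq_zero_or_eventually_ne_zero with h0 | h0
    · left
      filter_upwards [h0, hGg] with w hw hw'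
      rw [hw', T, if_pos hw]
    · right
      have hev : ∀ᶠ w in 𝓝[≠] z, G w = ((a + (g w)⁻¹ : ℂ) : OnePoint ℂ) := by
        filter_upwards [h0, hGg.filter_mono nhdsWithin_le_nhds] with w hw hw'
        rw [hw', T, if_neg hw]
      constructor
      · filter_upwards [hev] with w hw
        rw [hw]; exact OnePoint.coe_ne_infty _
      · have hm : MeromorphicAt (fun w => a + (g w)⁻¹) z :=
          (MeromorphicAt.const a z).add hg.meromorphicAt.inv
        refine hm.congr ?_
        filter_upwards [hev] with w hw
        rw [hw]; rfl
  let A : Set ℂ := {z | ∀ᶠ w in 𝓝 z, G w = ∞}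
  let B : Set ℂ := {z | ∀ᶠ w in 𝓝[≠] z, G w ≠ ∞}
  have hA : IsOpen A := isOpen_iff_mem_nhds.2 fun z hz => eventually_eventually_nhds.2 hz
  have hB : IsOpen B := isOpen_iff_mem_nhds.2 fun z hz => by
    have h1 : ∀ᶠ w in 𝓝[≠] z, w ∈ B := by
      filter_upwards [eventually_nhdsNE_eventually_nhds_iff.2 hz] with w hw
      exact hw.filter_mono nhdsWithin_le_nhds
    rw [eventually_nhdsWithin_iff] at h1
    filter_upwards [h1] with w hw
    by_cases hwz : w = z
    · rw [hwz]; exact hz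
    · exact hw hwz
  have hAB : Disjoint A B := by
    rw [Set.disjoint_left]
    intro z h1 h2
    have h3 : ∀ᶠ w in 𝓝[≠] z, False := by
      filter_upwards [h2, h1.filter_mono nhdsWithin_le_nhds] with w hw hw' using hw hw'
    exact (h3.exists).elim fun _ h => h
  have hsub : D ⊆ A ∪ B := fun z hz => (key z hz).imp id And.left
  rcases hDc.subset_or_subset hA hB hAB hsub with h | h
  · right
    intro z hz
    exact (h hz).self_of_nhds
  · left
    refine ⟨fun w => toC (G w), fun z hz => ?_, fun z hz => ?_⟩
    · rcases key z hz with h1 | h1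
      · exact absurd (h hz) (Set.disjoint_left.1 hAB h1)
      · exact h1.2
    · symm
      apply sphVal_eq_of_tendsto
      have h1 := (hG.continuousAt (hD.mem_nhds hz)).tendsto.mono_left
        (nhdsWithin_le_nhds (s := {z}ᶜ))
      refine h1.congr' ?_
      filter_upwards [show ∀ᶠ w in 𝓝[≠] z, G w ≠ ∞ from h hz] with w hw
      exact (coe_toC hw).symm

theorem cont_of_mero {D : Set ℂ} (hD : IsOpen D) {G : ℂ → OnePoint ℂ} (hG : IsMeroSphereOrInf D G) :
    ContinuousOn G D := by
  intro z hz
  rcases hG with ⟨a, ha, hGa⟩ | hG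
  · refine ((sphVal_cont (ha z hz)).congr ?_).continuousWithinAt
    filter_upwards [hD.mem_nhds hz] with w hw using (hGa w hw).symm
  · refine ((continuousAt_const (y := (∞ : OnePoint ℂ))).congr ?_).continuousWithinAt
    filter_upwards [hD.mem_nhds hz] with w hw using (hG w hw).symm

theorem normal_equi {D : Set ℂ} (hD : IsOpen D) {F : Set (ℂ → ℂ)} (hN : NormalOn D F)
    {z₀ : ℂ} (hz₀ : z₀ ∈ D) {δ : ℝ} (hδ : 0 < δ) (hδ2 : δ < 2) :
    ∃ r > 0, ∀ f ∈ F, ∀ z ∈ ball z₀ r, dist (sphVal f z) (sphVal f z₀) < δ := by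
  by_contra hcon
  have hcon' : ∀ n : ℕ, ∃ f ∈ F, ∃ z, dist z z₀ < 1 / ((n : ℝ) + 1) ∧
      δ ≤ dist (sphVal f z) (sphVal f z₀) := by
    intro n
    by_contra hc
    push Not at hc
    exact hcon ⟨1 / ((n : ℝ) + 1), by positivity, fun f hf z hz => hc f hf z hz⟩
  choose f hfF z hz hfz using hcon'
  obtain ⟨φ, hφ, G, hG, hlim⟩ := hN f hfF
  have hGc := cont_of_mero hD hG
  have hlim' : ∀ K : Set ℂ, K ⊆ D → IsCompact K → ∀ ε : ℝ, 0 < ε →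
        ∀ᶠ n in atTop, ∀ z ∈ K, dist (sphVal (f (φ n)) z) (G z) < ε := by
    intro K hKD hK ε hε
    have hm : 0 < min ε 1 := by positivity
    have hm2 : min ε 1 < 2 := (min_le_right _ _).trans_lt (by norm_num)
    obtain ⟨s1, -, s2⟩ := sph_of_dist hm hm2
    filter_upwards [hlim K hKD hK _ s1] with n hn w hw
    exact ((s2 _ _).2.2 (hn w hw)).trans_le (min_le_left _ _)
  have hj := tendsto_joint (u := fun n => sphVal (f (φ n))) hD hGc hlim' hz₀
  have hzt : Tendsto z atTop (𝓝 z₀) := by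
    rw [tendsto_iff_dist_tendsto_zero]
    exact squeeze_zero (fun _ => dist_nonneg) (fun n => (hz n).le)
      tendsto_one_div_add_atTop_nhds_zero_nat
  have hzφ : Tendsto (fun n => z (φ n)) atTop (𝓝 z₀) := hzt.comp hφ.tendsto_atTop
  have p1 : Tendsto (fun n : ℕ => (n, z (φ n))) atTop (atTop ×ˢ 𝓝 z₀) := tendsto_id.prodMk hzφ
  have p2 : Tendsto (fun n : ℕ => (n, z₀)) atTop (atTop ×ˢ 𝓝 z₀) :=
    tendsto_id.prodMk tendsto_const_nhds
  have h1 := hj.comp p1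
  have h2 := hj.comp p2
  have h3 := h1.dist h2
  rw [dist_self] at h3
  exact absurd (ge_of_tendsto' h3 fun n => hfz (φ n)) (not_le.2 hδ)

end SphAux

open SphAux in
theorem normal_iff_spherical_dichotomy
    (D : Set ℂ) (hD : IsOpen D) (hDc : IsPreconnected D)
    (F : Set (ℂ → ℂ)) (hF : ∀ f ∈ F, MeromorphicOn f D)
    (h : ℂ → ℂ) (hh : MeromorphicOn h D) :
    NormalOn D F ↔
      ∀ z₀ ∈ D, ∃ r : ℝ, 0 < r ∧ Metric.ball z₀ r ⊆ D ∧
        ∃ ε₁ ε₂ : ℝ, 0 < ε₁ ∧ ε₁ < ε₂ ∧ ε₂ < Real.pi ∧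
          ∀ f ∈ F,
            (∀ z ∈ Metric.ball z₀ r, ε₁ < sph (sphVal f z) (sphVal h z)) ∨
            (∀ z ∈ Metric.ball z₀ r, sph (sphVal f z) (sphVal h z) < ε₂) := by 
  constructor
  · intro hN z₀ hz₀
    obtain ⟨r1, hr1, H1⟩ := normal_equi hD hN hz₀ (show (0 : ℝ) < 1 / 4 by norm_num) (by norm_num)
    obtain ⟨r2, hr2, H2⟩ := Metric.continuousAt_iff.1 (sphVal_cont (hh z₀ hz₀)) (1 / 4)
      (by norm_num)
    obtain ⟨r3, hr3, H3⟩ := Metric.isOpen_iff.1 hD z₀ hz₀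
    obtain ⟨s1, -, s2⟩ := sph_of_dist (show (0 : ℝ) < 1 / 2 by norm_num) (by norm_num)
    obtain ⟨-, t1, t2⟩ := sph_of_dist (show (0 : ℝ) < 3 / 2 by norm_num) (by norm_num)
    refine ⟨min r1 (min r2 r3), by positivity, fun z hz => H3 ?_,
      2 * Real.arcsin (1 / 2 / 2), 2 * Real.arcsin (3 / 2 / 2), s1, ?_, t1, fun f hf => ?_⟩
    · rw [mem_ball] at hz ⊢
      exact lt_of_lt_of_le hz ((min_le_right _ _).trans (min_le_right _ _))
    · have := Real.strictMonoOn_arcsin (show (1 / 2 / 2 : ℝ) ∈ Set.Icc (-1 : ℝ) 1 by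
        constructor <;> norm_num) (show (3 / 2 / 2 : ℝ) ∈ Set.Icc (-1 : ℝ) 1 by
        constructor <;> norm_num) (by norm_num)
      linarith
    · have k1 : ∀ z ∈ ball z₀ (min r1 (min r2 r3)),
          dist (sphVal f z) (sphVal f z₀) < 1 / 4 ∧ dist (sphVal h z) (sphVal h z₀) < 1 / 4 :=
        fun z hz => ⟨H1 f hf z (ball_subset_ball (min_le_left _ _) hz),
          H2 (lt_of_lt_of_le (mem_ball.1 hz) ((min_le_right _ _).trans (min_le_left _ _)))⟩
      rcases lt_or_ge 1 (dist (sphVal f z₀) (sphVal h z₀)) with hlt | hge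
      · left
        intro z hz
        obtain ⟨u1, u2⟩ := k1 z hz
        refine (s2 _ _).1.1 ?_
        have v1 := dist_triangle4 (sphVal f z₀) (sphVal f z) (sphVal h z) (sphVal h z₀)
        rw [dist_comm (sphVal f z₀) (sphVal f z)] at v1
        linarith
      · right
        intro z hz
        obtain ⟨u1, u2⟩ := k1 z hz
        refine (t2 _ _).2.1 ?_
        have v1 := dist_triangle4 (sphVal f z) (sphVal f z₀) (sphVal h z₀) (sphVal h z)
        rw [dist_comm (sphVal h z₀) (sphVal h z)] at v1
        linarith
  · intro H f hf
    have H' := fun z hz => avoid_of_dichotomy D F h hh z hz (H z hz)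
    have equi : ∀ x ∈ D, ∀ ε > 0, ∃ δ > 0, ∀ n, ∀ y ∈ D, dist y x < δ →
        dist (sphVal (f n) y) (sphVal (f n) x) ≤ ε := by
      intro x hx ε hε
      obtain ⟨r, hr, hrD, c, hc, a, b, Hab⟩ := H' x hx
      obtain ⟨d1, hd1, h1⟩ := mod_of_avoid a hc hr hε
      obtain ⟨d2, hd2, h2⟩ := mod_of_avoid b hc hr hε
      refine ⟨min d1 d2, lt_min hd1 hd2, fun n y _ hy => ?_⟩
      have hm : MeromorphicOn (f n) (ball x r) := fun w hw => hF _ (hf n) w (hrD hw)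
      rcases Hab _ (hf n) with ho | ho
      · exact (h1 _ _ hm ho y (hy.trans_le (min_le_left _ _))).le
      · exact (h2 _ _ hm ho y (hy.trans_le (min_le_right _ _))).le
    obtain ⟨φ, hφ, G, hG, hlim⟩ := exists_subseq hD (fun n => sphVal (f n)) equi
    refine ⟨φ, hφ, G, glue hDc hD hG fun z₀ hz₀ => ?_, ?_⟩
    · obtain ⟨r, hr, hrD, c, hc, a, b, Hab⟩ := H' z₀ hz₀
      have hm : ∀ n, MeromorphicOn (f (φ n)) D := fun n => hF _ (hf _)
      by_cases hfr : ∃ᶠ n in atTop, ∀ z ∈ ball z₀ r, c ≤ dist (sphVal (f (φ n)) z) a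
      · exact ⟨r, hr, a, local_limit hD hm hG hlim hrD hc a hfr⟩
      · refine ⟨r, hr, b, local_limit hD hm hG hlim hrD hc b ?_⟩
        refine Eventually.frequently ?_
        filter_upwards [not_frequently.1 hfr] with n hn
        exact (Hab _ (hf _)).resolve_left hn
    · intro K hKD hK ε hε
      have hcont : Tendsto (fun t : ℝ => 2 * Real.arcsin (t / 2)) (𝓝 0) (𝓝 0) := by
        have : Continuous fun t : ℝ => 2 * Real.arcsin (t / 2) :=
          continuous_const.mul (Real.continuous_arcsin.comp (by fun_prop))
        simpa using this.tendsto 0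
      obtain ⟨δ, hδ, hd⟩ := Metric.tendsto_nhds_nhds.1 hcont ε hε
      filter_upwards [hlim K hKD hK δ hδ] with n hn z hz
      have h1 := hd (x := dist (sphVal (f (φ n)) z) (G z))
        (by rw [Real.dist_eq, sub_zero, abs_of_nonneg dist_nonneg]; exact hn z hz)
      rw [Real.dist_eq, sub_zero] at h1
      rw [sph_eq]
      exact (le_abs_self _).trans_lt h1
end

section
/- Let G be a family of pairs (a, b) of meromorphic functions on a domain D and let 0 < ε < π. If σ(a(z), b(z)) < ε for all (a, b) ∈ G and all z ∈ D, and the family {b : (a, b) ∈ G} is normal in D, then the family {a : (a, b) ∈ G} is also normal in D. -/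
open Filter Topology OnePoint Metric
open scoped Classical

/-- point of the sphere with homogeneous coordinates -/
noncomputable def pt (x y : ℂ) : OnePoint ℂ := if y = 0 then ∞ else ((x / y : ℂ) : OnePoint ℂ)

lemma pt_inf : pt 1 0 = ∞ := by simp [pt]

lemma pt_coe (a : ℂ) : pt a 1 = (a : OnePoint ℂ) := by simp [pt]

lemma exists_pt (X : OnePoint ℂ) : ∃ x y : ℂ, (x ≠ 0 ∨ y ≠ 0) ∧ X = pt x y := by
  induction X using OnePoint.rec with
  | infty => exact ⟨1, 0, by simp, pt_inf.symm⟩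
  | coe a => exact ⟨a, 1, by simp, (pt_coe a).symm⟩

lemma chord_nonneg (X Y : OnePoint ℂ) : 0 ≤ chord X Y := by
  induction X using OnePoint.rec <;> induction Y using OnePoint.rec <;>
  simp only [chord_inf_inf, chord_inf_coe, chord_coe_inf, chord_coe_coe] <;> positivity

lemma hpos {x y : ℂ} (h : x ≠ 0 ∨ y ≠ 0) : 0 < ‖x‖ ^ 2 + ‖y‖ ^ 2 := by
  rcases h with h | h
  · have := norm_pos_iff.2 h
    positivity
  · have := norm_pos_iff.2 h
    positivity

lemma chord_sq_pt {x y x' y' : ℂ} (h : x ≠ 0 ∨ y ≠ 0) (h' : x' ≠ 0 ∨ y' ≠ 0) :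
    chord (pt x y) (pt x' y') ^ 2 =
      4 * ‖x * y' - x' * y‖ ^ 2 / ((‖x‖ ^ 2 + ‖y‖ ^ 2) * (‖x'‖ ^ 2 + ‖y'‖ ^ 2)) := by
  have p := hpos h
  have p' := hpos h'
  unfold pt
  by_cases hy : y = 0 <;> by_cases hy' : y' = 0
  · simp [hy, hy', chord_inf_inf]
  · have hx : x ≠ 0 := by simpa [hy] using h
    have := norm_pos_iff.2 hy'
    have := norm_pos_iff.2 hx
    rw [if_pos hy, if_neg hy', chord_inf_coe, div_pow, Real.sq_sqrt (by positivity)]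
    simp only [hy, norm_div, mul_zero, sub_zero, norm_mul, norm_zero]
    field_simp
    ring
  · have hx : x' ≠ 0 := by simpa [hy'] using h'
    have := norm_pos_iff.2 hy
    have := norm_pos_iff.2 hx
    rw [if_neg hy, if_pos hy', chord_coe_inf, div_pow, Real.sq_sqrt (by positivity)]
    simp only [hy', norm_div, mul_zero, zero_sub, norm_mul, norm_zero, norm_neg]
    field_simp
    ring
  · have := norm_pos_iff.2 hy
    have := norm_pos_iff.2 hy'
    rw [if_neg hy, if_neg hy', chord_coe_coe, div_pow, Real.sq_sqrt (by positivity)]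
    have : x / y - x' / y' = (x * y' - x' * y) / (y * y') := by
      field_simp
    rw [this]
    simp only [norm_div, norm_mul]
    field_simp
    ring

/-- stereographic embedding -/
noncomputable def ster (X : OnePoint ℂ) : WithLp 2 (ℂ × ℝ) :=
  Option.elim (α := ℂ) X (WithLp.toLp 2 (0, 1))
    (fun a => WithLp.toLp 2 ((((2 / (1 + ‖a‖ ^ 2) : ℝ)) : ℂ) * a, (‖a‖ ^ 2 - 1) / (1 + ‖a‖ ^ 2)))

lemma lp_fst (a : ℂ) (b : ℝ) : (WithLp.toLp 2 (a, b)).fst = a := rfl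
lemma lp_snd (a : ℂ) (b : ℝ) : (WithLp.toLp 2 (a, b)).snd = b := rfl

lemma ster_inf : ster ∞ = WithLp.toLp 2 (0, 1) := rfl
lemma ster_coe (a : ℂ) : ster (a : OnePoint ℂ) = WithLp.toLp 2
  ((((2 / (1 + ‖a‖ ^ 2) : ℝ)) : ℂ) * a, (‖a‖ ^ 2 - 1) / (1 + ‖a‖ ^ 2)) := rfl

lemma nsq (a : ℂ) : ‖a‖ ^ 2 = a.re ^ 2 + a.im ^ 2 := by
  rw [← Complex.normSq_eq_norm_sq, Complex.normSq_apply]; ring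

lemma ster_inf_coe_sq (a : ℂ) : ‖ster ∞ - ster (a : OnePoint ℂ)‖ ^ 2 = (2 / Real.sqrt (1 + ‖a‖ ^ 2)) ^ 2 := by
  rw [div_pow, Real.sq_sqrt (by positivity), ster_inf, ster_coe, WithLp.prod_norm_sq_eq_of_L2]
  simp only [WithLp.sub_fst, WithLp.sub_snd, lp_fst, lp_snd, zero_sub, norm_neg, norm_mul, Complex.norm_real,
    Real.norm_eq_abs, mul_pow, sq_abs]
  field_simp
  ring

lemma chord_eq_ster (X Y : OnePoint ℂ) : chord X Y = ‖ster X - ster Y‖ := by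
  rw [← sq_eq_sq₀ (chord_nonneg X Y) (norm_nonneg _)]
  induction X using OnePoint.rec with
  | infty =>
    induction Y using OnePoint.rec with
    | infty => simp [chord_inf_inf]
    | coe b => rw [ster_inf_coe_sq, chord_inf_coe]
  | coe a =>
    induction Y using OnePoint.rec with
    | infty => rw [norm_sub_rev, ster_inf_coe_sq, chord_coe_inf]
    | coe b =>
      rw [chord_coe_coe, div_pow, Real.sq_sqrt (by positivity), ster_coe, ster_coe, WithLp.prod_norm_sq_eq_of_L2]
      simp only [WithLp.sub_fst, WithLp.sub_snd, lp_fst, lp_snd, mul_pow, Real.norm_eq_abs, sq_abs]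
      rw [nsq (a - b), nsq ( _ * a - _ * b)]
      simp only [Complex.sub_re, Complex.sub_im, Complex.re_ofReal_mul, Complex.im_ofReal_mul, nsq a, nsq b]
      have h1 : 1 + (a.re ^ 2 + a.im ^ 2) ≠ 0 := by positivity
      have h2 : 1 + (b.re ^ 2 + b.im ^ 2) ≠ 0 := by positivity
      field_simp
      ring

lemma chord_triangle (X Y Z : OnePoint ℂ) : chord X Z ≤ chord X Y + chord Y Z := by
  simp only [chord_eq_ster]; exact norm_sub_le_norm_sub_add_norm_sub _ _ _

lemma chord_comm (X Y : OnePoint ℂ) : chord X Y = chord Y X := by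
  simp only [chord_eq_ster]; exact norm_sub_rev _ _

lemma ster_norm (X : OnePoint ℂ) : ‖ster X‖ = 1 := by
  rw [← sq_eq_sq₀ (norm_nonneg _) zero_le_one]
  induction X using OnePoint.rec with
  | infty => simp [ster_inf, WithLp.prod_norm_sq_eq_of_L2]
  | coe a =>
    rw [ster_coe, WithLp.prod_norm_sq_eq_of_L2]
    simp only [lp_fst, lp_snd, norm_mul, Complex.norm_real, mul_pow, Real.norm_eq_abs, sq_abs]
    field_simp
    ring

lemma ster_surj (v : WithLp 2 (ℂ × ℝ)) (hv : ‖v‖ = 1) : ∃ X, ster X = v := by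
  have h : ‖v‖ ^ 2 = 1 := by rw [hv]; norm_num
  rw [WithLp.prod_norm_sq_eq_of_L2] at h
  obtain ⟨w, t⟩ := v
  simp only [lp_fst, lp_snd, Real.norm_eq_abs, sq_abs] at h
  by_cases ht : t = 1
  · have : w = 0 := by
      subst ht
      simpa using h
    exact ⟨∞, by rw [ster_inf, this, ht]⟩
  · refine ⟨((w / (1 - t : ℝ) : ℂ) : OnePoint ℂ), ?_⟩
    have h1 : (1 - t) ≠ 0 := fun h => ht (by linarith)
    have h2 : ‖(w / (1 - t : ℝ) : ℂ)‖ ^ 2 = (1 + t) / (1 - t) := by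
      rw [norm_div, div_pow, Complex.norm_real, Real.norm_eq_abs, sq_abs]
      have : ‖w‖ ^ 2 = (1 - t) * (1 + t) := by linarith
      rw [this]
      field_simp
    have h3 : 1 + (1 + t) / (1 - t) = 2 / (1 - t) := by field_simp; ring
    rw [ster_coe, h2, h3]
    congr 2
    · have : ((1 - t : ℝ) : ℂ) ≠ 0 := by exact_mod_cast h1
      rw [div_div_cancel₀ (by norm_num)]
      field_simp
    · field_simp
      ring

lemma chord_le_two (X Y : OnePoint ℂ) : chord X Y ≤ 2 := by
  rw [chord_eq_ster]
  calc _ ≤ ‖ster X‖ + ‖ster Y‖ := norm_sub_le _ _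
    _ = 2 := by rw [ster_norm, ster_norm]; norm_num

lemma chord_self (X : OnePoint ℂ) : chord X X = 0 := by simp [chord_eq_ster]

lemma sph_lt_iff {X Y : OnePoint ℂ} {ε : ℝ} (h0 : 0 < ε) (h1 : ε < Real.pi) :
    sph X Y < ε ↔ chord X Y < 2 * Real.sin (ε / 2) := by
  unfold sph
  have a := chord_nonneg X Y
  have b := chord_le_two X Y
  rw [show 2 * Real.arcsin (chord X Y / 2) < ε ↔ Real.arcsin (chord X Y / 2) < ε / 2 by
    constructor <;> intro <;> linarith]
  rw [Real.arcsin_lt_iff_lt_sin ⟨by linarith, by linarith⟩ ⟨by linarith, by linarith⟩]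
  constructor <;> intro <;> linarith

lemma chord_lt_of_sph_lt {X Y : OnePoint ℂ} {ε : ℝ} (h : sph X Y < ε) : chord X Y < ε := by
  have a := chord_nonneg X Y
  have b := chord_le_two X Y
  have h2 : 0 ≤ Real.arcsin (chord X Y / 2) := Real.arcsin_nonneg.2 (by linarith)
  have := Real.sin_le h2
  rw [Real.sin_arcsin (by linarith) (by linarith)] at this
  unfold sph at h
  linarith

lemma sph_lt_of_chord {ε : ℝ} (h0 : 0 < ε) : ∃ η > 0, ∀ X Y, chord X Y < η → sph X Y < ε := by
  have hm : 0 < min ε 1 := lt_min h0 one_pos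
  have hm' : min ε 1 < Real.pi := lt_of_le_of_lt (min_le_right _ _) (by linarith [Real.pi_gt_three])
  refine ⟨2 * Real.sin (min ε 1 / 2), ?_, fun X Y h => ?_⟩
  · have := Real.sin_pos_of_pos_of_lt_pi (x := min ε 1 / 2) (by linarith) (by linarith)
    linarith
  · exact lt_of_lt_of_le ((sph_lt_iff hm hm').2 h) (min_le_left _ _)

lemma sq_le_imp {a b : ℝ} (h : a ^ 2 ≤ b ^ 2) (hb : 0 ≤ b) : a ≤ b := by
  by_contra! hc
  nlinarith

open ComplexConjugate in
/-- rotation chart sending `pt β δ` to `0` -/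
noncomputable def mob (β δ : ℂ) (X : OnePoint ℂ) : ℂ :=
  Option.elim (α := ℂ) X (δ / conj β) (fun a => (δ * a - β) / (conj β * a + conj δ))

open ComplexConjugate in
lemma mob_pt (β δ : ℂ) {x y : ℂ} (h : x ≠ 0 ∨ y ≠ 0) :
    mob β δ (pt x y) = (δ * x - β * y) / (conj β * x + conj δ * y) := by
  unfold pt
  by_cases hy : y = 0
  · have hx : x ≠ 0 := by simpa [hy] using h
    rw [if_pos hy]
    change δ / conj β = _
    rw [hy, mul_zero, mul_zero, sub_zero, add_zero, mul_div_mul_right _ _ hx]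
  · rw [if_neg hy]
    change (δ * (x / y) - β) / (conj β * (x / y) + conj δ) = _
    rw [show δ * (x / y) - β = (δ * x - β * y) / y by field_simp,
      show conj β * (x / y) + conj δ = (conj β * x + conj δ * y) / y by field_simp,
      div_div_div_cancel_right₀ hy]

open ComplexConjugate in
lemma quad_id (β δ x y : ℂ) : ‖δ * x - β * y‖ ^ 2 + ‖conj β * x + conj δ * y‖ ^ 2 =
    (‖x‖ ^ 2 + ‖y‖ ^ 2) * (‖β‖ ^ 2 + ‖δ‖ ^ 2) := by
  simp only [nsq, Complex.sub_re, Complex.sub_im, Complex.mul_re, Complex.mul_im, Complex.add_re,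
    Complex.add_im, Complex.conj_re, Complex.conj_im]
  ring

open ComplexConjugate in
lemma den_bound {β δ x y : ℂ} (hp : β ≠ 0 ∨ δ ≠ 0) (h : x ≠ 0 ∨ y ≠ 0) {t : ℝ} (ht0 : 0 ≤ t) (ht : t < 1)
    (hc : chord (pt x y) (pt β δ) ≤ 2 * t) :
    (1 - t ^ 2) * ((‖x‖ ^ 2 + ‖y‖ ^ 2) * (‖β‖ ^ 2 + ‖δ‖ ^ 2)) ≤ ‖conj β * x + conj δ * y‖ ^ 2 ∧
    ‖δ * x - β * y‖ ^ 2 ≤ t ^ 2 * ((‖x‖ ^ 2 + ‖y‖ ^ 2) * (‖β‖ ^ 2 + ‖δ‖ ^ 2)) := by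
  have h1 := pow_le_pow_left₀ (chord_nonneg _ _) hc 2
  have p : 0 < (‖x‖ ^ 2 + ‖y‖ ^ 2) * (‖β‖ ^ 2 + ‖δ‖ ^ 2) := mul_pos (hpos h) (hpos hp)
  rw [chord_sq_pt h hp, div_le_iff₀ p, show x * δ - β * y = δ * x - β * y by ring] at h1
  have := quad_id β δ x y
  constructor <;> nlinarith

open ComplexConjugate in
lemma den_ne {β δ x y : ℂ} (hp : β ≠ 0 ∨ δ ≠ 0) (h : x ≠ 0 ∨ y ≠ 0) {t : ℝ} (ht0 : 0 ≤ t) (ht : t < 1)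
    (hc : chord (pt x y) (pt β δ) ≤ 2 * t) : conj β * x + conj δ * y ≠ 0 := by
  have h1 := (den_bound hp h ht0 ht hc).1
  have p : 0 < (‖x‖ ^ 2 + ‖y‖ ^ 2) * (‖β‖ ^ 2 + ‖δ‖ ^ 2) := mul_pos (hpos h) (hpos hp)
  intro h0
  rw [h0] at h1
  have : 0 < 1 - t ^ 2 := by nlinarith
  have := mul_pos this p
  simp at h1
  linarith

lemma mob_bound {β δ : ℂ} (hp : β ≠ 0 ∨ δ ≠ 0) {t : ℝ} (ht0 : 0 ≤ t) (ht : t < 1) (X : OnePoint ℂ)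
    (hc : chord X (pt β δ) ≤ 2 * t) : ‖mob β δ X‖ ≤ 1 / (1 - t ^ 2) := by
  obtain ⟨x, y, h, rfl⟩ := exists_pt X
  obtain ⟨h1, h2⟩ := den_bound hp h ht0 ht hc
  have h3 := den_ne hp h ht0 ht hc
  have p : 0 < (‖x‖ ^ 2 + ‖y‖ ^ 2) * (‖β‖ ^ 2 + ‖δ‖ ^ 2) := mul_pos (hpos h) (hpos hp)
  have q : 0 < 1 - t ^ 2 := by nlinarith
  have q' : 1 - t ^ 2 ≤ 1 := by nlinarith
  have h4 := norm_pos_iff.2 h3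
  rw [mob_pt _ _ h, norm_div, div_le_div_iff₀ h4 q, one_mul]
  apply sq_le_imp _ h4.le
  rw [mul_pow]
  set k := (‖x‖ ^ 2 + ‖y‖ ^ 2) * (‖β‖ ^ 2 + ‖δ‖ ^ 2)
  have e1 := mul_le_mul_of_nonneg_right h2 (sq_nonneg (1 - t ^ 2))
  have e2 : t ^ 2 * k * (1 - t ^ 2) ^ 2 ≤ (1 - t ^ 2) * k := by
    have : t ^ 2 * (1 - t ^ 2) ≤ 1 := by nlinarith
    have := mul_le_mul_of_nonneg_left this (mul_pos q p).le
    nlinarith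
  linarith

open ComplexConjugate in
/-- inverse of the rotation chart -/
noncomputable def mobInv (β δ u : ℂ) : OnePoint ℂ := pt (conj δ * u + β) (-conj β * u + δ)

open ComplexConjugate in
lemma quad_id2 (β δ u : ℂ) : ‖conj δ * u + β‖ ^ 2 + ‖-conj β * u + δ‖ ^ 2 =
    (1 + ‖u‖ ^ 2) * (‖β‖ ^ 2 + ‖δ‖ ^ 2) := by
  simp only [nsq, Complex.neg_re, Complex.neg_im, Complex.mul_re, Complex.mul_im, Complex.add_re,
    Complex.add_im, Complex.conj_re, Complex.conj_im]
  ring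

open ComplexConjugate in
lemma mobInv_ne {β δ : ℂ} (hp : β ≠ 0 ∨ δ ≠ 0) (u : ℂ) : conj δ * u + β ≠ 0 ∨ -conj β * u + δ ≠ 0 := by
  by_contra! h
  have := quad_id2 β δ u
  rw [h.1, h.2] at this
  have p := hpos hp
  have h2 : 0 < (1 + ‖u‖ ^ 2) * (‖β‖ ^ 2 + ‖δ‖ ^ 2) := by positivity
  rw [← this] at h2
  simp at h2

lemma pt_smul {c x y : ℂ} (hc : c ≠ 0) : pt (c * x) (c * y) = pt x y := by
  unfold pt
  by_cases hy : y = 0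
  · simp [hy]
  · rw [if_neg hy, if_neg (mul_ne_zero hc hy), mul_div_mul_left _ _ hc]

open ComplexConjugate in
lemma mobInv_mob {β δ : ℂ} (hp : β ≠ 0 ∨ δ ≠ 0) {t : ℝ} (ht0 : 0 ≤ t) (ht : t < 1) (X : OnePoint ℂ)
    (hc : chord X (pt β δ) ≤ 2 * t) : mobInv β δ (mob β δ X) = X := by
  obtain ⟨x, y, h, rfl⟩ := exists_pt X
  have h3 := den_ne hp h ht0 ht hc
  have p := hpos hp
  have e : ((‖β‖ ^ 2 + ‖δ‖ ^ 2 : ℝ) : ℂ) = β * conj β + δ * conj δ := by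
    push_cast
    rw [Complex.mul_conj', Complex.mul_conj']
  have e' : β * conj β + δ * conj δ ≠ 0 := by
    rw [← e]; exact_mod_cast p.ne'
  rw [mob_pt _ _ h, mobInv,
    show conj δ * ((δ * x - β * y) / (conj β * x + conj δ * y)) + β =
      ((β * conj β + δ * conj δ) / (conj β * x + conj δ * y)) * x by rw [div_mul_eq_mul_div, mul_div_assoc', div_add' _ _ _ h3]; congr 1; ring,
    show -conj β * ((δ * x - β * y) / (conj β * x + conj δ * y)) + δ =
      ((β * conj β + δ * conj δ) / (conj β * x + conj δ * y)) * y by rw [div_mul_eq_mul_div, mul_div_assoc', div_add' _ _ _ h3]; congr 1; ring,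
    pt_smul (div_ne_zero e' h3)]

open ComplexConjugate in
lemma chord_mobInv {β δ : ℂ} (hp : β ≠ 0 ∨ δ ≠ 0) (u v : ℂ) :
    chord (mobInv β δ u) (mobInv β δ v) ^ 2 = 4 * ‖u - v‖ ^ 2 / ((1 + ‖u‖ ^ 2) * (1 + ‖v‖ ^ 2)) := by
  have p := hpos hp
  rw [mobInv, mobInv, chord_sq_pt (mobInv_ne hp u) (mobInv_ne hp v), quad_id2, quad_id2]
  have e : ((‖β‖ ^ 2 + ‖δ‖ ^ 2 : ℝ) : ℂ) = β * conj β + δ * conj δ := by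
    push_cast
    rw [Complex.mul_conj', Complex.mul_conj']
  rw [show (conj δ * u + β) * (-conj β * v + δ) - (conj δ * v + β) * (-conj β * u + δ) =
    (β * conj β + δ * conj δ) * (u - v) by ring, ← e, norm_mul, Complex.norm_real, Real.norm_eq_abs,
    abs_of_pos p]
  field_simp

lemma chord_mobInv_le {β δ : ℂ} (hp : β ≠ 0 ∨ δ ≠ 0) (u v : ℂ) :
    chord (mobInv β δ u) (mobInv β δ v) ≤ 2 * ‖u - v‖ := by
  apply sq_le_imp _ (by positivity)
  rw [chord_mobInv hp, mul_pow]
  have : 1 ≤ (1 + ‖u‖ ^ 2) * (1 + ‖v‖ ^ 2) := by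
    nlinarith [sq_nonneg (‖u‖), sq_nonneg (‖v‖), mul_nonneg (sq_nonneg (‖u‖)) (sq_nonneg (‖v‖))]
  rw [show (2:ℝ) ^ 2 = 4 by norm_num]
  exact div_le_self (by positivity) this

lemma le_chord_mobInv {β δ : ℂ} (hp : β ≠ 0 ∨ δ ≠ 0) {u v : ℂ} {R : ℝ} (hu : ‖u‖ ≤ R) (hv : ‖v‖ ≤ R) :
    2 * ‖u - v‖ ≤ (1 + R ^ 2) * chord (mobInv β δ u) (mobInv β δ v) := by
  apply sq_le_imp _ (mul_nonneg (by positivity) (chord_nonneg _ _))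
  rw [mul_pow _ (chord _ _), chord_mobInv hp, mul_pow, mul_div_assoc', le_div_iff₀ (by positivity)]
  have h1 := pow_le_pow_left₀ (norm_nonneg _) hu 2
  have h2 := pow_le_pow_left₀ (norm_nonneg _) hv 2
  have : (1 + ‖u‖ ^ 2) * (1 + ‖v‖ ^ 2) ≤ (1 + R ^ 2) ^ 2 := by
    rw [sq (1 + R ^ 2)]
    gcongr
  nlinarith [mul_le_mul_of_nonneg_left this (sq_nonneg (‖u - v‖))]

/-- locally a quotient of analytic functions without common zeros -/
def LocRat (A : ℂ → OnePoint ℂ) (z : ℂ) : Prop :=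
  ∃ x y : ℂ → ℂ, AnalyticAt ℂ x z ∧ AnalyticAt ℂ y z ∧ (x z ≠ 0 ∨ y z ≠ 0) ∧
    ∀ᶠ w in 𝓝 z, A w = pt (x w) (y w)

lemma sphVal_eq {f x y : ℂ → ℂ} {w : ℂ} (hx : ContinuousAt x w) (hy : ContinuousAt y w)
    (h : x w ≠ 0 ∨ y w ≠ 0) (hy0 : ∀ᶠ u in 𝓝[≠] w, y u ≠ 0) (hf : ∀ᶠ u in 𝓝[≠] w, f u = x u / y u) :
    sphVal f w = pt (x w) (y w) := by
  have hf' : f =ᶠ[𝓝[≠] w] (fun u => x u / y u) := hf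
  unfold sphVal pt
  by_cases h0 : y w = 0
  · have hxw : x w ≠ 0 := by simpa [h0] using h
    rw [if_pos h0, if_pos]
    have : Tendsto (fun u => ‖x u‖ * ‖y u‖⁻¹) (𝓝[≠] w) atTop := by
      apply Tendsto.pos_mul_atTop (norm_pos_iff.2 hxw)
      · exact (hx.norm.tendsto).mono_left nhdsWithin_le_nhds
      · apply Tendsto.inv_tendsto_nhdsGT_zero
        rw [tendsto_nhdsWithin_iff]
        constructor
        · have := (hy.norm.tendsto).mono_left (nhdsWithin_le_nhds (s := {w}ᶜ))
          simpa [h0] using this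
        · filter_upwards [hy0] with u hu using norm_pos_iff.2 hu
    refine this.congr' ?_
    filter_upwards [hf] with u hu
    rw [hu, norm_div, div_eq_mul_inv]
  · have ht : Tendsto f (𝓝[≠] w) (𝓝 (x w / y w)) :=
      (((hx.div hy h0).tendsto).mono_left nhdsWithin_le_nhds).congr' hf'.symm
    rw [if_neg h0, if_neg (fun h => not_tendsto_nhds_of_tendsto_atTop h _ ht.norm), ht.limUnder_eq]

lemma sphVal_eventually {f x y : ℂ → ℂ} {z : ℂ} (hx : AnalyticAt ℂ x z) (hy : AnalyticAt ℂ y z)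
    (h : x z ≠ 0 ∨ y z ≠ 0) (hy0 : ∀ᶠ u in 𝓝[≠] z, y u ≠ 0) (hf : ∀ᶠ u in 𝓝[≠] z, f u = x u / y u) :
    ∀ᶠ w in 𝓝 z, sphVal f w = pt (x w) (y w) := by
  have h1 : ∀ᶠ w in 𝓝[≠] z, ∀ᶠ u in 𝓝[≠] w, y u ≠ 0 ∧ f u = x u / y u := by
    have := eventually_nhdsWithin_iff.1 (hy0.and hf)
    have := this.eventually_nhds
    rw [eventually_nhdsWithin_iff]
    filter_upwards [this] with w hw hwz
    have h2 : ∀ᶠ u in 𝓝 w, u ≠ z := isOpen_ne.mem_nhds hwz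
    apply nhdsWithin_le_nhds
    filter_upwards [hw, h2] with u hu hu2 using hu hu2
  rw [eventually_nhdsWithin_iff] at h1
  have h3 : ∀ᶠ w in 𝓝 z, x w ≠ 0 ∨ y w ≠ 0 := by
    rcases h with h | h
    · filter_upwards [hx.continuousAt.eventually_ne h] with w hw using Or.inl hw
    · filter_upwards [hy.continuousAt.eventually_ne h] with w hw using Or.inr hw
  filter_upwards [h1, h3, hx.eventually_analyticAt, hy.eventually_analyticAt] with w hw h3 hx' hy'
  by_cases hwz : w = z
  · subst hwz
    exact sphVal_eq hx.continuousAt hy.continuousAt h hy0 hf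
  · exact sphVal_eq hx'.continuousAt hy'.continuousAt h3 ((hw hwz).mono fun _ h => h.1)
      ((hw hwz).mono fun _ h => h.2)

lemma locRat_sphVal {f : ℂ → ℂ} {z : ℂ} (hf : MeromorphicAt f z) : LocRat (sphVal f) z := by
  by_cases ht : meromorphicOrderAt f z = ⊤
  · rw [meromorphicOrderAt_eq_top_iff] at ht
    refine ⟨fun _ => 0, fun _ => 1, analyticAt_const, analyticAt_const, by simp, ?_⟩
    exact sphVal_eventually analyticAt_const analyticAt_const (by simp) (by simp) (by simpa using ht)
  · rw [← ne_eq, meromorphicOrderAt_ne_top_iff hf] at ht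
    obtain ⟨g, hg, hg0, h⟩ := ht
    set n := (meromorphicOrderAt f z).untop₀
    have hid : AnalyticAt ℂ (fun w => w - z) z := by fun_prop
    rcases Int.le_total 0 n with hn | hn
    · obtain ⟨m, hm⟩ := Int.eq_ofNat_of_zero_le hn
      refine ⟨fun w => (w - z) ^ m * g w, fun _ => 1, (hid.pow m).mul hg, analyticAt_const, by simp, ?_⟩
      refine sphVal_eventually ((hid.pow m).mul hg) analyticAt_const (by simp) (by simp) ?_
      filter_upwards [h] with w hw
      rw [hw, hm]
      simp
    · obtain ⟨m, hm⟩ := Int.eq_ofNat_of_zero_le (Int.neg_nonneg_of_nonpos hn)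
      have hm' : n = -(m : ℤ) := by omega
      refine ⟨g, fun w => (w - z) ^ m, hg, hid.pow m, Or.inl hg0, ?_⟩
      refine sphVal_eventually hg (hid.pow m) (Or.inl hg0) ?_ ?_
      · filter_upwards [self_mem_nhdsWithin] with w hw
        exact pow_ne_zero _ (sub_ne_zero.2 hw)
      · filter_upwards [h] with w hw
        rw [hw, hm', zpow_neg, zpow_natCast, smul_eq_mul, div_eq_inv_mul]

lemma LocRat.continuous {A : ℂ → OnePoint ℂ} {z : ℂ} (h : LocRat A z) :
    Tendsto (fun w => chord (A w) (A z)) (𝓝 z) (𝓝 0) := by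
  obtain ⟨x, y, hx, hy, h0, hA⟩ := h
  have hx' := hx.continuousAt
  have hy' := hy.continuousAt
  have p := hpos h0
  have hsq : Tendsto (fun w => chord (A w) (A z) ^ 2) (𝓝 z) (𝓝 0) := by
    have h1 : ContinuousAt (fun w => 4 * ‖x w * y z - x z * y w‖ ^ 2 /
        ((‖x w‖ ^ 2 + ‖y w‖ ^ 2) * (‖x z‖ ^ 2 + ‖y z‖ ^ 2))) z := by
      apply ContinuousAt.div (by fun_prop) (by fun_prop) (by positivity)
    have h2 := h1.tendsto
    simp only [sub_self, norm_zero, ne_eq, OfNat.ofNat_ne_zero, not_false_eq_true, zero_pow, mul_zero, zero_div] at h2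
    refine h2.congr' ?_
    have h3 : ∀ᶠ w in 𝓝 z, x w ≠ 0 ∨ y w ≠ 0 := by
      rcases h0 with h | h
      · filter_upwards [hx'.eventually_ne h] with w hw using Or.inl hw
      · filter_upwards [hy'.eventually_ne h] with w hw using Or.inr hw
    filter_upwards [hA, h3] with w hw hw3
    rw [hw, hA.self_of_nhds, chord_sq_pt hw3 h0]
  have := hsq.sqrt
  simpa [Real.sqrt_sq (chord_nonneg _ _)] using this

lemma LocRat.mob_diff {A : ℂ → OnePoint ℂ} {z : ℂ} (h : LocRat A z) {β δ : ℂ} (hp : β ≠ 0 ∨ δ ≠ 0)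
    {t : ℝ} (ht0 : 0 ≤ t) (ht : t < 1) (hc : chord (A z) (pt β δ) ≤ 2 * t) :
    DifferentiableAt ℂ (fun w => mob β δ (A w)) z := by
  obtain ⟨x, y, hx, hy, h0, hA⟩ := h
  rw [hA.self_of_nhds] at hc
  have hx' := hx.differentiableAt
  have hy' := hy.differentiableAt
  have h1 := DifferentiableAt.fun_div (((hx'.const_mul δ).fun_sub (hy'.const_mul β)))
    (((hx'.const_mul _).fun_add (hy'.const_mul _))) (den_ne hp h0 ht0 ht hc)
  refine h1.congr_of_eventuallyEq ?_
  have h3 : ∀ᶠ w in 𝓝 z, x w ≠ 0 ∨ y w ≠ 0 := by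
    rcases h0 with h | h
    · filter_upwards [hx'.continuousAt.eventually_ne h] with w hw using Or.inl hw
    · filter_upwards [hy'.continuousAt.eventually_ne h] with w hw using Or.inr hw
  filter_upwards [hA, h3] with w hw hw3
  rw [hw, mob_pt _ _ hw3]

lemma locRat_mobInv {g : ℂ → ℂ} {z : ℂ} (hg : AnalyticAt ℂ g z) {β δ : ℂ} (hp : β ≠ 0 ∨ δ ≠ 0)
    {A : ℂ → OnePoint ℂ} (hA : ∀ᶠ w in 𝓝 z, A w = mobInv β δ (g w)) : LocRat A z := by
  refine ⟨_, _, ?_, ?_, mobInv_ne hp (g z), hA⟩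
  · exact (analyticAt_const.mul hg).add analyticAt_const
  · exact (analyticAt_const.mul hg).add analyticAt_const

lemma LocRat.dichotomy {A : ℂ → OnePoint ℂ} {z : ℂ} (h : LocRat A z) :
    (∀ᶠ w in 𝓝 z, A w = ∞) ∨ ∀ᶠ w in 𝓝[≠] z, A w ≠ ∞ := by
  obtain ⟨x, y, hx, hy, h0, hA⟩ := h
  rcases hy.eventually_eq_zero_or_eventually_ne_zero with h | h
  · left
    filter_upwards [hA, h] with w hw h
    rw [hw, h]; simp [pt]
  · right
    filter_upwards [nhdsWithin_le_nhds hA, h] with w hw h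
    rw [hw, pt, if_neg h]; simp

lemma mero_of_locRat {D : Set ℂ} (hDc : IsPreconnected D) {A : ℂ → OnePoint ℂ}
    (h : ∀ z ∈ D, LocRat A z) : IsMeroSphereOrInf D A := by
  by_cases hinf : ∃ z ∈ D, ∀ᶠ w in 𝓝 z, A w = ∞
  · right
    by_contra! hne
    obtain ⟨z1, hz1, hne⟩ := hne
    obtain ⟨z0, hz0, hinf⟩ := hinf
    have hU : IsOpen {z | ∀ᶠ w in 𝓝 z, A w = ∞} := isOpen_setOfPred_eventually_nhds
    have hV : IsOpen {z | ∀ᶠ w in 𝓝[≠] z, A w ≠ ∞} := by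
      rw [isOpen_iff_mem_nhds]
      intro z hz
      have hz : ∀ᶠ w in 𝓝[≠] z, A w ≠ ∞ := hz
      rw [eventually_nhdsWithin_iff] at hz
      filter_upwards [hz.eventually_nhds] with w hw
      by_cases hwz : w = z
      · subst hwz; exact eventually_nhdsWithin_iff.2 hz
      · have h2 : ∀ᶠ u in 𝓝 w, u ≠ z := isOpen_ne.mem_nhds hwz
        apply nhdsWithin_le_nhds
        filter_upwards [hw, h2] with u hu hu2 using hu hu2
    obtain ⟨z, hz, h1, h2⟩ := hDc _ _ hU hV (fun z hz => (h z hz).dichotomy) ⟨z0, hz0, hinf⟩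
      ⟨z1, hz1, (h z1 hz1).dichotomy.resolve_left fun h => hne h.self_of_nhds⟩
    have h1 : ∀ᶠ w in 𝓝 z, A w = ∞ := h1
    have h2 : ∀ᶠ w in 𝓝[≠] z, A w ≠ ∞ := h2
    have h1' : ∀ᶠ w in 𝓝[≠] z, A w = ∞ := nhdsWithin_le_nhds h1
    obtain ⟨w, hw⟩ := (h1'.and h2).exists
    exact hw.2 hw.1
  · left
    push Not at hinf
    have key : ∀ z ∈ D, MeromorphicAt (fun w => Option.elim (α := ℂ) (A w) 0 id) z ∧
        A z = sphVal (fun w => Option.elim (α := ℂ) (A w) 0 id) z := by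
      intro z hz
      obtain ⟨x, y, hx, hy, h0, hA⟩ := h z hz
      have hy0 : ∀ᶠ w in 𝓝[≠] z, y w ≠ 0 := by
        rcases hy.eventually_eq_zero_or_eventually_ne_zero with h | h
        · exfalso
          apply hinf z hz
          filter_upwards [hA, h] with w hw h
          rw [hw, h]; simp [pt]
        · exact h
      have hq : ∀ᶠ w in 𝓝[≠] z, Option.elim (α := ℂ) (A w) 0 id = x w / y w := by
        filter_upwards [nhdsWithin_le_nhds hA, hy0] with w hw h
        rw [hw, pt, if_neg h]; rfl
      constructor
      · refine (hx.meromorphicAt.div hy.meromorphicAt).congr ?_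
        filter_upwards [hq] with w hw using hw.symm
      · rw [sphVal_eq hx.continuousAt hy.continuousAt h0 hy0 hq, hA.self_of_nhds]
    exact ⟨_, fun z hz => (key z hz).1, fun z hz => (key z hz).2⟩

theorem sphere_core {D : Set ℂ} (hD : IsOpen D) (A : ℕ → ℂ → OnePoint ℂ)
    (hA : ∀ n, ∀ z ∈ D, LocRat (A n) z) {t : ℝ} (ht0 : 0 ≤ t) (ht : t < 1)
    (hloc : ∀ z0 ∈ D, ∃ P, ∃ r > 0, ball z0 r ⊆ D ∧ ∃ N : ℕ, ∀ n ≥ N, ∀ z ∈ ball z0 r,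
      chord (A n z) P ≤ 2 * t) :
    ∃ φ : ℕ → ℕ, StrictMono φ ∧ ∃ L : ℂ → OnePoint ℂ, (∀ z ∈ D, LocRat L z) ∧
      ∀ K : Set ℂ, K ⊆ D → IsCompact K → ∀ η : ℝ, 0 < η →
        ∀ᶠ n in atTop, ∀ z ∈ K, chord (A (φ n) z) (L z) < η := by
  have q : 0 < 1 - t ^ 2 := by nlinarith
  set R : ℝ := 1 / (1 - t ^ 2) with hR
  have hRpos : 0 < R := by positivity
  have : LocallyCompactSpace D := hD.locallyCompactSpace
  have hcont : ∀ n, ∀ z ∈ D, ContinuousAt (fun w => ster (A n w)) z := by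
    intro n z hz
    rw [ContinuousAt, tendsto_iff_norm_sub_tendsto_zero]
    simpa only [chord_eq_ster] using (hA n z hz).continuous
  let F : ℕ → C(D, WithLp 2 (ℂ × ℝ)) := fun n =>
    ⟨fun z => ster (A n z), by
      rw [continuous_iff_continuousAt]
      intro z
      exact ContinuousAt.comp (f := Subtype.val) (hcont n z z.2) continuous_subtype_val.continuousAt⟩
  have hF : ∀ n z, F n z = ster (A n z) := fun n z => rfl
  -- equicontinuity
  have heq : ∀ z : D, EquicontinuousAt (fun n => (F n : D → WithLp 2 (ℂ × ℝ))) z := by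
    rintro ⟨z0, hz0⟩
    rw [Metric.equicontinuousAt_iff_right]
    intro η hη
    obtain ⟨P, r, hr, hball, N, hN⟩ := hloc z0 hz0
    obtain ⟨β, δ, hp, rfl⟩ := exists_pt P
    have hfin : ∀ᶠ x : D in 𝓝 (⟨z0, hz0⟩ : D), ∀ n ∈ Set.Iio N, dist (F n ⟨z0, hz0⟩) (F n x) < η := by
      rw [eventually_all_finite (Set.finite_Iio N)]
      intro n _
      have := (F n).continuous.continuousAt (x := (⟨z0, hz0⟩ : D))
      filter_upwards [this (ball_mem_nhds _ hη)] with x hx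
      rw [dist_comm]
      exact hx
    have hsmall : ∀ᶠ x : D in 𝓝 (⟨z0, hz0⟩ : D), (x : ℂ) ∈ ball z0 (min r (η * r / (4 * R + 1))) := by
      have := (continuous_subtype_val (p := fun x => x ∈ D)).continuousAt (x := (⟨z0, hz0⟩ : D))
      exact this (ball_mem_nhds _ (lt_min hr (div_pos (mul_pos hη hr) (by linarith))))
    filter_upwards [hfin, hsmall] with x hx1 hx2 n
    by_cases hn : n < N
    · exact hx1 n hn
    push Not at hn
    have hxr : (x : ℂ) ∈ ball z0 r := ball_subset_ball (min_le_left _ _) hx2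
    have hxs : dist (x : ℂ) z0 < η * r / (4 * R + 1) :=
      lt_of_lt_of_le (mem_ball.1 hx2) (min_le_right _ _)
    have hz0r : z0 ∈ ball z0 r := mem_ball_self hr
    have hbd : ∀ w ∈ ball z0 r, ‖mob β δ (A n w)‖ ≤ R := fun w hw =>
      mob_bound hp ht0 ht _ (hN n hn w hw)
    have hd : DifferentiableOn ℂ (fun w => mob β δ (A n w)) (ball z0 r) := fun w hw =>
      ((hA n w (hball hw)).mob_diff hp ht0 ht (hN n hn w hw)).differentiableWithinAt
    have hmaps : Set.MapsTo (fun w => mob β δ (A n w)) (ball z0 r)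
        (closedBall (mob β δ (A n z0)) (2 * R)) := by
      intro w hw
      rw [mem_closedBall, dist_eq_norm]
      calc _ ≤ ‖mob β δ (A n w)‖ + ‖mob β δ (A n z0)‖ := norm_sub_le _ _
        _ ≤ 2 * R := by linarith [hbd w hw, hbd z0 hz0r]
    have h1 := Complex.dist_le_div_mul_dist_of_mapsTo_ball hd hmaps hxr
    rw [dist_comm, dist_eq_norm, hF, hF, ← chord_eq_ster]
    rw [← mobInv_mob hp ht0 ht _ (hN n hn _ hxr), ← mobInv_mob hp ht0 ht _ (hN n hn _ hz0r)]
    refine lt_of_le_of_lt (chord_mobInv_le hp _ _) ?_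
    rw [← dist_eq_norm]
    have h2 : 2 * (2 * R / r * dist (x : ℂ) z0) < η := by
      have h3 := (lt_div_iff₀ (by positivity)).1 hxs
      have h4 : 2 * (2 * R / r * dist (x : ℂ) z0) = (4 * R * dist (x : ℂ) z0) / r := by ring
      rw [h4, div_lt_iff₀ hr]
      nlinarith [dist_nonneg (x := (x : ℂ)) (y := z0)]
    linarith
  have : T2Space (UniformOnFun D (WithLp 2 (ℂ × ℝ)) {K : Set D | IsCompact K}) :=
    UniformOnFun.t2Space_of_covering
      (Set.eq_univ_of_forall fun x => ⟨{x}, isCompact_singleton, rfl⟩)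
  have hcl := (ContinuousMap.isUniformEmbedding_toUniformOnFunIsCompact
    (α := D) (β := WithLp 2 (ℂ × ℝ))).isClosedEmbedding
  have hcomp : IsCompact (closure (Set.range F)) := by
    refine ArzelaAscoli.isCompact_closure_of_isClosedEmbedding
      (F := fun f : C(D, WithLp 2 (ℂ × ℝ)) => (f : D → WithLp 2 (ℂ × ℝ))) (𝔖 := {K | IsCompact K})
      (fun K hK => hK) hcl ?_ ?_
    · intro K _ z _
      apply EquicontinuousAt.equicontinuousWithinAt
      intro U hU
      filter_upwards [heq z U hU] with x hx
      rintro ⟨_, n, rfl⟩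
      exact hx n
    · intro K _ z _
      refine ⟨closedBall 0 1, isCompact_closedBall _ _, ?_⟩
      rintro _ ⟨n, rfl⟩
      rw [mem_closedBall, dist_zero_right, hF, ster_norm]
  obtain ⟨H, -, φ, hφ, hlim⟩ := hcomp.tendsto_subseq (x := F) (fun n => subset_closure ⟨n, rfl⟩)
  rw [ContinuousMap.tendsto_iff_forall_isCompact_tendstoUniformlyOn] at hlim
  have hpw : ∀ z : D, Tendsto (fun n => F (φ n) z) atTop (𝓝 (H z)) := fun z =>
    (hlim {z} isCompact_singleton).tendsto_at rfl
  have hH : ∀ z : D, ‖H z‖ = 1 := by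
    intro z
    have := (hpw z).norm
    simp only [hF, ster_norm] at this
    exact tendsto_nhds_unique this tendsto_const_nhds |>.symm ▸ rfl
  have hex : ∀ z : ℂ, ∃ X, ∀ hz : z ∈ D, ster X = H ⟨z, hz⟩ := by
    intro z
    by_cases hz : z ∈ D
    · obtain ⟨X, hX⟩ := ster_surj _ (hH ⟨z, hz⟩)
      exact ⟨X, fun _ => hX⟩
    · exact ⟨∞, fun h => absurd h hz⟩
  choose L hL using hex
  have hconv : ∀ K : Set ℂ, K ⊆ D → IsCompact K → ∀ η : ℝ, 0 < η →
        ∀ᶠ n in atTop, ∀ z ∈ K, chord (A (φ n) z) (L z) < η := by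
    intro K hKD hK η hη
    have hK' : IsCompact ((Subtype.val : D → ℂ) ⁻¹' K) := by
      rw [Subtype.isCompact_iff, Subtype.image_preimage_coe, Set.inter_eq_right.2 hKD]
      exact hK
    have := Metric.tendstoUniformlyOn_iff.1 (hlim _ hK') η hη
    filter_upwards [this] with n hn z hz
    have := hn ⟨z, hKD hz⟩ hz
    rw [dist_comm, dist_eq_norm] at this
    rw [chord_eq_ster, hL z (hKD hz)]
    exact this
  refine ⟨φ, hφ, L, ?_, hconv⟩
  intro z0 hz0
  obtain ⟨P, r, hr, hball, N, hN⟩ := hloc z0 hz0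
  obtain ⟨β, δ, hp, rfl⟩ := exists_pt P
  have hNev : ∀ᶠ n in atTop, N ≤ φ n := hφ.tendsto_atTop.eventually_ge_atTop N
  have hLc : ∀ z ∈ ball z0 r, chord (L z) (pt β δ) ≤ 2 * t := by
    intro z hz
    have h1 := ((hpw ⟨z, hball hz⟩).sub_const (ster (pt β δ))).norm
    rw [← hL z (hball hz), ← chord_eq_ster] at h1
    refine le_of_tendsto h1 ?_
    filter_upwards [hNev] with n hn
    rw [hF, ← chord_eq_ster]
    exact hN _ hn z hz
  have hg : DifferentiableOn ℂ (fun w => mob β δ (L w)) (ball z0 r) := by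
    refine TendstoLocallyUniformlyOn.differentiableOn
      (F := fun n w => mob β δ (A (φ n) w)) (φ := atTop) ?_ ?_ isOpen_ball
    · rw [tendstoLocallyUniformlyOn_iff_forall_isCompact isOpen_ball]
      intro K hK hKc
      rw [Metric.tendstoUniformlyOn_iff]
      intro η hη
      filter_upwards [hNev, hconv K (hK.trans hball) hKc (η / (1 + R ^ 2)) (by positivity)] with n hn h z hz
      have h1 := hN _ hn z (hK hz)
      have h2 := hLc z (hK hz)
      have h3 := le_chord_mobInv hp (mob_bound hp ht0 ht _ h1) (mob_bound hp ht0 ht _ h2)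
      rw [mobInv_mob hp ht0 ht _ h1, mobInv_mob hp ht0 ht _ h2, ← hR] at h3
      have h4 := (lt_div_iff₀ (by positivity)).1 (h z hz)
      rw [dist_comm, dist_eq_norm]
      linarith
    · filter_upwards [hNev] with n hn w hw
      exact ((hA _ w (hball hw)).mob_diff hp ht0 ht (hN _ hn w hw)).differentiableWithinAt
  refine locRat_mobInv (hg.analyticAt (ball_mem_nhds z0 hr)) hp ?_
  filter_upwards [ball_mem_nhds z0 hr] with w hw
  exact (mobInv_mob hp ht0 ht _ (hLc w hw)).symm

lemma LocRat.congr {A B : ℂ → OnePoint ℂ} {z : ℂ} (h : LocRat A z) (hAB : ∀ᶠ w in 𝓝 z, B w = A w) :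
    LocRat B z := by
  obtain ⟨x, y, hx, hy, h0, hA⟩ := h
  refine ⟨x, y, hx, hy, h0, ?_⟩
  filter_upwards [hA, hAB] with w h1 h2
  rw [h2, h1]

lemma locRat_of_mero {D : Set ℂ} (hD : IsOpen D) {A : ℂ → OnePoint ℂ} (h : IsMeroSphereOrInf D A) :
    ∀ z ∈ D, LocRat A z := by
  intro z hz
  rcases h with ⟨a, ha, h⟩ | h
  · refine (locRat_sphVal (ha z hz)).congr ?_
    filter_upwards [hD.mem_nhds hz] with w hw using h w hw
  · refine ⟨fun _ => 1, fun _ => 0, analyticAt_const, analyticAt_const, by simp, ?_⟩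
    filter_upwards [hD.mem_nhds hz] with w hw
    rw [h w hw, pt_inf]

theorem normal_of_close_to_normal
    (D : Set ℂ) (hD : IsOpen D) (hDc : IsPreconnected D)
    (G : Set ((ℂ → ℂ) × (ℂ → ℂ)))
    (hG : ∀ p ∈ G, MeromorphicOn p.1 D ∧ MeromorphicOn p.2 D)
    (ε : ℝ) (hε : 0 < ε) (hεπ : ε < Real.pi)
    (hclose : ∀ p ∈ G, ∀ z ∈ D, sph (sphVal p.1 z) (sphVal p.2 z) < ε)
    (hb : NormalOn D (Prod.snd '' G)) :
    NormalOn D (Prod.fst '' G) := by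
  intro f hf
  choose p hpG hpf using hf
  obtain ⟨φ, hφ, B, hB, hBconv⟩ := hb (fun n => (p n).2) (fun n => ⟨p n, hpG n, rfl⟩)
  have hBr := locRat_of_mero hD hB
  set s := Real.sin (ε / 2) with hs
  have hs0 : 0 < s := Real.sin_pos_of_pos_of_lt_pi (by linarith) (by linarith)
  have hs1 : s < 1 := by
    rw [hs, ← Real.sin_pi_div_two]
    exact Real.sin_lt_sin_of_lt_of_le_pi_div_two (by linarith) le_rfl (by linarith)
  obtain ⟨ψ, hψ, L, hL, hLconv⟩ := sphere_core hD (fun n => sphVal (p (φ n)).1)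
    (fun n z hz => locRat_sphVal ((hG _ (hpG _)).1 z hz)) (t := (1 + s) / 2) (by linarith) (by linarith) (by
      intro z0 hz0
      have h1 : ∀ᶠ w in 𝓝 z0, chord (B w) (B z0) < (1 - s) / 2 :=
        (hBr z0 hz0).continuous.eventually_lt_const (by linarith)
      obtain ⟨r, hr, hrb⟩ := Metric.nhds_basis_closedBall.mem_iff.1 (inter_mem h1 (hD.mem_nhds hz0))
      have hrD : closedBall z0 r ⊆ D := fun w hw => (hrb hw).2
      obtain ⟨N, hN⟩ := eventually_atTop.1
        (hBconv _ hrD (isCompact_closedBall z0 r) ((1 - s) / 2) (by linarith))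
      refine ⟨B z0, r, hr, ball_subset_closedBall.trans hrD, N, fun n hn z hz => ?_⟩
      have hz' := ball_subset_closedBall hz
      have e1 := (sph_lt_iff hε hεπ).1 (hclose _ (hpG (φ n)) z (hrD hz'))
      have e2 := chord_lt_of_sph_lt (hN n hn z hz')
      have e3 : chord (B z) (B z0) < (1 - s) / 2 := (hrb hz').1
      have t1 := chord_triangle (sphVal (p (φ n)).1 z) (sphVal (p (φ n)).2 z) (B z0)
      have t2 := chord_triangle (sphVal (p (φ n)).2 z) (B z) (B z0)
      linarith)
  refine ⟨φ ∘ ψ, hφ.comp hψ, L, mero_of_locRat hDc hL, ?_⟩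
  intro K hK hKc η hη
  obtain ⟨η', hη', h⟩ := sph_lt_of_chord hη
  filter_upwards [hLconv K hK hKc η' hη'] with n hn z hz
  rw [← hpf]
  exact h _ _ (hn z hz)
end
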